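/- There exists a bounded linear operator L₁ : H²(ℝ)×H¹(ℝ) → H^{5/2}(ℝ²) such that (i) [L₁(φ,ψ)](t,0) = φ(t) for all t ∈ ℝ, (ii) [∂L₁(φ,ψ)/∂x₂](t,0) = ψ(t) for all t ∈ ℝ, and (iii) L₁(φ,ψ)(x₁,x₂) vanishes on the half plane x₁ < 0 whenever φ(t) and ψ(t) vanish on the half line t < 0. -/

import Mathlib

open MeasureTheory Real Set
open scoped RealInnerProductSpace
noncomputable section

abbrev E2 := EuclideanSpace ℝ (Fin 2)
def stdb2 (i : Fin 2) : E2 := EuclideanSpace.single i 1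
def L2on {n : ℕ} (Ω : Set (EuclideanSpace ℝ (Fin n))) (u : EuclideanSpace ℝ (Fin n) → ℝ) : Prop :=
  MemLp u 2 (volume.restrict Ω)
def IsWeakD {n : ℕ} (Ω : Set (EuclideanSpace ℝ (Fin n)))
    (u v : EuclideanSpace ℝ (Fin n) → ℝ) (d : EuclideanSpace ℝ (Fin n)) : Prop :=
  ∀ φ : EuclideanSpace ℝ (Fin n) → ℝ, ContDiff ℝ (⊤ : ℕ∞) φ → HasCompactSupport φ → tsupport φ ⊆ Ω →
    ∫ x in Ω, u x * fderiv ℝ φ x d = - ∫ x in Ω, v x * φ x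
def tri (p : Fin 3 → E2) : Set E2 := interior (convexHull ℝ (range p))
def evec (p : Fin 3 → E2) (i : Fin 3) : E2 := p (i + 2) - p (i + 1)
def elen (p : Fin 3 → E2) (i : Fin 3) : ℝ := ‖evec p i‖
def tangv (p : Fin 3 → E2) (i : Fin 3) : E2 := (elen p i)⁻¹ • evec p i
def norv (p : Fin 3 → E2) (i : Fin 3) : E2 :=
  EuclideanSpace.single 0 (tangv p i 1) + EuclideanSpace.single 1 (-(tangv p i 0))
def epar (p : Fin 3 → E2) (i : Fin 3) (t : ℝ) : E2 := p (i + 1) + t • evec p i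
def ccw (p : Fin 3 → E2) : Prop :=
  0 < (p 1 - p 0) 0 * (p 2 - p 0) 1 - (p 1 - p 0) 1 * (p 2 - p 0) 0
def tau (i j : Fin 3) : ℝ := if i = j + 1 then 0 else 1

/-- weak derivative on an open interval of `ℝ` -/
def IsWeakD1 (S : Set ℝ) (u v : ℝ → ℝ) : Prop :=
  ∀ φ : ℝ → ℝ, ContDiff ℝ (⊤ : ℕ∞) φ → HasCompactSupport φ → tsupport φ ⊆ S →
    ∫ t in S, u t * deriv φ t = - ∫ t in S, v t * φ t

def MemHedge : ℕ → (ℝ → ℝ) → Prop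
  | 0, u => MemLp u 2 (volume.restrict (Ioo (0:ℝ) 1))
  | (k+1), u => MemLp u 2 (volume.restrict (Ioo (0:ℝ) 1)) ∧
      ∃ v, IsWeakD1 (Ioo (0:ℝ) 1) u v ∧ MemHedge k v

/-- membership of edgewise data in `H²(∂T) × H¹(∂T)` (with pointwise C¹/C⁰ representatives) -/
def MemBdryH2H1 (f g : Fin 3 → ℝ → ℝ) : Prop :=
  ∀ i, MemHedge 2 (f i) ∧ ContDiffOn ℝ 1 (f i) (Icc 0 1) ∧
    MemHedge 1 (g i) ∧ ContinuousOn (g i) (Icc 0 1)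

/-- compatibility conditions (2.2)-(2.4) -/
def Compat (p : Fin 3 → E2) (f g : Fin 3 → ℝ → ℝ) : Prop :=
  (∀ i j k : Fin 3, j ≠ i → k ≠ i → f j (tau i j) = f k (tau i k)) ∧
  ∃ w : Fin 3 → E2, ∀ i j : Fin 3, j ≠ i →
    derivWithin (f j) (Icc 0 1) (tau i j) = elen p j * ⟪w i, tangv p j⟫ ∧
    g j (tau i j) = ⟪w i, norv p j⟫

/-- `H²` membership with explicit weak gradient and Hessian data -/
def MemH2W {n : ℕ} (Ω : Set (EuclideanSpace ℝ (Fin n))) (ξ : EuclideanSpace ℝ (Fin n) → ℝ)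
    (G : Fin n → EuclideanSpace ℝ (Fin n) → ℝ)
    (Hs : Fin n → Fin n → EuclideanSpace ℝ (Fin n) → ℝ) : Prop :=
  L2on Ω ξ ∧ (∀ d, L2on Ω (G d) ∧ IsWeakD Ω ξ (G d) (EuclideanSpace.single d 1)) ∧
  ∀ d d', L2on Ω (Hs d d') ∧ IsWeakD Ω (G d) (Hs d d') (EuclideanSpace.single d' 1)

/-- Gagliardo-type `H^{1/2}` seminorm finiteness for functions on a domain in `ℝⁿ` -/
def GagH12 {n : ℕ} (Ω : Set (EuclideanSpace ℝ (Fin n))) (u : EuclideanSpace ℝ (Fin n) → ℝ) : Prop :=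
  Integrable (fun q : EuclideanSpace ℝ (Fin n) × EuclideanSpace ℝ (Fin n) =>
    (u q.1 - u q.2) ^ 2 / ‖q.1 - q.2‖ ^ (n + 1)) ((volume.restrict Ω).prod (volume.restrict Ω))

/-- membership in `H^{5/2}` of a domain: weak `H²` data whose second derivatives have finite
`H^{1/2}` Gagliardo seminorm. -/
def MemH52 {n : ℕ} (Ω : Set (EuclideanSpace ℝ (Fin n))) (ζ : EuclideanSpace ℝ (Fin n) → ℝ) : Prop :=
  ∃ G Hs, MemH2W Ω ζ G Hs ∧ ∀ d d', GagH12 Ω (Hs d d')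

/-- pointwise trace relation `Tr ζ = (f,g)` on `∂T` for a `C¹` function -/
def TraceEq (p : Fin 3 → E2) (ζ : E2 → ℝ) (f g : Fin 3 → ℝ → ℝ) : Prop :=
  ∀ i : Fin 3, ∀ t ∈ Icc (0:ℝ) 1,
    ζ (epar p i t) = f i t ∧ fderiv ℝ ζ (epar p i t) (norv p i) = g i t

/-- membership in `H²(ℝ)` with explicit weak first and second derivatives -/
def MemH2line (φ φ₁ φ₂ : ℝ → ℝ) : Prop :=
  MemLp φ 2 (volume : Measure ℝ) ∧ MemLp φ₁ 2 (volume : Measure ℝ) ∧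
    MemLp φ₂ 2 (volume : Measure ℝ) ∧
    IsWeakD1 univ φ φ₁ ∧ IsWeakD1 univ φ₁ φ₂

/-- membership in `H¹(ℝ)` with explicit weak derivative -/
def MemH1line (ψ ψ₁ : ℝ → ℝ) : Prop :=
  MemLp ψ 2 (volume : Measure ℝ) ∧ MemLp ψ₁ 2 (volume : Measure ℝ) ∧ IsWeakD1 univ ψ ψ₁

/-- the squared Gagliardo `H^{1/2}` seminorm of `u` on `Ω ⊆ ℝⁿ` -/
def GagSqVal {n : ℕ} (Ω : Set (EuclideanSpace ℝ (Fin n))) (u : EuclideanSpace ℝ (Fin n) → ℝ) : ℝ :=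
  ∫ q, (u q.1 - u q.2) ^ 2 / ‖q.1 - q.2‖ ^ (n + 1)
    ∂((volume.restrict Ω).prod (volume.restrict Ω))

set_option linter.unusedVariables false

def TT (m f : ℝ → ℝ) (x y : ℝ) : ℝ := ∫ s, f (x - y * s) * m s
def ACor (f : ℝ → ℝ) (t : ℝ) : ℝ := ∫ x, f x * f (x - t)

lemma int_sq {f : ℝ → ℝ} (hf2 : MemLp f 2 (volume : Measure ℝ)) : Integrable (fun x => f x ^ 2) :=
  hf2.integrable_sq

lemma int_tri {f κ : ℝ → ℝ} (hf : Measurable f) (hf2 : MemLp f 2 (volume : Measure ℝ))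
    (hκm : Measurable κ) (hκ : Integrable κ) (y : ℝ) :
    Integrable (fun p : ℝ × (ℝ × ℝ) => (f (p.1 - y * p.2.1) * κ p.2.1) *
      (f (p.1 - y * p.2.2) * κ p.2.2)) := by
  have hs := int_sq hf2
  have key : ∀ g : ℝ × ℝ → ℝ, Measurable g →
      Integrable (fun p : ℝ × (ℝ × ℝ) => f (p.1 - g p.2) ^ 2 * (κ p.2.1 * κ p.2.2)) := by
    intro g hg
    have hm : AEStronglyMeasurable (fun p : ℝ × (ℝ × ℝ) =>
        f (p.1 - g p.2) ^ 2 * (κ p.2.1 * κ p.2.2)) (volume.prod (volume : Measure (ℝ × ℝ))) := by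
      apply Measurable.aestronglyMeasurable
      fun_prop
    rw [Measure.volume_eq_prod]
    rw [integrable_prod_iff' hm]
    refine ⟨Filter.Eventually.of_forall fun q => ?_, ?_⟩
    · exact (hs.comp_sub_right (g q)).mul_const (κ q.1 * κ q.2)
    · have : (fun q : ℝ × ℝ => ∫ x, ‖f (x - g q) ^ 2 * (κ q.1 * κ q.2)‖)
          = fun q => (∫ x, f x ^ 2) * (‖κ q.1‖ * ‖κ q.2‖) := by
        funext q
        simp only [norm_mul]
        rw [integral_mul_const]
        congr 1
        rw [← integral_sub_right_eq_self (fun x => f x ^ 2) (g q)]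
        simp
      simp only
      rw [this]
      exact (hκ.norm.mul_prod hκ.norm).const_mul _
  have h1 := (key (fun q => y * q.1) (by fun_prop)).norm.add (key (fun q => y * q.2) (by fun_prop)).norm
  refine h1.mono' (Measurable.aestronglyMeasurable (by fun_prop)) (Filter.Eventually.of_forall fun p => ?_)
  simp only [Pi.add_apply, norm_mul, Real.norm_eq_abs, norm_pow]
  have e1 := sq_nonneg (|f (p.1 - y * p.2.1)| - |f (p.1 - y * p.2.2)|)
  have e2 : 0 ≤ |κ p.2.1| * |κ p.2.2| := by positivity
  nlinarith [mul_nonneg e1 e2, mul_nonneg (sq_nonneg |f (p.1 - y * p.2.1)|) e2,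
    mul_nonneg (sq_nonneg |f (p.1 - y * p.2.2)|) e2]

lemma acor_meas {f : ℝ → ℝ} (hf : Measurable f) : Measurable (ACor f) := by
  have : StronglyMeasurable (Function.uncurry fun t x : ℝ => f x * f (x - t)) :=
    Measurable.stronglyMeasurable (by fun_prop)
  exact this.integral_prod_right.measurable

lemma acor_le {f : ℝ → ℝ} (hf2 : MemLp f 2 (volume : Measure ℝ)) (t : ℝ) :
    |ACor f t| ≤ ∫ x, f x ^ 2 := by
  have hs := int_sq hf2
  have hs' := hs.comp_sub_right t
  have e : ∫ x, f (x - t) ^ 2 = ∫ x, f x ^ 2 := integral_sub_right_eq_self (fun x => f x ^ 2) t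
  calc |ACor f t| ≤ ∫ x, (f x ^ 2 + f (x - t) ^ 2) / 2 := by
        unfold ACor
        rw [← Real.norm_eq_abs]
        refine norm_integral_le_of_norm_le ((hs.add hs').div_const 2) (Filter.Eventually.of_forall fun x => ?_)
        rw [norm_mul, Real.norm_eq_abs, Real.norm_eq_abs]
        nlinarith [sq_nonneg (|f x| - |f (x - t)|), sq_abs (f x), sq_abs (f (x - t))]
    _ = _ := by
        rw [integral_div, integral_add hs hs', e]; ring

lemma acor_neg (f : ℝ → ℝ) (t : ℝ) : ACor f (-t) = ACor f t := by
  unfold ACor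
  rw [← integral_sub_right_eq_self (fun x => f x * f (x - -t)) t]
  congr 1; funext x
  simp [mul_comm]

lemma acor_abs (f : ℝ → ℝ) (t : ℝ) : ACor f |t| = ACor f t := by
  rcases abs_choice t with h | h <;> rw [h]
  exact acor_neg f t

lemma TT_sq (f κ : ℝ → ℝ) (x y : ℝ) : TT κ f x y ^ 2 =
    ∫ q : ℝ × ℝ, (f (x - y * q.1) * κ q.1) * (f (x - y * q.2) * κ q.2) := by
  unfold TT
  rw [sq, Measure.volume_eq_prod,
    integral_prod_mul (fun s => f (x - y * s) * κ s) (fun s => f (x - y * s) * κ s)]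

lemma TT_sq_integrable {f κ : ℝ → ℝ} (hf : Measurable f) (hf2 : MemLp f 2 (volume : Measure ℝ))
    (hκm : Measurable κ) (hκ : Integrable κ) (y : ℝ) :
    Integrable (fun x => TT κ f x y ^ 2) := by
  simp only [TT_sq]
  exact (int_tri hf hf2 hκm hκ y).integral_prod_left

lemma TT_sq_integral {f κ : ℝ → ℝ} (hf : Measurable f) (hf2 : MemLp f 2 (volume : Measure ℝ))
    (hκm : Measurable κ) (hκ : Integrable κ) (y : ℝ) :
    ∫ x, TT κ f x y ^ 2 = ∫ q : ℝ × ℝ, κ q.1 * κ q.2 * ACor f (y * (q.1 - q.2)) := by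
  simp only [TT_sq]
  rw [integral_integral_swap (int_tri hf hf2 hκm hκ y)]
  congr 1; funext q
  rw [← acor_neg]
  unfold ACor
  rw [← integral_sub_right_eq_self (fun x => f x * f (x - -(y * (q.1 - q.2)))) (y * q.1), ← integral_const_mul]
  congr 1; funext x
  have : x - y * q.1 - -(y * (q.1 - q.2)) = x - y * q.2 := by ring
  rw [this]; ring

lemma TT_sq_bound {f κ : ℝ → ℝ} (hf : Measurable f) (hf2 : MemLp f 2 (volume : Measure ℝ))
    (hκm : Measurable κ) (hκ : Integrable κ) (y : ℝ) :
    ∫ x, TT κ f x y ^ 2 ≤ (∫ s, |κ s|) ^ 2 * ∫ x, f x ^ 2 := by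
  rw [TT_sq_integral hf hf2 hκm hκ y]
  have h := hκ.norm.mul_prod hκ.norm
  refine (le_abs_self _).trans ?_
  rw [← Real.norm_eq_abs]
  calc _ ≤ ∫ q : ℝ × ℝ, ‖κ q.1‖ * ‖κ q.2‖ * ∫ x, f x ^ 2 := by
        refine norm_integral_le_of_norm_le (h.mul_const _) (Filter.Eventually.of_forall fun q => ?_)
        rw [norm_mul, norm_mul]
        exact mul_le_mul_of_nonneg_left (acor_le hf2 _) (by positivity)
    _ = _ := by
        rw [integral_mul_const, Measure.volume_eq_prod,
          integral_prod_mul (fun s => ‖κ s‖) (fun s => ‖κ s‖), sq]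
        simp [Real.norm_eq_abs]

/-- the log-kernel constant -/
def KL (κ : ℝ → ℝ) : ℝ := ∫ q : ℝ × ℝ, |κ q.1| * |κ q.2| * |Real.log (q.1 - q.2)|

lemma acor_log {f : ℝ → ℝ} (hf : Measurable f) (hf2 : MemLp f 2 (volume : Measure ℝ))
    {a τ : ℝ} (ha : 0 < a) (hτ : 0 < τ) :
    |∫ t in a..(a * τ), ACor f t / t| ≤ (∫ x, f x ^ 2) * |Real.log τ| := by
  have h1 : ∫ t in a..(a * τ), t⁻¹ = Real.log τ := by
    rw [integral_inv_of_pos ha (by positivity)]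
    congr 1; field_simp
  have hN : 0 ≤ ∫ x, f x ^ 2 := integral_nonneg fun x => sq_nonneg _
  rw [← h1, ← Real.norm_eq_abs]
  have h0 : (0:ℝ) ∉ uIcc a (a * τ) := by
    intro h
    have := h.1
    have h3 : 0 < min a (a * τ) := lt_min ha (by positivity)
    exact absurd (lt_of_lt_of_le h3 this) (lt_irrefl _)
  have := intervalIntegral.norm_integral_le_abs_of_norm_le (f := fun t => ACor f t / t)
    (g := fun t => (∫ x, f x ^ 2) * t⁻¹) (a := a) (b := a * τ) (μ := volume) ?_ ?_
  · refine this.trans ?_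
    rw [intervalIntegral.integral_const_mul, abs_mul, abs_of_nonneg hN]
  · refine ae_restrict_of_forall_mem measurableSet_uIoc fun t ht => ?_
    have ht0 : 0 < t := lt_trans (lt_min ha (by positivity)) ht.1
    rw [norm_div, div_eq_mul_inv, Real.norm_eq_abs, Real.norm_eq_abs, abs_of_pos ht0]
    exact mul_le_mul_of_nonneg_right (acor_le hf2 t) (by positivity)
  · apply IntervalIntegrable.const_mul
    exact intervalIntegrable_inv_iff.2 (Or.inr h0)

lemma acor_ii {f : ℝ → ℝ} (hf : Measurable f) (hf2 : MemLp f 2 (volume : Measure ℝ))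
    {a b : ℝ} (ha : 0 < a) (hb : 0 < b) :
    IntervalIntegrable (fun t => ACor f t / t) volume a b := by
  have h0 : (0:ℝ) ∉ uIcc a b := fun h => absurd (lt_of_lt_of_le (lt_min ha hb) h.1) (lt_irrefl _)
  have h1 : IntervalIntegrable (fun t : ℝ => (∫ x, f x ^ 2) * t⁻¹) volume a b :=
    (intervalIntegrable_inv_iff.2 (Or.inr h0)).const_mul _
  refine h1.mono_fun ((acor_meas hf).div measurable_id).aestronglyMeasurable ?_
  refine Filter.Eventually.of_forall fun t => ?_
  simp only [norm_div, norm_mul, norm_inv]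
  rw [div_eq_mul_inv]
  refine mul_le_mul_of_nonneg_right ((acor_le hf2 t).trans (le_abs_self _)) (by positivity)

lemma acor_diff {f : ℝ → ℝ} (hf : Measurable f) (hf2 : MemLp f 2 (volume : Measure ℝ))
    {a b τ : ℝ} (ha : 0 < a) (hb : 0 < b) (hτ : 0 < τ) :
    |(∫ y in a..b, ACor f (y * τ) / y) - ∫ y in a..b, ACor f y / y| ≤
      2 * (∫ x, f x ^ 2) * |Real.log τ| := by
  have e1 : ∫ y in a..b, ACor f (y * τ) / y = ∫ t in (a * τ)..(b * τ), ACor f t / t := by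
    have h := intervalIntegral.integral_comp_mul_right (a := a) (b := b)
      (fun t => ACor f t / t) hτ.ne'
    have h' : ∫ t in (a * τ)..(b * τ), ACor f t / t = τ * ∫ y in a..b, ACor f (y * τ) / (y * τ) := by
      rw [h, smul_eq_mul]; field_simp
    rw [h', ← intervalIntegral.integral_const_mul]
    congr 1; funext y
    by_cases hy : y = 0
    · simp [hy]
    · field_simp
  have ii := fun {u v : ℝ} (hu : 0 < u) (hv : 0 < v) => acor_ii hf hf2 hu hv
  have haτ : 0 < a * τ := by positivity
  have hbτ : 0 < b * τ := by positivity
  have e2 : ∫ t in (a * τ)..(b * τ), ACor f t / t = -(∫ t in a..(a * τ), ACor f t / t)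
      + (∫ t in a..b, ACor f t / t) + ∫ t in b..(b*τ), ACor f t / t := by
    rw [← intervalIntegral.integral_symm, intervalIntegral.integral_add_adjacent_intervals (ii haτ ha) (ii ha hb),
      intervalIntegral.integral_add_adjacent_intervals (ii haτ hb) (ii hb hbτ)]
  rw [e1, e2]
  have := acor_log hf hf2 ha hτ
  have := acor_log hf hf2 hb hτ
  rw [abs_le] at *
  constructor <;> linarith

lemma SQ_trunc {f κ : ℝ → ℝ} (hf : Measurable f) (hf2 : MemLp f 2 (volume : Measure ℝ))
    (hκm : Measurable κ) (hκ : Integrable κ) (h0 : ∫ s, κ s = 0)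
    (hK : Integrable (fun q : ℝ × ℝ => |κ q.1| * |κ q.2| * |Real.log (q.1 - q.2)|))
    {a b : ℝ} (ha : 0 < a) (hab : a ≤ b) :
    IntegrableOn (fun y => (∫ x, TT κ f x y ^ 2) / y) (Ioc a b) ∧
    ∫ y in Ioc a b, (∫ x, TT κ f x y ^ 2) / y ≤ 2 * (∫ x, f x ^ 2) * KL κ := by
  have hb : 0 < b := ha.trans_le hab
  simp only [TT_sq_integral hf hf2 hκm hκ]
  have hAm := acor_meas hf
  have hInt9 : Integrable (Function.uncurry fun (y : ℝ) (q : ℝ × ℝ) =>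
      κ q.1 * κ q.2 * ACor f (y * (q.1 - q.2)) / y) ((volume.restrict (Ioc a b)).prod volume) := by
    have hc : Integrable (fun y : ℝ => (∫ x, f x ^ 2) * y⁻¹) (volume.restrict (Ioc a b)) := by
      have h0 : (0:ℝ) ∉ uIcc a b := fun h => absurd (lt_of_lt_of_le (lt_min ha hb) h.1) (lt_irrefl _)
      have h1 : IntervalIntegrable (fun t : ℝ => (∫ x, f x ^ 2) * t⁻¹) volume a b :=
        (intervalIntegrable_inv_iff.2 (Or.inr h0)).const_mul _
      exact (intervalIntegrable_iff_integrableOn_Ioc_of_le hab).1 h1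
    have h1 := hc.mul_prod (hκ.mul_prod hκ)
    refine h1.mono (Measurable.aestronglyMeasurable (by fun_prop)) (Filter.Eventually.of_forall fun p => ?_)
    simp only [Function.uncurry, norm_mul, norm_div, norm_inv]
    have := (acor_le hf2 (p.1 * (p.2.1 - p.2.2))).trans (le_abs_self _)
    rw [← Real.norm_eq_abs, ← Real.norm_eq_abs] at this
    calc _ = ‖ACor f (p.1 * (p.2.1 - p.2.2))‖ * ‖p.1‖⁻¹ * (‖κ p.2.1‖ * ‖κ p.2.2‖) := by
          rw [div_eq_mul_inv]; ring
      _ ≤ _ := by gcongr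
  have e : ∀ y, (∫ q : ℝ × ℝ, κ q.1 * κ q.2 * ACor f (y * (q.1 - q.2))) / y =
      ∫ q : ℝ × ℝ, κ q.1 * κ q.2 * ACor f (y * (q.1 - q.2)) / y := fun y => (integral_div _ _).symm
  simp only [e]
  refine ⟨hInt9.integral_prod_left, ?_⟩
  rw [integral_integral_swap hInt9]
  have e2 : ∀ q : ℝ × ℝ, ∫ y in Ioc a b, κ q.1 * κ q.2 * ACor f (y * (q.1 - q.2)) / y
      = κ q.1 * κ q.2 * ∫ y in a..b, ACor f (y * |q.1 - q.2|) / y := by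
    intro q
    rw [intervalIntegral.integral_of_le hab, ← integral_const_mul]
    refine setIntegral_congr_fun measurableSet_Ioc fun y hy => ?_
    have hy0 : 0 < y := ha.trans hy.1
    rw [← acor_abs f (y * (q.1 - q.2)), abs_mul, abs_of_pos hy0]; ring
  have i1 : Integrable (fun q : ℝ × ℝ => κ q.1 * κ q.2 * ∫ y in a..b, ACor f (y * |q.1 - q.2|) / y) := by
    have := hInt9.integral_prod_right
    simp only [Function.uncurry] at this
    simpa only [e2] using this
  simp only [e2]
  set c := ∫ y in a..b, ACor f y / y with hc
  have i2 : Integrable (fun q : ℝ × ℝ => κ q.1 * κ q.2 * c) := (hκ.mul_prod hκ).mul_const c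
  have z : ∫ q : ℝ × ℝ, κ q.1 * κ q.2 * c = 0 := by
    rw [integral_mul_const, Measure.volume_eq_prod, integral_prod_mul κ κ, h0]; simp
  rw [← sub_zero (∫ q : ℝ × ℝ, κ q.1 * κ q.2 * ∫ y in a..b, ACor f (y * |q.1 - q.2|) / y), ← z,
    ← integral_sub i1 i2]
  refine (le_abs_self _).trans ?_
  rw [KL, ← integral_const_mul, ← Real.norm_eq_abs]
  refine norm_integral_le_of_norm_le (hK.const_mul _) ?_
  have hd : ∀ᵐ q : ℝ × ℝ, q.1 ≠ q.2 := by
    rw [Measure.volume_eq_prod]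
    rw [Measure.ae_prod_iff_ae_ae (p := fun q : ℝ × ℝ => q.1 ≠ q.2)
      (measurableSet_eq_fun measurable_fst measurable_snd).compl]
    refine Filter.Eventually.of_forall fun x => ?_
    have : ∀ᵐ y : ℝ, y ≠ x := by simp [ae_iff]
    filter_upwards [this] with y hy using hy.symm
  filter_upwards [hd] with q hq
  have hτ : 0 < |q.1 - q.2| := abs_pos.2 (sub_ne_zero.2 hq)
  have := acor_diff hf hf2 ha hb hτ
  rw [Real.log_abs] at this
  rw [← mul_sub, norm_mul, norm_mul]
  simp only [Real.norm_eq_abs]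
  calc _ ≤ |κ q.1| * |κ q.2| * (2 * (∫ x, f x ^ 2) * |Real.log (q.1 - q.2)|) := by gcongr
    _ = _ := by ring

lemma TT_meas {f m : ℝ → ℝ} (hf : Measurable f) (hm : Measurable m) :
    Measurable (fun p : ℝ × ℝ => TT m f p.1 p.2) := by
  have : StronglyMeasurable (Function.uncurry fun (p : ℝ × ℝ) (s : ℝ) => f (p.1 - p.2 * s) * m s) :=
    Measurable.stronglyMeasurable (by fun_prop)
  exact this.integral_prod_right.measurable

lemma TT_lint {f κ : ℝ → ℝ} (hf : Measurable f) (hf2 : MemLp f 2 (volume : Measure ℝ))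
    (hκm : Measurable κ) (hκ : Integrable κ) (y : ℝ) :
    ∫⁻ x, ENNReal.ofReal (TT κ f x y ^ 2) = ENNReal.ofReal (∫ x, TT κ f x y ^ 2) :=
  (ofReal_integral_eq_lintegral_ofReal (TT_sq_integrable hf hf2 hκm hκ y)
    (Filter.Eventually.of_forall fun x => sq_nonneg _)).symm

lemma SQ_pos {f κ : ℝ → ℝ} (hf : Measurable f) (hf2 : MemLp f 2 (volume : Measure ℝ))
    (hκm : Measurable κ) (hκ : Integrable κ) (h0 : ∫ s, κ s = 0)
    (hK : Integrable (fun q : ℝ × ℝ => |κ q.1| * |κ q.2| * |Real.log (q.1 - q.2)|)) :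
    ∫⁻ y in Ioi (0:ℝ), ENNReal.ofReal ((∫ x, TT κ f x y ^ 2) / |y|) ≤
      ENNReal.ofReal (2 * (∫ x, f x ^ 2) * KL κ) := by
  have hms : Measurable fun y => ENNReal.ofReal ((∫ x, TT κ f x y ^ 2) / |y|) := by
    have h1 : StronglyMeasurable (Function.uncurry fun (y x : ℝ) => TT κ f x y ^ 2) := by
      have := ((TT_meas hf hκm).comp measurable_swap).pow_const 2
      exact this.stronglyMeasurable
    have h2 := (h1.integral_prod_right (ν := (volume : Measure ℝ))).measurable
    have h3 : Measurable fun y : ℝ => |y| := continuous_abs.measurable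
    exact (h2.div h3).ennreal_ofReal
  have hcov : AECover (volume.restrict (Ioi (0:ℝ))) Filter.atTop
      (fun n : ℕ => Ioc ((1:ℝ) / ((n:ℝ) + 1)) n) := by
    have hA : Filter.Tendsto (fun n : ℕ => (1:ℝ) / ((n:ℝ) + 1)) Filter.atTop (nhds 0) :=
      tendsto_one_div_add_atTop_nhds_zero_nat
    refine ⟨?_, fun _ => measurableSet_Ioc⟩
    refine ae_restrict_of_forall_mem measurableSet_Ioi fun x hx => ?_
    filter_upwards [hA.eventually (gt_mem_nhds hx), tendsto_natCast_atTop_atTop.eventually_ge_atTop x] with n h1 h2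
    exact ⟨h1, h2⟩
  have ht := hcov.lintegral_tendsto_of_countably_generated hms.aemeasurable
  refine le_of_tendsto ht ?_
  filter_upwards [Filter.eventually_ge_atTop 1] with n hn
  have hn' : (1:ℝ) ≤ n := by exact_mod_cast hn
  have hp : (0:ℝ) < 1 / ((n:ℝ) + 1) := by positivity
  have hab : (1:ℝ) / ((n:ℝ) + 1) ≤ n := by
    rw [div_le_iff₀ (by positivity)]; nlinarith
  obtain ⟨h1, h2⟩ := SQ_trunc hf hf2 hκm hκ h0 hK hp hab
  rw [Measure.restrict_restrict measurableSet_Ioc]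
  have hsub : Ioc ((1:ℝ) / ((n:ℝ) + 1)) n ∩ Ioi 0 = Ioc ((1:ℝ) / ((n:ℝ) + 1)) n :=
    inter_eq_left.2 fun x hx => hp.trans hx.1
  rw [hsub]
  calc _ = ∫⁻ y in Ioc ((1:ℝ) / ((n:ℝ) + 1)) n, ENNReal.ofReal ((∫ x, TT κ f x y ^ 2) / y) := by
        refine setLIntegral_congr_fun measurableSet_Ioc fun y hy => ?_
        simp only [abs_of_pos (hp.trans hy.1)]
    _ = ENNReal.ofReal (∫ y in Ioc ((1:ℝ) / ((n:ℝ) + 1)) n, (∫ x, TT κ f x y ^ 2) / y) := by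
        rw [ofReal_integral_eq_lintegral_ofReal h1]
        refine ae_restrict_of_forall_mem measurableSet_Ioc fun y hy => ?_
        exact div_nonneg (integral_nonneg fun x => sq_nonneg _) (hp.trans hy.1).le
    _ ≤ _ := ENNReal.ofReal_le_ofReal h2

lemma SQ {f κ : ℝ → ℝ} (hf : Measurable f) (hf2 : MemLp f 2 (volume : Measure ℝ))
    (hκm : Measurable κ) (hκ : Integrable κ) (h0 : ∫ s, κ s = 0)
    (hK : Integrable (fun q : ℝ × ℝ => |κ q.1| * |κ q.2| * |Real.log (q.1 - q.2)|)) :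
    ∫⁻ y, ENNReal.ofReal ((∫ x, TT κ f x y ^ 2) / |y|) ≤
      ENNReal.ofReal (4 * (∫ x, f x ^ 2) * KL κ) := by
  have h := SQ_pos hf hf2 hκm hκ h0 hK
  have hKL : 0 ≤ KL κ := integral_nonneg fun q => by positivity
  have hN : 0 ≤ ∫ x, f x ^ 2 := integral_nonneg fun x => sq_nonneg _
  set F := fun y => ENNReal.ofReal ((∫ x, TT κ f x y ^ 2) / |y|) with hF
  have hev : ∀ y, F (-y) = F y := by
    intro y
    simp only [hF, TT_sq_integral hf hf2 hκm hκ, abs_neg, neg_mul, acor_neg]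
  have h2 : ∫⁻ y in Iio (0:ℝ), F y = ∫⁻ y in Ioi (0:ℝ), F y := by
    have hmp : MeasurePreserving (fun x : ℝ => -x) volume volume := Measure.measurePreserving_neg _
    have := hmp.setLIntegral_comp_preimage_emb (MeasurableEquiv.neg ℝ).measurableEmbedding F (Iio 0)
    rw [← this]
    simp [hev]
  have h3 : ∫⁻ y, F y = (∫⁻ y in Ioi (0:ℝ), F y) + ∫⁻ y in Iio (0:ℝ), F y := by
    rw [← lintegral_add_compl F (measurableSet_Ioi (a := (0:ℝ))), compl_Ioi,
      setLIntegral_congr Iio_ae_eq_Iic]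
  change ∫⁻ y, F y ≤ _
  rw [h3, h2]
  calc _ ≤ ENNReal.ofReal (2 * (∫ x, f x ^ 2) * KL κ) + ENNReal.ofReal (2 * (∫ x, f x ^ 2) * KL κ) :=
        add_le_add h h
    _ = _ := by
        rw [← ENNReal.ofReal_add (by positivity) (by positivity)]; congr 1; ring

/-- bounded measurable kernels of bounded support -/
structure BK (m : ℝ → ℝ) (M R : ℝ) : Prop where
  meas : Measurable m
  M0 : 0 ≤ M
  R1 : 1 ≤ R
  bd : ∀ s, |m s| ≤ M
  supp : ∀ s, R < |s| → m s = 0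

def hh (t : ℝ) : ℝ := indicator (Icc (-1) 1) (fun t : ℝ => |t| ^ (-(1/2) : ℝ)) t

lemma hh_nonneg (t : ℝ) : 0 ≤ hh t := by
  unfold hh; exact indicator_nonneg (fun t _ => by positivity) t

lemma hh_integrable : Integrable hh := by
  unfold hh
  rw [show (fun t : ℝ => (Icc (-1:ℝ) 1).indicator (fun t : ℝ => |t| ^ (-(1/2) : ℝ)) t) = (Icc (-1:ℝ) 1).indicator (fun t : ℝ => |t| ^ (-(1/2) : ℝ)) from rfl]
  rw [integrable_indicator_iff measurableSet_Icc]
  have h1 : IntervalIntegrable (fun t : ℝ => t ^ (-(1/2) : ℝ)) volume 0 1 :=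
    intervalIntegral.intervalIntegrable_rpow' (by norm_num)
  have h2 : IntervalIntegrable (fun t : ℝ => |t| ^ (-(1/2) : ℝ)) volume 0 1 := by
    refine h1.congr (fun t ht => ?_)
    rw [uIoc_of_le zero_le_one] at ht
    simp only [abs_of_pos ht.1]
  have h3 : IntervalIntegrable (fun t : ℝ => |t| ^ (-(1/2) : ℝ)) volume (-1) 0 := by
    have := (IntervalIntegrable.iff_comp_neg (f := fun t : ℝ => |t| ^ (-(1/2) : ℝ)) (a := 0) (b := 1)).1 h2
    simp only [abs_neg, neg_zero] at this
    exact this.symm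
  have := h3.trans h2
  rwa [intervalIntegrable_iff_integrableOn_Icc_of_le (by norm_num)] at this

lemma hh_meas : Measurable hh := by
  unfold hh
  refine Measurable.indicator ?_ measurableSet_Icc
  exact (continuous_abs.measurable).pow_const _

lemma log_le (t : ℝ) : |Real.log t| ≤ 4 * |t| ^ (1/4 : ℝ) + 2 * hh t := by
  rw [← Real.log_abs]
  have h0 := abs_nonneg t
  rcases eq_or_lt_of_le h0 with h | h
  · rw [← h]; simp [hh_nonneg]
  rcases le_total 1 |t| with h1 | h1
  · rw [abs_of_nonneg (Real.log_nonneg h1)]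
    have := Real.log_le_rpow_div h0 (ε := 1/4) (by norm_num)
    have := hh_nonneg t
    linarith
  · rw [abs_of_nonpos (Real.log_nonpos h0 h1)]
    have h2 := Real.log_le_rpow_div (x := |t|⁻¹) (by positivity) (ε := 1/2) (by norm_num)
    rw [Real.log_inv] at h2
    have h3 : hh t = |t| ^ (-(1/2) : ℝ) := by
      unfold hh; rw [indicator_of_mem]; exact abs_le.1 h1
    rw [h3, Real.rpow_neg h0]
    rw [Real.inv_rpow h0] at h2
    have : 0 ≤ |t| ^ (1/4 : ℝ) := by positivity
    linarith

def Pot (m : ℝ → ℝ) (z : ℝ) : ENNReal := ∫⁻ s, ‖m s‖ₑ * ‖Real.log (s - z)‖ₑ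
def LK (m : ℝ → ℝ) : ENNReal := ∫⁻ s, ‖m s‖ₑ * Pot m s

lemma BK.int {m : ℝ → ℝ} {M R : ℝ} (h : BK m M R) : Integrable m := by
  have h1 : IntegrableOn (fun _ : ℝ => M) (Icc (-R) R) := by
    simp
  have h2 : Integrable ((Icc (-R) R).indicator (fun _ : ℝ => M)) := by
    rwa [integrable_indicator_iff measurableSet_Icc]
  refine h2.mono' h.meas.aestronglyMeasurable (Filter.Eventually.of_forall fun s => ?_)
  by_cases hs : s ∈ Icc (-R) R
  · rw [indicator_of_mem hs]; exact h.bd s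
  · rw [indicator_of_notMem hs, h.supp s]; · simp
    by_contra hc; exact hs (abs_le.1 (not_lt.1 hc))

lemma BK.enorm_int {m : ℝ → ℝ} {M R : ℝ} (h : BK m M R) :
    ∫⁻ s, ‖m s‖ₑ = ENNReal.ofReal (∫ s, |m s|) := by
  rw [ofReal_integral_eq_lintegral_ofReal h.int.abs (Filter.Eventually.of_forall fun s => abs_nonneg _)]
  simp only [Real.enorm_eq_ofReal_abs]

lemma hh_conv (z : ℝ) : ∫⁻ s, ENNReal.ofReal (hh (s - z)) = ENNReal.ofReal (∫ t, hh t) := by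
  rw [lintegral_sub_right_eq_self (fun s => ENNReal.ofReal (hh s)) z,
    ofReal_integral_eq_lintegral_ofReal hh_integrable (Filter.Eventually.of_forall hh_nonneg)]

lemma pot_le {m : ℝ → ℝ} {M R : ℝ} (h : BK m M R) : ∃ C, 0 ≤ C ∧ ∀ z,
    Pot m z ≤ ENNReal.ofReal (C * (1 + |z|) ^ (1/4 : ℝ)) := by
  have hH : 0 ≤ ∫ t, hh t := integral_nonneg hh_nonneg
  have hI : 0 ≤ ∫ s, |m s| := integral_nonneg fun s => abs_nonneg _
  have hM := h.M0
  have hR := h.R1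
  refine ⟨(∫ s, |m s|) * (4 * R) + 2 * M * (∫ t, hh t), by positivity, fun z => ?_⟩
  have h1z : 1 ≤ (1 + |z|) ^ (1/4 : ℝ) := Real.one_le_rpow (by linarith [abs_nonneg z]) (by norm_num)
  calc Pot m z ≤ ∫⁻ s, (‖m s‖ₑ * ENNReal.ofReal (4 * R * (1 + |z|) ^ (1/4 : ℝ)) +
        ENNReal.ofReal (2 * M) * ENNReal.ofReal (hh (s - z))) := by
        refine lintegral_mono fun s => ?_
        simp only [Real.enorm_eq_ofReal_abs]
        rw [← ENNReal.ofReal_mul (abs_nonneg _), ← ENNReal.ofReal_mul (abs_nonneg _), ← ENNReal.ofReal_mul (by positivity),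
          ← ENNReal.ofReal_add (by positivity) (mul_nonneg (by positivity) (hh_nonneg _))]
        apply ENNReal.ofReal_le_ofReal
        by_cases hs : R < |s|
        · rw [h.supp s hs]; simp; exact mul_nonneg (by positivity) (hh_nonneg _)
        · push Not at hs
          have e1 : |s - z| ^ (1/4 : ℝ) ≤ R * (1 + |z|) ^ (1/4 : ℝ) := by
            calc |s - z| ^ (1/4 : ℝ) ≤ (R * (1 + |z|)) ^ (1/4 : ℝ) := by
                  apply Real.rpow_le_rpow (abs_nonneg _) _ (by norm_num)
                  have := abs_sub s z
                  nlinarith [abs_nonneg z]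
              _ = R ^ (1/4 : ℝ) * (1 + |z|) ^ (1/4 : ℝ) := Real.mul_rpow (by linarith) (by positivity)
              _ ≤ _ := by
                  gcongr
                  calc R ^ (1/4 : ℝ) ≤ R ^ (1 : ℝ) := Real.rpow_le_rpow_of_exponent_le hR (by norm_num)
                    _ = R := Real.rpow_one R
          have e2 := log_le (s - z)
          have e3 := h.bd s
          have e4 := hh_nonneg (s - z)
          calc |m s| * |Real.log (s - z)| ≤ |m s| * (4 * (R * (1 + |z|) ^ (1/4 : ℝ)) + 2 * hh (s - z)) := by
                gcongr; linarith
            _ = |m s| * (4 * R * (1 + |z|) ^ (1/4 : ℝ)) + |m s| * (2 * hh (s - z)) := by ring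
            _ ≤ |m s| * (4 * R * (1 + |z|) ^ (1/4 : ℝ)) + M * (2 * hh (s - z)) := by gcongr
            _ = _ := by ring
    _ = ENNReal.ofReal ((∫ s, |m s|) * (4 * R * (1 + |z|) ^ (1/4 : ℝ)) + 2 * M * ∫ t, hh t) := by
        have hz : Measurable fun s => ENNReal.ofReal (hh (s - z)) :=
          (hh_meas.comp (measurable_id.sub_const z)).ennreal_ofReal
        rw [lintegral_add_left (h.meas.enorm.mul_const _), lintegral_mul_const _ h.meas.enorm, h.enorm_int,
          lintegral_const_mul _ hz, hh_conv,
          ← ENNReal.ofReal_mul hI, ← ENNReal.ofReal_mul (by positivity), ← ENNReal.ofReal_add (by positivity) (by positivity)]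
    _ ≤ _ := by
        apply ENNReal.ofReal_le_ofReal
        rw [add_mul]
        have : 2 * M * (∫ t, hh t) ≤ 2 * M * (∫ t, hh t) * (1 + |z|) ^ (1/4 : ℝ) :=
          le_mul_of_one_le_right (by positivity) h1z
        linarith

lemma aff_lint {G : ℝ → ENNReal} {l : ℝ} (hl : l ≠ 0) (a : ℝ) :
    ∫⁻ s, G s = ENNReal.ofReal |l| * ∫⁻ σ, G (l * σ - a) := by
  have e1 : ∫⁻ σ, G (l * σ - a) = ENNReal.ofReal |l⁻¹| * ∫⁻ s, G s := by
    have h := (Homeomorph.mulLeft₀ l hl).toMeasurableEquiv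
    have h1 : ∫⁻ σ, G (l * σ - a) = ∫⁻ s, G (s - a) ∂(Measure.map (fun x => l * x) volume) := by
      rw [show (fun x : ℝ => l * x) = (Homeomorph.mulLeft₀ l hl).toMeasurableEquiv from rfl,
        lintegral_map_equiv]
      rfl
    rw [h1, Real.map_volume_mul_left hl, lintegral_smul_measure, lintegral_sub_right_eq_self G a]
    rfl
  rw [e1, ← mul_assoc, ← ENNReal.ofReal_mul (abs_nonneg _), ← abs_mul, mul_inv_cancel₀ hl]
  simp

/-- rescaled kernel -/
def resc (n : ℝ → ℝ) (a l : ℝ) (s : ℝ) : ℝ := n ((s + a) / l) * |l|⁻¹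

lemma resc_lint {n : ℝ → ℝ} {l : ℝ} (hl : l ≠ 0) (a : ℝ) (G : ℝ → ENNReal) :
    ∫⁻ s, ‖resc n a l s‖ₑ * G s = ∫⁻ σ, ‖n σ‖ₑ * G (l * σ - a) := by
  rw [aff_lint hl a, ← lintegral_const_mul' _ _ ENNReal.ofReal_ne_top]
  congr 1; funext σ
  unfold resc
  have : (l * σ - a + a) / l = σ := by field_simp; ring
  rw [this, enorm_mul, ← mul_assoc]
  congr 1
  have e : ‖|l|⁻¹‖ₑ = ENNReal.ofReal |l|⁻¹ := Real.enorm_eq_ofReal (by positivity)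
  rw [mul_left_comm, e, ← ENNReal.ofReal_mul (abs_nonneg _), mul_inv_cancel₀ (abs_ne_zero.2 hl)]
  simp

lemma pot_meas_aux {a b : ℝ → ℝ} (ha : Measurable a) (hb : Measurable b) :
    Measurable (Function.uncurry fun s s' : ℝ => ‖a s‖ₑ * (‖b s'‖ₑ * ‖Real.log (s' - s)‖ₑ)) := by
  unfold Function.uncurry
  have : Measurable fun p : ℝ × ℝ => Real.log (p.2 - p.1) :=
    Real.measurable_log.comp (measurable_snd.sub measurable_fst)
  exact (ha.comp measurable_fst).enorm.mul ((hb.comp measurable_snd).enorm.mul this.enorm)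

lemma pot_meas {b : ℝ → ℝ} (hb : Measurable b) : Measurable (Pot b) := by
  have := pot_meas_aux (a := fun _ => (1:ℝ)) measurable_const hb
  have := this.lintegral_prod_right' (ν := (volume : Measure ℝ))
  unfold Pot
  simpa [Function.uncurry] using this

lemma pot_symm {a b : ℝ → ℝ} (ha : Measurable a) (hb : Measurable b) :
    ∫⁻ s, ‖a s‖ₑ * Pot b s = ∫⁻ s, ‖b s‖ₑ * Pot a s := by
  unfold Pot
  simp only [← lintegral_const_mul' _ _ enorm_ne_top]
  rw [lintegral_lintegral_swap (pot_meas_aux ha hb).aemeasurable]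
  refine lintegral_congr fun s => lintegral_congr fun s' => ?_
  rw [← Real.log_neg_eq_log, neg_sub]
  ring

lemma pot_const_mul_le {m : ℝ → ℝ} {M R : ℝ} (h : BK m M R) (g : ℝ → ENNReal) (c : ENNReal)
    (hg : ∀ s, |s| ≤ R → g s ≤ c) : ∫⁻ s, ‖m s‖ₑ * g s ≤ ENNReal.ofReal (∫ s, |m s|) * c := by
  rw [← h.enorm_int, ← lintegral_mul_const _ h.meas.enorm]
  refine lintegral_mono fun s => ?_
  by_cases hs : |s| ≤ R
  · exact mul_le_mul_right (hg s hs) _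
  · rw [h.supp s (not_le.1 hs)]; simp

lemma LK_mm {m : ℝ → ℝ} {M R : ℝ} (h : BK m M R) : ∃ C, 0 ≤ C ∧ LK m ≤ ENNReal.ofReal C := by
  obtain ⟨C, hC, hp⟩ := pot_le h
  have hR := h.R1
  refine ⟨(∫ s, |m s|) * (C * (1 + R) ^ (1/4:ℝ)), ?_, ?_⟩
  · have : 0 ≤ ∫ s, |m s| := integral_nonneg fun s => abs_nonneg _
    positivity
  · rw [ENNReal.ofReal_mul (integral_nonneg fun s => abs_nonneg _)]
    refine pot_const_mul_le h _ _ fun s hs => (hp s).trans (ENNReal.ofReal_le_ofReal ?_)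
    gcongr

lemma LK_add_le {m n : ℝ → ℝ} (hm : Measurable m) (hn : Measurable n) {κ : ℝ → ℝ}
    (hκ : ∀ s, ‖κ s‖ₑ ≤ ‖m s‖ₑ + ‖n s‖ₑ) :
    LK κ ≤ LK m + 2 * (∫⁻ s, ‖n s‖ₑ * Pot m s) + LK n := by
  have h1 : ∀ z, Pot κ z ≤ Pot m z + Pot n z := by
    intro z
    unfold Pot
    have hl : Measurable fun s => ‖Real.log (s - z)‖ₑ :=
      (Real.measurable_log.comp (measurable_id.sub_const z)).enorm
    have hl2 : Measurable fun s => ‖m s‖ₑ * ‖Real.log (s - z)‖ₑ := hm.enorm.mul hl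
    rw [← lintegral_add_left hl2]
    refine lintegral_mono fun s => ?_
    rw [← add_mul]
    exact mul_le_mul_left (hκ s) _
  calc LK κ ≤ ∫⁻ s, (‖m s‖ₑ + ‖n s‖ₑ) * (Pot m s + Pot n s) :=
        lintegral_mono fun s => mul_le_mul' (hκ s) (h1 s)
    _ = ∫⁻ s, ((‖m s‖ₑ * Pot m s + ‖m s‖ₑ * Pot n s) + (‖n s‖ₑ * Pot m s + ‖n s‖ₑ * Pot n s)) := by
        refine lintegral_congr fun s => ?_
        ring
    _ = LK m + (∫⁻ s, ‖n s‖ₑ * Pot m s) + ((∫⁻ s, ‖n s‖ₑ * Pot m s) + LK n) := by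
        have a1 : Measurable fun s => ‖m s‖ₑ * Pot m s := hm.enorm.mul (pot_meas hm)
        have a2 : Measurable fun s => ‖m s‖ₑ * Pot n s := hm.enorm.mul (pot_meas hn)
        have a3 : Measurable fun s => ‖n s‖ₑ * Pot m s := hn.enorm.mul (pot_meas hm)
        have a4 : Measurable fun s => ‖m s‖ₑ * Pot m s + ‖m s‖ₑ * Pot n s := a1.add a2
        rw [lintegral_add_left a4, lintegral_add_left a1, lintegral_add_left a3, pot_symm hm hn]
        rfl
    _ = _ := by ring

lemma resc_meas {n : ℝ → ℝ} (hn : Measurable n) (a l : ℝ) : Measurable (resc n a l) := by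
  unfold resc; fun_prop

lemma LK_far {m n : ℝ → ℝ} {M R M' R' : ℝ} (hm : BK m M R) (hn : BK n M' R') : ∃ C, 0 ≤ C ∧
    ∀ (κ : ℝ → ℝ) (a l : ℝ), l ≠ 0 → (∀ s, ‖κ s‖ₑ ≤ ‖m s‖ₑ + ‖resc n a l s‖ₑ) →
    LK κ ≤ ENNReal.ofReal (C * ((1 + |a|) ^ (1/4 : ℝ) * ((1 + |l|) ^ (1/4 : ℝ) + hh l))) := by
  obtain ⟨C1, h1, hC1⟩ := LK_mm hm
  obtain ⟨C2, h2, hC2⟩ := LK_mm hn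
  obtain ⟨C3, h3, hC3⟩ := pot_le hm
  set I := ∫ s, |n s| with hI
  have hI0 : 0 ≤ I := integral_nonneg fun s => abs_nonneg _
  have hR' := hn.R1
  refine ⟨C1 + 2 * (I * (C3 * (1 + R'))) + (C2 + 4 * I * I), by positivity, fun κ a l hl hκ => ?_⟩
  refine (LK_add_le hm.meas (resc_meas hn.meas a l) hκ).trans ?_
  have x1 : 1 ≤ (1 + |a|) ^ (1/4 : ℝ) := Real.one_le_rpow (by linarith [abs_nonneg a]) (by norm_num)
  have x2 : 1 ≤ (1 + |l|) ^ (1/4 : ℝ) := Real.one_le_rpow (by linarith [abs_nonneg l]) (by norm_num)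
  have x3 := hh_nonneg l
  set P := (1 + |a|) ^ (1/4 : ℝ) with hP
  set Q := (1 + |l|) ^ (1/4 : ℝ) with hQ
  have t2 : ∫⁻ s, ‖resc n a l s‖ₑ * Pot m s ≤ ENNReal.ofReal (I * (C3 * (1 + R') * (P * Q))) := by
    rw [resc_lint hl, ENNReal.ofReal_mul hI0]
    refine pot_const_mul_le hn _ _ fun s hs => (hC3 _).trans (ENNReal.ofReal_le_ofReal ?_)
    rw [mul_assoc C3]
    refine mul_le_mul_of_nonneg_left ?_ h3
    calc (1 + |l * s - a|) ^ (1/4 : ℝ) ≤ ((1 + R') * ((1 + |a|) * (1 + |l|))) ^ (1/4 : ℝ) := by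
          apply Real.rpow_le_rpow (by positivity) _ (by norm_num)
          have e1 := abs_sub (l * s) a
          rw [abs_mul] at e1
          have e2 : |l| * |s| ≤ |l| * R' := mul_le_mul_of_nonneg_left hs (abs_nonneg l)
          have e3 := abs_nonneg a
          have e4 := abs_nonneg l
          nlinarith [mul_nonneg e3 e4, mul_nonneg (by linarith : (0:ℝ) ≤ R') (mul_nonneg e3 e4),
            mul_nonneg (by linarith : (0:ℝ) ≤ R') e3]
      _ = (1 + R') ^ (1/4 : ℝ) * (P * Q) := by
          rw [Real.mul_rpow (by positivity) (by positivity), Real.mul_rpow (by positivity) (by positivity)]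
      _ ≤ _ := by
          gcongr
          calc (1 + R') ^ (1/4 : ℝ) ≤ (1 + R') ^ (1 : ℝ) := Real.rpow_le_rpow_of_exponent_le (by linarith) (by norm_num)
            _ = _ := Real.rpow_one _
  have hlog : |Real.log l| ≤ 4 * (Q + hh l) := by
    have := log_le l
    have : |l| ^ (1/4 : ℝ) ≤ Q := Real.rpow_le_rpow (abs_nonneg _) (by linarith) (by norm_num)
    linarith
  have t3 : LK (resc n a l) ≤ ENNReal.ofReal (C2 + I * (I * (4 * (Q + hh l)))) := by
    have e1 : ∀ σ, Pot (resc n a l) (l * σ - a) ≤ Pot n σ + ENNReal.ofReal (I * (4 * (Q + hh l))) := by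
      intro σ
      unfold Pot
      rw [resc_lint hl]
      have hl1 : Measurable fun s => ‖Real.log (s - σ)‖ₑ :=
        (Real.measurable_log.comp (measurable_id.sub_const σ)).enorm
      calc _ ≤ ∫⁻ s, (‖n s‖ₑ * ‖Real.log (s - σ)‖ₑ + ‖n s‖ₑ * ENNReal.ofReal (4 * (Q + hh l))) := by
            refine lintegral_mono fun s => ?_
            simp only
            rw [← mul_add]
            refine mul_le_mul_right ?_ _
            have : l * s - a - (l * σ - a) = l * (s - σ) := by ring
            rw [this]
            by_cases hs : s - σ = 0
            · simp [hs]
            · rw [Real.log_mul hl hs]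
              refine (enorm_add_le _ _).trans ?_
              rw [add_comm]
              gcongr
              rw [Real.enorm_eq_ofReal_abs]
              exact ENNReal.ofReal_le_ofReal hlog
        _ = _ := by
            have hl2 : Measurable fun s => ‖n s‖ₑ * ‖Real.log (s - σ)‖ₑ := hn.meas.enorm.mul hl1
            rw [lintegral_add_left hl2, lintegral_mul_const _ hn.meas.enorm, hn.enorm_int,
              ENNReal.ofReal_mul hI0]
    unfold LK
    rw [resc_lint hl]
    calc _ ≤ ∫⁻ σ, (‖n σ‖ₑ * Pot n σ + ‖n σ‖ₑ * ENNReal.ofReal (I * (4 * (Q + hh l)))) := by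
          refine lintegral_mono fun σ => ?_
          simp only
          rw [← mul_add]
          exact mul_le_mul_right (e1 σ) _
      _ = LK n + ENNReal.ofReal (I * (I * (4 * (Q + hh l)))) := by
          have a1 : Measurable fun s => ‖n s‖ₑ * Pot n s := hn.meas.enorm.mul (pot_meas hn.meas)
          rw [lintegral_add_left a1, lintegral_mul_const _ hn.meas.enorm, hn.enorm_int,
            ← ENNReal.ofReal_mul hI0]
          rfl
      _ ≤ _ := by
          rw [ENNReal.ofReal_add h2 (by positivity)]
          gcongr
  calc _ ≤ ENNReal.ofReal C1 + 2 * ENNReal.ofReal (I * (C3 * (1 + R') * (P * Q))) +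
        ENNReal.ofReal (C2 + I * (I * (4 * (Q + hh l)))) := by gcongr
    _ = ENNReal.ofReal (C1 + 2 * (I * (C3 * (1 + R') * (P * Q))) + (C2 + I * (I * (4 * (Q + hh l))))) := by
        have gen : ∀ A B D : ℝ, 0 ≤ A → 0 ≤ B → 0 ≤ D → ENNReal.ofReal A + 2 * ENNReal.ofReal B + ENNReal.ofReal D
            = ENNReal.ofReal (A + 2 * B + D) := by
          intro A B D hA hB hD
          rw [ENNReal.ofReal_add (by positivity) hD, ENNReal.ofReal_add hA (by positivity),
            ENNReal.ofReal_mul (p := 2) (by norm_num)]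
          simp
        exact gen _ _ _ h1 (by positivity) (by positivity)
    _ ≤ _ := by
        apply ENNReal.ofReal_le_ofReal
        have y1 : 1 ≤ P * (Q + hh l) := by nlinarith
        have y2 : P * Q ≤ P * (Q + hh l) := by gcongr; linarith
        have y3 : Q + hh l ≤ P * (Q + hh l) := le_mul_of_one_le_left (by positivity) x1
        set Y := P * (Q + hh l)
        have z1 : C1 ≤ C1 * Y := le_mul_of_one_le_right h1 y1
        have z2 : C2 ≤ C2 * Y := le_mul_of_one_le_right h2 y1
        have z3 : 2 * (I * (C3 * (1 + R') * (P * Q))) ≤ 2 * (I * (C3 * (1 + R') * Y)) := by gcongr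
        have z4 : I * (I * (4 * (Q + hh l))) ≤ I * (I * (4 * Y)) := by gcongr
        calc _ ≤ C1 * Y + 2 * (I * (C3 * (1 + R') * Y)) + (C2 * Y + I * (I * (4 * Y))) := by linarith
          _ = _ := by ring

lemma LK_mono_scale {κ g : ℝ → ℝ} {c : ℝ} (hc : 0 ≤ c) (h : ∀ s, |κ s| ≤ c * |g s|) :
    LK κ ≤ ENNReal.ofReal (c ^ 2) * LK g := by
  have h1 : ∀ s, ‖κ s‖ₑ ≤ ENNReal.ofReal c * ‖g s‖ₑ := fun s => by
    rw [Real.enorm_eq_ofReal_abs, Real.enorm_eq_ofReal_abs, ← ENNReal.ofReal_mul hc]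
    exact ENNReal.ofReal_le_ofReal (h s)
  have h2 : ∀ z, Pot κ z ≤ ENNReal.ofReal c * Pot g z := fun z => by
    unfold Pot
    rw [← lintegral_const_mul' _ _ ENNReal.ofReal_ne_top]
    refine lintegral_mono fun s => ?_
    simp only
    rw [← mul_assoc]
    exact mul_le_mul_left (h1 s) _
  unfold LK
  rw [← lintegral_const_mul' _ _ ENNReal.ofReal_ne_top]
  refine lintegral_mono fun s => (mul_le_mul' (h1 s) (h2 s)).trans (le_of_eq ?_)
  rw [pow_two, ENNReal.ofReal_mul hc]
  ring

def rr (a l : ℝ) : ℝ := √(a ^ 2 + (l - 1) ^ 2)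
def WW (a l : ℝ) : ℝ := hh a * hh (l - 1) +
  (1 + |a|) ^ (-(5/4) : ℝ) * ((1 + |l|) ^ (-(5/4) : ℝ) + hh l)
def kap (m n : ℝ → ℝ) (a l s : ℝ) : ℝ := m s - (if 0 < l then resc m a l s else resc n a l s)

lemma WW_nonneg (a l : ℝ) : 0 ≤ WW a l := by
  unfold WW
  have := hh_nonneg a; have := hh_nonneg (l-1); have := hh_nonneg l
  positivity

lemma kap_far {m n : ℝ → ℝ} {M R M' R' : ℝ} (hm : BK m M R) (hn : BK n M' R') : ∃ C, 0 ≤ C ∧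
    ∀ a l, l ≠ 0 → LK (kap m n a l) ≤
      ENNReal.ofReal (C * ((1 + |a|) ^ (1/4 : ℝ) * ((1 + |l|) ^ (1/4 : ℝ) + hh l))) := by
  obtain ⟨C1, h1, H1⟩ := LK_far hm hm
  obtain ⟨C2, h2, H2⟩ := LK_far hm hn
  refine ⟨C1 + C2, by positivity, fun a l hl => ?_⟩
  have x3 := hh_nonneg l
  by_cases h : 0 < l
  · refine (H1 _ a l hl (fun s => ?_)).trans (ENNReal.ofReal_le_ofReal ?_)
    · unfold kap; rw [if_pos h]; exact enorm_sub_le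
    · gcongr; linarith
  · refine (H2 _ a l hl (fun s => ?_)).trans (ENNReal.ofReal_le_ofReal ?_)
    · unfold kap; rw [if_neg h]; exact enorm_sub_le
    · gcongr; linarith

lemma kap_near {m n : ℝ → ℝ} {M R K : ℝ} (hm : BK m M R) (hK : 0 ≤ K)
    (hL : ∀ s t, |m s - m t| ≤ K * |s - t|) : ∃ C, 0 ≤ C ∧
    ∀ a l, |a| ≤ 1/2 → |l - 1| ≤ 1/2 → LK (kap m n a l) ≤
      ENNReal.ofReal (C * rr a l ^ 2) := by
  have hR := hm.R1
  have hM := hm.M0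
  set S := 2 * R + 1 with hS
  set g : ℝ → ℝ := (Icc (-S) S).indicator (fun _ => (1:ℝ)) with hg
  have hgB : BK g 1 S := by
    refine ⟨measurable_const.indicator measurableSet_Icc, by norm_num, by linarith, fun s => ?_, fun s hs => ?_⟩
    · by_cases h : s ∈ Icc (-S) S <;> simp [hg, h]
    · rw [hg, indicator_of_notMem]
      intro h; exact absurd (abs_le.2 h) (not_le.2 hs)
  obtain ⟨C, hC, hCL⟩ := LK_mm hgB
  set D := 2 * M + 4 * K * S with hD
  have hD0 : 0 ≤ D := by positivity
  refine ⟨2 * D ^ 2 * C, by positivity, fun a l ha hl => ?_⟩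
  have hl2 := abs_le.1 hl
  have hl0 : 0 < l := by linarith
  have hρ : 0 ≤ D * (|a| + |l - 1|) := by positivity
  have key : ∀ s, |kap m n a l s| ≤ D * (|a| + |l - 1|) * |g s| := by
    intro s
    unfold kap; rw [if_pos hl0]; unfold resc; rw [abs_of_pos hl0]
    by_cases hs : |s| ≤ S
    · have : g s = 1 := by rw [hg, indicator_of_mem]; exact abs_le.1 hs
      rw [this, abs_one, mul_one]
      have e0 : m s - m ((s + a) / l) * l⁻¹ = m s * ((l - 1) * l⁻¹) + l⁻¹ * (m s - m ((s + a) / l)) := by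
        field_simp; ring
      have e1 : l⁻¹ ≤ 2 := by
        rw [inv_le_comm₀ hl0 (by norm_num)]; linarith
      have e1' : 0 < l⁻¹ := by positivity
      have e2 : s - (s + a) / l = ((l - 1) * s - a) * l⁻¹ := by field_simp; ring
      rw [e0]
      have e3 := hL s ((s + a) / l)
      rw [e2, abs_mul, abs_of_pos e1'] at e3
      have e4 : |(l - 1) * s - a| ≤ |l - 1| * S + |a| := by
        refine (abs_sub _ _).trans ?_
        rw [abs_mul]; gcongr
      calc _ ≤ |m s * ((l - 1) * l⁻¹)| + |l⁻¹ * (m s - m ((s + a) / l))| := abs_add_le _ _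
        _ = |m s| * (|l - 1| * l⁻¹) + l⁻¹ * |m s - m ((s + a) / l)| := by
            rw [abs_mul, abs_mul, abs_mul, abs_of_pos e1']
        _ ≤ M * (|l - 1| * 2) + 2 * (K * ((|l - 1| * S + |a|) * 2)) := by
            have := hm.bd s
            gcongr
            exact e3.trans (by gcongr)
        _ ≤ D * (|a| + |l - 1|) := by
            rw [hD]
            have q1 := mul_nonneg hM (abs_nonneg a)
            have q2 : K * |a| ≤ K * |a| * S := le_mul_of_one_le_right (by positivity) (by linarith)
            nlinarith
    · push Not at hs
      have z1 : m s = 0 := hm.supp s (by linarith)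
      have z2 : m ((s + a) / l) = 0 := by
        apply hm.supp
        rw [abs_div, abs_of_pos hl0, lt_div_iff₀ hl0]
        have : |s| ≤ |s + a| + |a| := by
          have := abs_sub (s + a) a
          simpa using this
        nlinarith
      rw [z1, z2]; simp; positivity
  refine (LK_mono_scale hρ key).trans ?_
  calc _ ≤ ENNReal.ofReal ((D * (|a| + |l - 1|)) ^ 2) * ENNReal.ofReal C := by gcongr
    _ = ENNReal.ofReal ((D * (|a| + |l - 1|)) ^ 2 * C) := by rw [ENNReal.ofReal_mul (by positivity)]
    _ ≤ _ := by
      apply ENNReal.ofReal_le_ofReal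
      unfold rr
      rw [Real.sq_sqrt (by positivity), mul_pow]
      have : (|a| + |l - 1|) ^ 2 ≤ 2 * (a ^ 2 + (l - 1) ^ 2) := by
        rw [← sq_abs a, ← sq_abs (l - 1)]
        nlinarith [sq_nonneg (|a| - |l - 1|)]
      calc D ^ 2 * (|a| + |l - 1|) ^ 2 * C ≤ D ^ 2 * (2 * (a ^ 2 + (l - 1) ^ 2)) * C := by gcongr
        _ = _ := by ring

lemma hh_eq {t : ℝ} (ht : |t| ≤ 1) : hh t = |t| ^ (-(1/2) : ℝ) := by
  unfold hh; rw [indicator_of_mem]; exact abs_le.1 ht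

lemma KB {m n : ℝ → ℝ} {M R M' R' K : ℝ} (hm : BK m M R) (hn : BK n M' R') (hK : 0 ≤ K)
    (hL : ∀ s t, |m s - m t| ≤ K * |s - t|) : ∃ C, 0 ≤ C ∧
    ∀ a l, a ≠ 0 → l ≠ 0 → l ≠ 1 → LK (kap m n a l) ≤ ENNReal.ofReal (C * (rr a l ^ 3 * WW a l)) := by
  obtain ⟨C1, h1, H1⟩ := kap_far hm hn
  obtain ⟨C2, h2, H2⟩ := kap_near (n := n) hm hK hL
  refine ⟨125 * C1 + C2, by positivity, fun a l ha hl hl1 => ?_⟩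
  have x1 := hh_nonneg a
  have x2 := hh_nonneg (l - 1)
  have x3 := hh_nonneg l
  have ha' : 0 < |a| := abs_pos.2 ha
  have hl' : 0 < |l - 1| := abs_pos.2 (sub_ne_zero.2 hl1)
  have hrs : rr a l ^ 2 = |a| ^ 2 + |l - 1| ^ 2 := by
    unfold rr; rw [Real.sq_sqrt (by positivity), sq_abs, sq_abs]
  have hr0 : 0 ≤ rr a l := Real.sqrt_nonneg _
  have hr : 0 < rr a l := by
    rcases eq_or_lt_of_le hr0 with h | h
    · rw [← h] at hrs; nlinarith
    · exact h
  have hra : |a| ≤ rr a l := by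
    apply abs_le_of_sq_le_sq' _ hr0 |>.2
    nlinarith
  have hrl : |l - 1| ≤ rr a l := by
    apply abs_le_of_sq_le_sq' _ hr0 |>.2
    nlinarith
  by_cases hnear : |a| ≤ 1/2 ∧ |l - 1| ≤ 1/2
  · refine (H2 a l hnear.1 hnear.2).trans (ENNReal.ofReal_le_ofReal ?_)
    have e1 : 1 ≤ rr a l * (hh a * hh (l - 1)) := by
      rw [hh_eq (by linarith [hnear.1]), hh_eq (by linarith [hnear.2]), ← Real.mul_rpow ha'.le hl'.le,
        Real.rpow_neg (by positivity), ← div_eq_mul_inv, le_div_iff₀ (by positivity), one_mul,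
        ← Real.sqrt_eq_rpow]
      apply Real.sqrt_le_iff.2 ⟨hr0, ?_⟩
      rw [hrs]; nlinarith [sq_nonneg (|a| - |l - 1|)]
    have e2 : hh a * hh (l - 1) ≤ WW a l := by
      unfold WW
      have : 0 ≤ (1 + |a|) ^ (-(5/4) : ℝ) * ((1 + |l|) ^ (-(5/4) : ℝ) + hh l) := by positivity
      linarith
    have e3 : 1 ≤ rr a l * WW a l := e1.trans (by gcongr)
    have e4 : rr a l ^ 2 ≤ rr a l ^ 2 * (rr a l * WW a l) := le_mul_of_one_le_right (by positivity) e3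
    have e5 : 0 ≤ rr a l ^ 3 * WW a l := mul_nonneg (by positivity) (WW_nonneg a l)
    calc C2 * rr a l ^ 2 ≤ C2 * (rr a l ^ 3 * WW a l) := by
          gcongr; calc _ ≤ _ := e4
                    _ = _ := by ring
      _ ≤ _ := by nlinarith
  · have hr2 : 1/2 ≤ rr a l := by
      by_contra hc
      push Not at hc
      exact hnear ⟨by linarith, by linarith⟩
    have e1 : 1 + |a| ≤ 5 * rr a l := by linarith
    have e2 : 1 + |l| ≤ 5 * rr a l := by
      have : |l| ≤ |l - 1| + 1 := by
        have := abs_add_le (l - 1) 1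
        simpa using this
      linarith
    refine (H1 a l hl).trans (ENNReal.ofReal_le_ofReal ?_)
    have pa : 0 < 1 + |a| := by positivity
    have pl : 0 < 1 + |l| := by positivity
    have e3 : (1 + |a|) ^ (3/2 : ℝ) * (1 + |l|) ^ (3/2 : ℝ) ≤ 125 * rr a l ^ 3 := by
      calc _ ≤ (5 * rr a l) ^ (3/2 : ℝ) * (5 * rr a l) ^ (3/2 : ℝ) := by gcongr
        _ = (5 * rr a l) ^ (3 : ℝ) := by
          rw [← Real.rpow_add (by positivity)]; norm_num
        _ = (5 * rr a l) ^ 3 := by norm_cast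
        _ = _ := by ring
    have f1 : (1 + |a|) ^ (1/4 : ℝ) = (1 + |a|) ^ (3/2 : ℝ) * (1 + |a|) ^ (-(5/4) : ℝ) := by
      rw [← Real.rpow_add pa]; norm_num
    have f2 : (1 + |l|) ^ (1/4 : ℝ) = (1 + |l|) ^ (3/2 : ℝ) * (1 + |l|) ^ (-(5/4) : ℝ) := by
      rw [← Real.rpow_add pl]; norm_num
    have f3 : hh l ≤ (1 + |l|) ^ (3/2 : ℝ) * hh l :=
      le_mul_of_one_le_left x3 (Real.one_le_rpow (by linarith [abs_nonneg l]) (by norm_num))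
    have f4 : (1 + |a|) ^ (-(5/4) : ℝ) * ((1 + |l|) ^ (-(5/4) : ℝ) + hh l) ≤ WW a l := by
      unfold WW
      have := mul_nonneg x1 x2
      linarith
    have e5 : 0 ≤ rr a l ^ 3 * WW a l := mul_nonneg (by positivity) (WW_nonneg a l)
    have f5 : (1 + |a|) ^ (1/4 : ℝ) * ((1 + |l|) ^ (1/4 : ℝ) + hh l) ≤ 125 * rr a l ^ 3 * WW a l := by
      calc _ ≤ (1 + |a|) ^ (3/2 : ℝ) * (1 + |a|) ^ (-(5/4) : ℝ) *
            ((1 + |l|) ^ (3/2 : ℝ) * (1 + |l|) ^ (-(5/4) : ℝ) + (1 + |l|) ^ (3/2 : ℝ) * hh l) := by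
            rw [f1, f2]; gcongr
        _ = ((1 + |a|) ^ (3/2 : ℝ) * (1 + |l|) ^ (3/2 : ℝ)) *
            ((1 + |a|) ^ (-(5/4) : ℝ) * ((1 + |l|) ^ (-(5/4) : ℝ) + hh l)) := by ring
        _ ≤ _ := by gcongr
    calc _ ≤ C1 * (125 * rr a l ^ 3 * WW a l) := by gcongr
      _ ≤ _ := by nlinarith

lemma LK_bridge {κ : ℝ → ℝ} (hκ : Measurable κ) {c : ℝ} (hc : 0 ≤ c) (h : LK κ ≤ ENNReal.ofReal c) :
    Integrable (fun q : ℝ × ℝ => |κ q.1| * |κ q.2| * |Real.log (q.1 - q.2)|) ∧ KL κ ≤ c := by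
  have hm : Measurable (fun q : ℝ × ℝ => |κ q.1| * |κ q.2| * |Real.log (q.1 - q.2)|) := by
    have : Measurable fun p : ℝ × ℝ => Real.log (p.1 - p.2) :=
      Real.measurable_log.comp (measurable_fst.sub measurable_snd)
    fun_prop
  have e : ∫⁻ q : ℝ × ℝ, ENNReal.ofReal (|κ q.1| * |κ q.2| * |Real.log (q.1 - q.2)|) = LK κ := by
    rw [Measure.volume_eq_prod, lintegral_prod _ hm.ennreal_ofReal.aemeasurable]
    unfold LK Pot
    refine lintegral_congr fun s => ?_
    rw [← lintegral_const_mul' _ _ enorm_ne_top]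
    refine lintegral_congr fun s' => ?_
    simp only [Real.enorm_eq_ofReal_abs]
    rw [← ENNReal.ofReal_mul (abs_nonneg _), ← ENNReal.ofReal_mul (abs_nonneg _), mul_assoc,
      ← Real.log_neg_eq_log, neg_sub]
  have h0 : ∀ q : ℝ × ℝ, 0 ≤ |κ q.1| * |κ q.2| * |Real.log (q.1 - q.2)| := fun q => by positivity
  constructor
  · refine ⟨hm.aestronglyMeasurable, ?_⟩
    rw [hasFiniteIntegral_iff_ofReal (Filter.Eventually.of_forall h0), e]
    exact lt_of_le_of_lt h ENNReal.ofReal_lt_top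
  · unfold KL
    rw [integral_eq_lintegral_of_nonneg_ae (Filter.Eventually.of_forall h0) hm.aestronglyMeasurable, e]
    exact ENNReal.toReal_le_of_le_ofReal hc h

lemma resc_int {n : ℝ → ℝ} (a : ℝ) {l : ℝ} (hl : l ≠ 0) (hn : Integrable n) : Integrable (resc n a l) := by
  unfold resc
  refine Integrable.mul_const ?_ _
  have := (hn.comp_div hl).comp_add_right a
  exact this

lemma resc_integral {n : ℝ → ℝ} (a : ℝ) {l : ℝ} (hl : l ≠ 0) : ∫ s, resc n a l s = ∫ s, n s := by
  unfold resc
  rw [integral_mul_const, integral_add_right_eq_self (fun s => n (s / l)) a, Measure.integral_comp_div]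
  rw [smul_eq_mul, mul_comm, ← mul_assoc, inv_mul_cancel₀ (abs_ne_zero.2 hl), one_mul]

lemma kap_meas {m n : ℝ → ℝ} (hm : Measurable m) (hn : Measurable n) (a l : ℝ) :
    Measurable (kap m n a l) := by
  unfold kap
  by_cases h : 0 < l
  · simp only [if_pos h]; exact hm.sub (resc_meas hm a l)
  · simp only [if_neg h]; exact hm.sub (resc_meas hn a l)

lemma kap_int {m n : ℝ → ℝ} (hm : Integrable m) (hn : Integrable n) (a : ℝ) {l : ℝ} (hl : l ≠ 0) :
    Integrable (kap m n a l) := by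
  unfold kap
  by_cases h : 0 < l
  · simp only [if_pos h]; exact hm.sub (resc_int a hl hm)
  · simp only [if_neg h]; exact hm.sub (resc_int a hl hn)

lemma kap_zero {m n : ℝ → ℝ} (hm : Integrable m) (hn : Integrable n) (a : ℝ) {l : ℝ} (hl : l ≠ 0)
    (he : ∫ s, m s = ∫ s, n s) : ∫ s, kap m n a l s = 0 := by
  unfold kap
  by_cases h : 0 < l
  · simp only [if_pos h]; rw [integral_sub hm (resc_int a hl hm), resc_integral a hl, sub_self]
  · simp only [if_neg h]; rw [integral_sub hm (resc_int a hl hn), resc_integral a hl, he, sub_self]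

lemma TT_resc {n f : ℝ → ℝ} (x y a : ℝ) {l : ℝ} (hl : l ≠ 0) :
    TT n f (x + a * y) (l * y) = TT (resc n a l) f x y := by
  unfold TT resc
  have := Measure.integral_comp_mul_left (fun s => f (x - y * (s - a)) * (n (s / l) * |l|⁻¹)) l
  rw [integral_congr_ae (g := fun s => |l|⁻¹ * (f (x + a * y - l * y * s) * n s))] at this
  · rw [integral_const_mul, smul_eq_mul, abs_inv] at this
    have h2 : |l|⁻¹ ≠ 0 := inv_ne_zero (abs_ne_zero.2 hl)
    rw [mul_right_inj' h2] at this
    rw [this, ← integral_add_right_eq_self _ a]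
    simp
  · refine Filter.Eventually.of_forall fun s => ?_
    simp only
    rw [mul_div_cancel_left₀ _ hl, show x - y * (l * s - a) = x + a * y - l * y * s by ring]
    ring

lemma WW_meas : Measurable (Function.uncurry WW) := by
  unfold Function.uncurry WW
  have := hh_meas
  fun_prop

lemma WW_lint : ∃ C, ∫⁻ a, ∫⁻ l, ENNReal.ofReal (WW a l) = ENNReal.ofReal C ∧ 0 ≤ C := by
  have i1 : Integrable fun t : ℝ => (1 + |t|) ^ (-(5/4) : ℝ) := by
    have := integrable_one_add_norm (E := ℝ) (μ := volume) (r := 5/4) (by simp; norm_num)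
    simpa using this
  have i2 : Integrable fun l : ℝ => hh (l - 1) := hh_integrable.comp_sub_right 1
  have i3 : Integrable fun q : ℝ × ℝ => WW q.1 q.2 :=
    (hh_integrable.mul_prod i2).add (i1.mul_prod (i1.add hh_integrable))
  refine ⟨∫ q : ℝ × ℝ, WW q.1 q.2, ?_, integral_nonneg fun q => WW_nonneg _ _⟩
  have mm : Measurable fun q : ℝ × ℝ => ENNReal.ofReal (WW q.1 q.2) := WW_meas.ennreal_ofReal
  rw [ofReal_integral_eq_lintegral_ofReal i3 (Filter.Eventually.of_forall fun q => WW_nonneg _ _),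
    Measure.volume_eq_prod, lintegral_prod _ mm.aemeasurable]

/-- smooth compactly supported functions on the line -/
structure GK (m : ℝ → ℝ) : Prop where
  smooth : ContDiff ℝ (⊤ : ℕ∞) m
  cs : HasCompactSupport m

lemma GK.cont {m : ℝ → ℝ} (h : GK m) : Continuous m := h.smooth.continuous

lemma GK.bk {m : ℝ → ℝ} (h : GK m) : ∃ M R, BK m M R := by
  obtain ⟨M, hM⟩ := h.cs.exists_bound_of_continuous h.cont
  obtain ⟨R, hR⟩ := h.cs.isCompact.isBounded.subset_closedBall 0
  refine ⟨M, max R 1, h.cont.measurable, (norm_nonneg _).trans (hM 0), le_max_right _ _, hM, fun s hs => ?_⟩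
  by_contra hc
  have h1 := hR (subset_tsupport m hc)
  rw [mem_closedBall_zero_iff, Real.norm_eq_abs] at h1
  exact absurd hs (not_lt.2 (h1.trans (le_max_left _ _)))

lemma GK.lip {m : ℝ → ℝ} (h : GK m) : ∃ K, 0 ≤ K ∧ ∀ s t, |m s - m t| ≤ K * |s - t| := by
  obtain ⟨K, hK⟩ := ContDiff.lipschitzWith_of_hasCompactSupport h.cs h.smooth (by simp)
  refine ⟨K, K.2, fun s t => ?_⟩
  have := hK.dist_le_mul s t
  rwa [Real.dist_eq, Real.dist_eq] at this

lemma GK.int {m : ℝ → ℝ} (h : GK m) : Integrable m := h.cont.integrable_of_hasCompactSupport h.cs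

def VV (m n f : ℝ → ℝ) (p : ℝ × ℝ) : ℝ := if 0 ≤ p.2 then TT m f p.1 p.2 else TT n f p.1 p.2
def dd (p q : ℝ × ℝ) : ℝ := √((p.1 - q.1) ^ 2 + (p.2 - q.2) ^ 2)
def GG (v : ℝ × ℝ → ℝ) : ENNReal :=
  ∫⁻ p : ℝ × ℝ, ∫⁻ q : ℝ × ℝ, ENNReal.ofReal ((v p - v q) ^ 2 / dd p q ^ 3)

lemma dd_meas : Measurable fun w : (ℝ × ℝ) × (ℝ × ℝ) => dd w.1 w.2 := by
  unfold dd; fun_prop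

lemma VV_meas {m n f : ℝ → ℝ} (hf : Measurable f) (hm : Measurable m) (hn : Measurable n) :
    Measurable (VV m n f) :=
  Measurable.ite (measurableSet_le measurable_const measurable_snd) (TT_meas hf hm) (TT_meas hf hn)

lemma subst2 {F : ℝ × ℝ → ENNReal} (hF : Measurable F) (x : ℝ) {y : ℝ} (hy : y ≠ 0) :
    ∫⁻ q, F q = ENNReal.ofReal (y ^ 2) * ∫⁻ w : ℝ × ℝ, F (x + w.1 * y, w.2 * y) := by
  have hF2 : Measurable fun w : ℝ × ℝ => F (x + w.1 * y, w.2 * y) := by fun_prop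
  rw [Measure.volume_eq_prod, lintegral_prod _ hF.aemeasurable, lintegral_prod _ hF2.aemeasurable]
  rw [aff_lint hy (-x)]
  have : ∀ x', ∫⁻ y', F (x', y') = ENNReal.ofReal |y| * ∫⁻ l, F (x', l * y) := by
    intro x'
    rw [aff_lint hy 0]
    simp [mul_comm]
  simp only [this]
  rw [lintegral_const_mul' _ _ ENNReal.ofReal_ne_top, ← mul_assoc, ← ENNReal.ofReal_mul (abs_nonneg _),
    ← pow_two, sq_abs]
  congr 1
  refine lintegral_congr fun a => lintegral_congr fun l => ?_
  rw [sub_neg_eq_add, add_comm, mul_comm]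


lemma TTk {m n f : ℝ → ℝ} {x y a l : ℝ} (hl : l ≠ 0) (h1 : Integrable fun s => f (x - y * s) * m s)
    (h2 : Integrable fun s => f (x - y * s) * resc m a l s)
    (h3 : Integrable fun s => f (x - y * s) * resc n a l s) :
    TT (kap m n a l) f x y = TT m f x y -
      (if 0 < l then TT m f (x + a * y) (l * y) else TT n f (x + a * y) (l * y)) := by
  by_cases h : 0 < l
  · rw [if_pos h, TT_resc x y a hl]
    unfold TT kap
    simp only [if_pos h, mul_sub]
    exact integral_sub h1 h2
  · rw [if_neg h, TT_resc x y a hl]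
    unfold TT kap
    simp only [if_neg h, mul_sub]
    exact integral_sub h1 h3

lemma resc_bk {m : ℝ → ℝ} {M R a l : ℝ} (h : BK m M R) (hl : l ≠ 0) : ∃ M' R', BK (resc m a l) M' R' := by
  have hM := h.M0
  have hR := h.R1
  refine ⟨M * |l|⁻¹, |l| * R + |a| + 1, resc_meas h.meas a l, by positivity, ?_, fun s => ?_, fun s hs => ?_⟩
  · have : 0 ≤ |l| * R := by positivity
    linarith [abs_nonneg a]
  · unfold resc; rw [abs_mul, abs_inv, abs_abs]
    have := h.bd ((s + a) / l)
    gcongr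
  · unfold resc
    rw [h.supp, zero_mul]
    rw [abs_div, lt_div_iff₀ (abs_pos.2 hl)]
    have : |s| ≤ |s + a| + |a| := by
      have := abs_sub (s + a) a
      simpa using this
    linarith

lemma loc_int {m f : ℝ → ℝ} {M R : ℝ} (h : BK m M R) (hf : Measurable f) (hf2 : MemLp f 2 (volume : Measure ℝ))
    (x : ℝ) {y : ℝ} (hy : y ≠ 0) : Integrable fun s => f (x - y * s) * m s := by
  have h1 : Integrable fun s => f (x - y * s) ^ 2 := by
    have := (hf2.integrable_sq.comp_sub_left x).comp_mul_left' hy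
    exact this
  have h2 : Integrable fun s => m s ^ 2 := by
    have : Integrable fun s => m s * m s := h.int.bdd_mul (c := M) h.meas.aestronglyMeasurable
      (Filter.Eventually.of_forall fun s => h.bd s)
    simpa [pow_two] using this
  have hm := h.meas
  refine (h1.add h2).mono' (by fun_prop) (Filter.Eventually.of_forall fun s => ?_)
  simp only [Pi.add_apply]
  rw [Real.norm_eq_abs, abs_le]
  constructor <;> nlinarith [sq_nonneg (f (x - y * s) - m s), sq_nonneg (f (x - y * s) + m s), sq_nonneg (f (x - y * s)), sq_nonneg (m s)]

lemma VV_kap {m n f : ℝ → ℝ} {M R M' R' : ℝ} (hm : BK m M R) (hn : BK n M' R') (hf : Measurable f)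
    (hf2 : MemLp f 2 (volume : Measure ℝ)) (x a : ℝ) {y l : ℝ} (hy : y ≠ 0) (hl : l ≠ 0) :
    (VV m n f (x, y) - VV m n f (x + a * y, l * y)) ^ 2 ≤
      TT (kap m n a l) f x y ^ 2 + TT (kap n m a l) f x y ^ 2 := by
  obtain ⟨_, _, h1⟩ := resc_bk (a := a) hm hl
  obtain ⟨_, _, h2⟩ := resc_bk (a := a) hn hl
  have k1 := TTk (m := m) (n := n) hl (loc_int hm hf hf2 x hy) (loc_int h1 hf hf2 x hy) (loc_int h2 hf hf2 x hy)
  have k2 := TTk (m := n) (n := m) hl (loc_int hn hf hf2 x hy) (loc_int h2 hf hf2 x hy) (loc_int h1 hf hf2 x hy)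
  unfold VV
  simp only
  rcases lt_or_gt_of_ne hy with h | h
  · have e : VV m n f (x, y) - VV m n f (x + a * y, l * y) = TT (kap n m a l) f x y := by
      rw [k2]; unfold VV; simp only
      rw [if_neg (not_le.2 h)]
      congr 1
      rcases lt_or_gt_of_ne hl with h' | h'
      · rw [if_pos (mul_nonneg_of_nonpos_of_nonpos h'.le h.le), if_neg (not_lt.2 h'.le)]
      · rw [if_neg (not_le.2 (mul_neg_of_pos_of_neg h' h)), if_pos h']
    unfold VV at e; simp only at e; rw [e]; nlinarith [sq_nonneg (TT (kap m n a l) f x y)]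
  · have e : VV m n f (x, y) - VV m n f (x + a * y, l * y) = TT (kap m n a l) f x y := by
      rw [k1]; unfold VV; simp only
      rw [if_pos h.le]
      congr 1
      rcases lt_or_gt_of_ne hl with h' | h'
      · rw [if_neg (not_le.2 (mul_neg_of_neg_of_pos h' h)), if_neg (not_lt.2 h'.le)]
      · rw [if_pos (mul_nonneg h'.le h.le), if_pos h']
    unfold VV at e; simp only at e; rw [e]; nlinarith [sq_nonneg (TT (kap n m a l) f x y)]

lemma kap_joint {m n : ℝ → ℝ} (hm : Measurable m) (hn : Measurable n) :
    Measurable fun w : ℝ × ℝ × ℝ => kap m n w.1 w.2.1 w.2.2 := by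
  unfold kap resc
  refine Measurable.sub (by fun_prop) (Measurable.ite ?_ (by fun_prop) (by fun_prop))
  exact measurableSet_lt measurable_const (by fun_prop)

lemma TTk_joint {m n f : ℝ → ℝ} (hm : Measurable m) (hn : Measurable n) (hf : Measurable f) :
    Measurable fun w : (ℝ × ℝ) × (ℝ × ℝ) => TT (kap m n w.2.1 w.2.2) f w.1.1 w.1.2 := by
  have hk := kap_joint hm hn
  have h1 : Measurable fun w : ((ℝ × ℝ) × (ℝ × ℝ)) × ℝ => kap m n w.1.2.1 w.1.2.2 w.2 :=
    hk.comp (g := fun w : ℝ × ℝ × ℝ => kap m n w.1 w.2.1 w.2.2)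
      (f := fun w : ((ℝ × ℝ) × (ℝ × ℝ)) × ℝ => (w.1.2.1, w.1.2.2, w.2)) (by fun_prop)
  have : StronglyMeasurable (Function.uncurry fun (w : (ℝ × ℝ) × (ℝ × ℝ)) (s : ℝ) =>
      f (w.1.1 - w.1.2 * s) * kap m n w.2.1 w.2.2 s) :=
    Measurable.stronglyMeasurable (by unfold Function.uncurry; fun_prop)
  exact this.integral_prod_right.measurable

/-- the Gagliardo integral of one kernel difference -/
lemma SQ_kap {m n : ℝ → ℝ} (hm : GK m) (hn : GK n) (he : ∫ s, m s = ∫ s, n s) : ∃ C, 0 ≤ C ∧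
    ∀ f : ℝ → ℝ, Measurable f → MemLp f 2 (volume : Measure ℝ) →
    ∫⁻ w : ℝ × ℝ, ∫⁻ p : ℝ × ℝ, ENNReal.ofReal (TT (kap m n w.1 w.2) f p.1 p.2 ^ 2 / (|p.2| * rr w.1 w.2 ^ 3))
      ≤ ENNReal.ofReal (C * ∫ x, f x ^ 2) := by
  obtain ⟨M, R, bm⟩ := hm.bk
  obtain ⟨M', R', bn⟩ := hn.bk
  obtain ⟨K, hK, hL⟩ := hm.lip
  obtain ⟨C, hC, H⟩ := KB bm bn hK hL
  obtain ⟨CW, hCW, hCW0⟩ := WW_lint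
  refine ⟨4 * C * CW, by positivity, fun f hf hf2 => ?_⟩
  have hI : 0 ≤ ∫ x, f x ^ 2 := integral_nonneg fun x => sq_nonneg _
  have mWW : Measurable fun w : ℝ × ℝ => ENNReal.ofReal (WW w.1 w.2) := WW_meas.ennreal_ofReal
  have key : ∀ᵐ w : ℝ × ℝ, ∫⁻ p : ℝ × ℝ, ENNReal.ofReal (TT (kap m n w.1 w.2) f p.1 p.2 ^ 2 / (|p.2| * rr w.1 w.2 ^ 3))
      ≤ ENNReal.ofReal (4 * (∫ x, f x ^ 2) * C) * ENNReal.ofReal (WW w.1 w.2) := by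
    have a1 : ∀ᵐ w : ℝ × ℝ, w.1 ≠ 0 := by
      have := Measure.quasiMeasurePreserving_fst (μ := (volume : Measure ℝ)) (ν := (volume : Measure ℝ))
      exact this.ae (Measure.ae_ne volume 0)
    have a2 : ∀ᵐ w : ℝ × ℝ, w.2 ≠ 0 := by
      have := Measure.quasiMeasurePreserving_snd (μ := (volume : Measure ℝ)) (ν := (volume : Measure ℝ))
      exact this.ae (Measure.ae_ne volume 0)
    have a3 : ∀ᵐ w : ℝ × ℝ, w.2 ≠ 1 := by
      have := Measure.quasiMeasurePreserving_snd (μ := (volume : Measure ℝ)) (ν := (volume : Measure ℝ))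
      exact this.ae (Measure.ae_ne volume 1)
    filter_upwards [a1, a2, a3] with w h1 h2 h3
    obtain ⟨a, l⟩ := w
    simp only at h1 h2 h3 ⊢
    have hr : 0 < rr a l := by
      unfold rr; apply Real.sqrt_pos.2
      have : 0 < a ^ 2 := by positivity
      positivity
    have hWW := WW_nonneg a l
    obtain ⟨b1, b2⟩ := LK_bridge (kap_meas bm.meas bn.meas a l) (by positivity) (H a l h1 h2 h3)
    have sq := SQ hf hf2 (kap_meas bm.meas bn.meas a l) (kap_int bm.int bn.int a h2)
      (kap_zero bm.int bn.int a h2 he) b1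
    have mT := TT_meas hf (kap_meas bm.meas bn.meas a l)
    have mF : Measurable fun p : ℝ × ℝ => ENNReal.ofReal (TT (kap m n a l) f p.1 p.2 ^ 2 / (|p.2| * rr a l ^ 3)) := by
      fun_prop
    rw [Measure.volume_eq_prod, lintegral_prod_symm _ mF.aemeasurable]
    have e1 : ∀ y, ∫⁻ x, ENNReal.ofReal (TT (kap m n a l) f x y ^ 2 / (|y| * rr a l ^ 3)) =
        ENNReal.ofReal (rr a l ^ 3)⁻¹ * ENNReal.ofReal ((∫ x, TT (kap m n a l) f x y ^ 2) / |y|) := by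
      intro y
      have : ∀ x, ENNReal.ofReal (TT (kap m n a l) f x y ^ 2 / (|y| * rr a l ^ 3)) =
          ENNReal.ofReal ((rr a l ^ 3)⁻¹ * |y|⁻¹) * ENNReal.ofReal (TT (kap m n a l) f x y ^ 2) := by
        intro x
        rw [← ENNReal.ofReal_mul (by positivity), div_eq_mul_inv, mul_inv]
        congr 1; ring
      simp only [this]
      rw [lintegral_const_mul' _ _ ENNReal.ofReal_ne_top, TT_lint hf hf2 (kap_meas bm.meas bn.meas a l) (kap_int bm.int bn.int a h2),
        ← ENNReal.ofReal_mul (by positivity), ← ENNReal.ofReal_mul (by positivity)]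
      congr 1; ring
    simp only [e1]
    rw [lintegral_const_mul' _ _ ENNReal.ofReal_ne_top]
    refine (mul_le_mul_right sq _).trans ?_
    rw [← ENNReal.ofReal_mul (by positivity), ← ENNReal.ofReal_mul (by positivity)]
    apply ENNReal.ofReal_le_ofReal
    calc (rr a l ^ 3)⁻¹ * (4 * (∫ x, f x ^ 2) * KL (kap m n a l))
        ≤ (rr a l ^ 3)⁻¹ * (4 * (∫ x, f x ^ 2) * (C * (rr a l ^ 3 * WW a l))) := by gcongr
      _ = _ := by field_simp
  refine (lintegral_mono_ae key).trans ?_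
  rw [lintegral_const_mul' _ _ ENNReal.ofReal_ne_top, Measure.volume_eq_prod, lintegral_prod _ mWW.aemeasurable, hCW,
    ← ENNReal.ofReal_mul (by positivity)]
  apply ENNReal.ofReal_le_ofReal
  apply le_of_eq; ring

lemma GG_VV {m n : ℝ → ℝ} (hm : GK m) (hn : GK n) (he : ∫ s, m s = ∫ s, n s) : ∃ C, 0 ≤ C ∧
    ∀ f : ℝ → ℝ, Measurable f → MemLp f 2 (volume : Measure ℝ) →
    GG (VV m n f) ≤ ENNReal.ofReal (C * ∫ x, f x ^ 2) := by
  obtain ⟨M, R, bm⟩ := hm.bk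
  obtain ⟨M', R', bn⟩ := hn.bk
  obtain ⟨C1, h1, H1⟩ := SQ_kap hm hn he
  obtain ⟨C2, h2, H2⟩ := SQ_kap hn hm he.symm
  refine ⟨C1 + C2, by positivity, fun f hf hf2 => ?_⟩
  have hI : 0 ≤ ∫ x, f x ^ 2 := integral_nonneg fun x => sq_nonneg _
  have mV := VV_meas hf bm.meas bn.meas
  set F1 : ℝ × ℝ → ℝ × ℝ → ENNReal := fun p w =>
    ENNReal.ofReal (TT (kap m n w.1 w.2) f p.1 p.2 ^ 2 / (|p.2| * rr w.1 w.2 ^ 3)) with hF1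
  set F2 : ℝ × ℝ → ℝ × ℝ → ENNReal := fun p w =>
    ENNReal.ofReal (TT (kap n m w.1 w.2) f p.1 p.2 ^ 2 / (|p.2| * rr w.1 w.2 ^ 3)) with hF2
  have mr : Measurable fun w : (ℝ × ℝ) × (ℝ × ℝ) => rr w.2.1 w.2.2 := by unfold rr; fun_prop
  have mF1 : Measurable (Function.uncurry F1) := by
    have := TTk_joint bm.meas bn.meas hf
    simp only [hF1]
    unfold Function.uncurry
    exact ((this.pow_const 2).div (((by fun_prop : Measurable fun w : (ℝ × ℝ) × (ℝ × ℝ) => |w.1.2|)).mul (mr.pow_const 3))).ennreal_ofReal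
  have mF2 : Measurable (Function.uncurry F2) := by
    have := TTk_joint bn.meas bm.meas hf
    simp only [hF2]
    unfold Function.uncurry
    exact ((this.pow_const 2).div (((by fun_prop : Measurable fun w : (ℝ × ℝ) × (ℝ × ℝ) => |w.1.2|)).mul (mr.pow_const 3))).ennreal_ofReal
  have a2 : ∀ᵐ w : ℝ × ℝ, w.2 ≠ 0 := by
    have := Measure.quasiMeasurePreserving_snd (μ := (volume : Measure ℝ)) (ν := (volume : Measure ℝ))
    exact this.ae (Measure.ae_ne volume 0)
  have step : GG (VV m n f) ≤ ∫⁻ p, ∫⁻ w, (F1 p w + F2 p w) := by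
    unfold GG
    refine lintegral_mono_ae ?_
    filter_upwards [a2] with p hp
    obtain ⟨x, y⟩ := p
    simp only at hp
    have mq : Measurable fun q : ℝ × ℝ => ENNReal.ofReal ((VV m n f (x, y) - VV m n f q) ^ 2 / dd (x, y) q ^ 3) := by
      have : Measurable fun q : ℝ × ℝ => dd (x, y) q := by unfold dd; fun_prop
      fun_prop
    rw [subst2 mq x hp, ← lintegral_const_mul' _ _ ENNReal.ofReal_ne_top]
    refine lintegral_mono_ae ?_
    filter_upwards [a2] with w hw
    obtain ⟨a, l⟩ := w
    simp only at hw
    simp only [hF1, hF2]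
    have hy : 0 < |y| := abs_pos.2 hp
    have hr0 : 0 ≤ rr a l := Real.sqrt_nonneg _
    rw [← ENNReal.ofReal_mul (by positivity), ← ENNReal.ofReal_add (by positivity) (by positivity)]
    apply ENNReal.ofReal_le_ofReal
    have ed : dd (x, y) (x + a * y, l * y) = |y| * rr a l := by
      unfold dd rr
      rw [← Real.sqrt_sq_eq_abs, ← Real.sqrt_mul (sq_nonneg y)]
      congr 1; simp only; ring
    rw [ed, ← add_div]
    have kk := VV_kap bm bn hf hf2 x a hp hw
    calc y ^ 2 * ((VV m n f (x, y) - VV m n f (x + a * y, l * y)) ^ 2 / (|y| * rr a l) ^ 3)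
        = (VV m n f (x, y) - VV m n f (x + a * y, l * y)) ^ 2 / (|y| * rr a l ^ 3) := by
          rw [← sq_abs y, mul_pow]
          rw [show |y| ^ 3 * rr a l ^ 3 = |y| ^ 2 * (|y| * rr a l ^ 3) by ring, ← mul_div_assoc,
            mul_div_mul_left _ _ (by positivity)]
      _ ≤ _ := by gcongr
  refine step.trans ?_
  rw [lintegral_lintegral_swap (mF1.add mF2).aemeasurable]
  have : ∀ w, ∫⁻ p, (F1 p w + F2 p w) = (∫⁻ p, F1 p w) + ∫⁻ p, F2 p w := fun w =>
    lintegral_add_left (mF1.comp (measurable_id.prodMk measurable_const)) _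
  simp only [this]
  have mF1' : Measurable fun w => ∫⁻ p, F1 p w := mF1.lintegral_prod_left'
  rw [lintegral_add_left mF1', add_mul, ENNReal.ofReal_add (by positivity) (by positivity)]
  exact add_le_add (H1 f hf hf2) (H2 f hf hf2)

def QQ (c m n f : ℝ → ℝ) (p : ℝ × ℝ) : ℝ := c p.2 * VV m n f p

lemma VV_slice {m n : ℝ → ℝ} (hm : GK m) (hn : GK n) : ∃ B, 0 ≤ B ∧
    ∀ f : ℝ → ℝ, Measurable f → MemLp f 2 (volume : Measure ℝ) → ∀ y,
    ∫⁻ x, ENNReal.ofReal (VV m n f (x, y) ^ 2) ≤ ENNReal.ofReal (B * ∫ x, f x ^ 2) := by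
  refine ⟨(∫ s, |m s|) ^ 2 + (∫ s, |n s|) ^ 2, by positivity, fun f hf hf2 y => ?_⟩
  have hI : 0 ≤ ∫ x, f x ^ 2 := integral_nonneg fun x => sq_nonneg _
  unfold VV
  by_cases h : 0 ≤ y
  · simp only [if_pos h]
    rw [TT_lint hf hf2 hm.cont.measurable hm.int]
    apply ENNReal.ofReal_le_ofReal
    refine (TT_sq_bound hf hf2 hm.cont.measurable hm.int y).trans ?_
    gcongr
    nlinarith [sq_nonneg (∫ s, |n s|)]
  · simp only [if_neg h]
    rw [TT_lint hf hf2 hn.cont.measurable hn.int]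
    apply ENNReal.ofReal_le_ofReal
    refine (TT_sq_bound hf hf2 hn.cont.measurable hn.int y).trans ?_
    gcongr
    nlinarith [sq_nonneg (∫ s, |m s|)]

lemma L2_QQ {c m n : ℝ → ℝ} (hc : GK c) (hm : GK m) (hn : GK n) : ∃ C, 0 ≤ C ∧
    ∀ f : ℝ → ℝ, Measurable f → MemLp f 2 (volume : Measure ℝ) →
    ∫⁻ p, ENNReal.ofReal (QQ c m n f p ^ 2) ≤ ENNReal.ofReal (C * ∫ x, f x ^ 2) := by
  obtain ⟨B, hB, H⟩ := VV_slice hm hn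
  have ic : Integrable fun y => c y ^ 2 :=
    (hc.cont.pow 2).integrable_of_hasCompactSupport (by
      have := hc.cs.comp_left (g := fun t : ℝ => t ^ 2) (by simp); exact this)
  have hJ : 0 ≤ ∫ y, c y ^ 2 := integral_nonneg fun y => sq_nonneg _
  refine ⟨(∫ y, c y ^ 2) * B, by positivity, fun f hf hf2 => ?_⟩
  have hI : 0 ≤ ∫ x, f x ^ 2 := integral_nonneg fun x => sq_nonneg _
  have mV := VV_meas hf hm.cont.measurable hn.cont.measurable
  have mc := hc.cont.measurable
  have mF : Measurable fun p => ENNReal.ofReal (QQ c m n f p ^ 2) := by unfold QQ; fun_prop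
  rw [Measure.volume_eq_prod, lintegral_prod_symm _ mF.aemeasurable]
  calc _ ≤ ∫⁻ y, ENNReal.ofReal (c y ^ 2) * ENNReal.ofReal (B * ∫ x, f x ^ 2) := by
        refine lintegral_mono fun y => ?_
        simp only [QQ, mul_pow, ENNReal.ofReal_mul (sq_nonneg (c y))]
        rw [lintegral_const_mul' _ _ ENNReal.ofReal_ne_top]
        exact mul_le_mul_right (H f hf hf2 y) _
    _ = _ := by
        rw [lintegral_mul_const' _ _ ENNReal.ofReal_ne_top,
          ← ofReal_integral_eq_lintegral_ofReal ic (Filter.Eventually.of_forall fun y => sq_nonneg _),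
          ← ENNReal.ofReal_mul hJ, mul_assoc]

lemma lint_inv_sq : ∫⁻ t : ℝ, ENNReal.ofReal ((1 + t ^ 2)⁻¹) = ENNReal.ofReal π := by
  rw [← integral_univ_inv_one_add_sq, ofReal_integral_eq_lintegral_ofReal integrable_inv_one_add_sq
    (Filter.Eventually.of_forall fun t => by simp only [Pi.zero_apply]; positivity)]

lemma slice_dd (x : ℝ) {δ : ℝ} (hδ : δ ≠ 0) :
    ∫⁻ x', ENNReal.ofReal ((√((x - x') ^ 2 + δ ^ 2) ^ 3)⁻¹) ≤ ENNReal.ofReal (π * (δ ^ 2)⁻¹) := by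
  have hd : 0 < |δ| := abs_pos.2 hδ
  rw [aff_lint hδ (-x)]
  calc _ ≤ ENNReal.ofReal |δ| * ∫⁻ σ, ENNReal.ofReal ((|δ| ^ 3)⁻¹) * ENNReal.ofReal ((1 + σ ^ 2)⁻¹) := by
        refine mul_le_mul_right (lintegral_mono fun σ => ?_) _
        simp only
        rw [← ENNReal.ofReal_mul (by positivity)]
        apply ENNReal.ofReal_le_ofReal
        rw [← mul_inv]
        apply inv_anti₀ (by positivity)
        have e : √((x - (δ * σ - -x)) ^ 2 + δ ^ 2) = |δ| * √(1 + σ ^ 2) := by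
          rw [← Real.sqrt_sq_eq_abs, ← Real.sqrt_mul (sq_nonneg δ)]
          congr 1; ring
        rw [e, mul_pow]
        gcongr
        have h1 : 1 ≤ √(1 + σ ^ 2) := Real.one_le_sqrt.2 (by nlinarith [sq_nonneg σ])
        have h2 : √(1 + σ ^ 2) ^ 2 = 1 + σ ^ 2 := Real.sq_sqrt (by positivity)
        calc 1 + σ ^ 2 = √(1 + σ ^ 2) ^ 2 := h2.symm
          _ ≤ √(1 + σ ^ 2) ^ 3 := pow_le_pow_right₀ h1 (by norm_num)
    _ = _ := by
        rw [lintegral_const_mul' _ _ ENNReal.ofReal_ne_top, lint_inv_sq, ← ENNReal.ofReal_mul (by positivity),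
          ← ENNReal.ofReal_mul (by positivity)]
        congr 1
        rw [← sq_abs δ]
        field_simp

lemma JJ {c : ℝ → ℝ} (hc : GK c) : ∃ C, 0 ≤ C ∧
    ∫⁻ y, ∫⁻ y', ENNReal.ofReal ((c y - c y') ^ 2 * ((y - y') ^ 2)⁻¹) ≤ ENNReal.ofReal C := by
  obtain ⟨B, A, bc⟩ := hc.bk
  obtain ⟨K, hK, hL⟩ := hc.lip
  have hB := bc.M0
  have hA := bc.R1
  set C0 := K ^ 2 + 4 * B ^ 2 with hC0
  set g : ℝ → ℝ := (Icc (-A) A).indicator (fun _ => (1:ℝ)) with hg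
  have mg : Measurable g := measurable_const.indicator measurableSet_Icc
  have g0 : ∀ y, 0 ≤ g y := fun y => indicator_nonneg (fun _ _ => by norm_num) y
  have g1 : ∀ y, c y ≠ 0 → g y = 1 := fun y hy => by
    rw [hg, indicator_of_mem]
    by_contra h
    apply hy; apply bc.supp
    by_contra h2
    exact h (abs_le.1 (not_lt.1 h2))
  have lg : ∫⁻ y, ENNReal.ofReal (g y) = ENNReal.ofReal (2 * A) := by
    have : (fun y => ENNReal.ofReal (g y)) = (Icc (-A) A).indicator (fun _ => 1) := by
      funext y
      by_cases h : y ∈ Icc (-A) A <;> simp [hg, h]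
    rw [this, lintegral_indicator measurableSet_Icc]
    rw [setLIntegral_one, Real.volume_Icc]
    congr 1; ring
  have pw : ∀ y y', (c y - c y') ^ 2 * ((y - y') ^ 2)⁻¹ ≤ C0 * (g y * (1 + (y - y') ^ 2)⁻¹) + C0 * (g y' * (1 + (y - y') ^ 2)⁻¹) := by
    intro y y'
    by_cases h : c y = 0 ∧ c y' = 0
    · rw [h.1, h.2]; simp
      have := g0 y; have := g0 y'
      positivity
    · have hgg : 1 ≤ g y + g y' := by
        rw [not_and_or] at h
        rcases h with h | h
        · rw [g1 y h]; linarith [g0 y']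
        · rw [g1 y' h]; linarith [g0 y]
      have hle : (c y - c y') ^ 2 * ((y - y') ^ 2)⁻¹ ≤ C0 * (1 + (y - y') ^ 2)⁻¹ := by
        rcases eq_or_ne y y' with e | e
        · rw [e]; simp; positivity
        · have hp : 0 < (y - y') ^ 2 := by
            have := sub_ne_zero.2 e
            positivity
          rw [← div_eq_mul_inv, ← div_eq_mul_inv, div_le_div_iff₀ hp (by positivity)]
          have l1 : (c y - c y') ^ 2 ≤ K ^ 2 * (y - y') ^ 2 := by
            have := hL y y'
            rw [← sq_abs (c y - c y'), ← sq_abs (y - y'), ← mul_pow]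
            gcongr
          have l2 : (c y - c y') ^ 2 ≤ 4 * B ^ 2 := by
            have h1 := bc.bd y; have h2 := bc.bd y'
            have : |c y - c y'| ≤ 2 * B := (abs_sub _ _).trans (by linarith)
            rw [← sq_abs]
            calc _ ≤ (2 * B) ^ 2 := by gcongr
              _ = _ := by ring
          have : (c y - c y') ^ 2 * (y - y') ^ 2 ≤ 4 * B ^ 2 * (y - y') ^ 2 := by gcongr
          rw [hC0]; nlinarith
      calc _ ≤ C0 * (1 + (y - y') ^ 2)⁻¹ := hle
        _ ≤ C0 * (1 + (y - y') ^ 2)⁻¹ * (g y + g y') := le_mul_of_one_le_right (by positivity) hgg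
        _ = _ := by ring
  have hC00 : 0 ≤ C0 := by positivity
  refine ⟨2 * (C0 * (2 * A * π)), by positivity, ?_⟩
  have T1 : ∀ y, ∫⁻ y', ENNReal.ofReal ((1 + (y - y') ^ 2)⁻¹) = ENNReal.ofReal π := fun y => by
    rw [lintegral_sub_left_eq_self (fun t => ENNReal.ofReal ((1 + t ^ 2)⁻¹)) y, lint_inv_sq]
  have T2 : ∀ y', ∫⁻ y, ENNReal.ofReal ((1 + (y - y') ^ 2)⁻¹) = ENNReal.ofReal π := fun y => by
    rw [lintegral_sub_right_eq_self (fun t => ENNReal.ofReal ((1 + t ^ 2)⁻¹)) y, lint_inv_sq]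
  have S1 : ∫⁻ y, ∫⁻ y', ENNReal.ofReal (C0 * (g y * (1 + (y - y') ^ 2)⁻¹)) = ENNReal.ofReal (C0 * (2 * A * π)) := by
    have : ∀ y, ∫⁻ y', ENNReal.ofReal (C0 * (g y * (1 + (y - y') ^ 2)⁻¹)) = ENNReal.ofReal C0 * (ENNReal.ofReal (g y) * ENNReal.ofReal π) := by
      intro y
      rw [← T1 y, ← lintegral_const_mul' _ _ ENNReal.ofReal_ne_top, ← lintegral_const_mul' _ _ ENNReal.ofReal_ne_top]
      refine lintegral_congr fun y' => ?_
      rw [ENNReal.ofReal_mul hC00, ENNReal.ofReal_mul (g0 y)]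
    simp only [this]
    rw [lintegral_const_mul' _ _ ENNReal.ofReal_ne_top, lintegral_mul_const' _ _ ENNReal.ofReal_ne_top, lg,
      ← ENNReal.ofReal_mul (by positivity), ← ENNReal.ofReal_mul (by positivity)]
  have S2 : ∫⁻ y, ∫⁻ y', ENNReal.ofReal (C0 * (g y' * (1 + (y - y') ^ 2)⁻¹)) = ENNReal.ofReal (C0 * (2 * A * π)) := by
    have mm : Measurable (Function.uncurry fun y y' : ℝ => ENNReal.ofReal (C0 * (g y' * (1 + (y - y') ^ 2)⁻¹))) := by
      unfold Function.uncurry; fun_prop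
    rw [lintegral_lintegral_swap mm.aemeasurable, ← S1]
    refine lintegral_congr fun y => lintegral_congr fun y' => ?_
    rw [show (y' - y) ^ 2 = (y - y') ^ 2 by ring]
  calc _ ≤ ∫⁻ y, ∫⁻ y', (ENNReal.ofReal (C0 * (g y * (1 + (y - y') ^ 2)⁻¹)) + ENNReal.ofReal (C0 * (g y' * (1 + (y - y') ^ 2)⁻¹))) := by
        refine lintegral_mono fun y => lintegral_mono fun y' => ?_
        simp only
        have := g0 y; have := g0 y'
        rw [← ENNReal.ofReal_add (by positivity) (by positivity)]
        exact ENNReal.ofReal_le_ofReal (pw y y')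
    _ = (∫⁻ y, ∫⁻ y', ENNReal.ofReal (C0 * (g y * (1 + (y - y') ^ 2)⁻¹))) + ∫⁻ y, ∫⁻ y', ENNReal.ofReal (C0 * (g y' * (1 + (y - y') ^ 2)⁻¹)) := by
        have mm : Measurable (Function.uncurry fun y y' : ℝ => ENNReal.ofReal (C0 * (g y * (1 + (y - y') ^ 2)⁻¹))) := by
          unfold Function.uncurry; fun_prop
        have m2 : Measurable fun y => ∫⁻ y', ENNReal.ofReal (C0 * (g y * (1 + (y - y') ^ 2)⁻¹)) := mm.lintegral_prod_right'
        rw [← lintegral_add_left m2]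
        refine lintegral_congr fun y => ?_
        rw [lintegral_add_left (by fun_prop)]
    _ = _ := by
        rw [S1, S2, ← ENNReal.ofReal_add (by positivity) (by positivity)]
        congr 1; ring
    _ ≤ _ := le_refl _

set_option maxHeartbeats 1000000 in
lemma GG_QQ {c m n : ℝ → ℝ} (hc : GK c) (hm : GK m) (hn : GK n) (he : ∫ s, m s = ∫ s, n s) : ∃ C, 0 ≤ C ∧
    ∀ f : ℝ → ℝ, Measurable f → MemLp f 2 (volume : Measure ℝ) →
    GG (QQ c m n f) ≤ ENNReal.ofReal (C * ∫ x, f x ^ 2) := by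
  obtain ⟨C1, h1, H1⟩ := GG_VV hm hn he
  obtain ⟨B, A, bc⟩ := hc.bk
  obtain ⟨C2, h2, H2⟩ := VV_slice hm hn
  obtain ⟨C3, h3, H3⟩ := JJ hc
  have hB := bc.M0
  refine ⟨2 * B ^ 2 * C1 + 2 * π * C2 * C3, by positivity, fun f hf hf2 => ?_⟩
  have hI : 0 ≤ ∫ x, f x ^ 2 := integral_nonneg fun x => sq_nonneg _
  have mV := VV_meas hf hm.cont.measurable hn.cont.measurable
  have mc := hc.cont.measurable
  have md := dd_meas
  have d0 : ∀ p q, 0 ≤ dd p q := fun p q => Real.sqrt_nonneg _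
  set v := VV m n f with hv
  set F1 : ℝ × ℝ → ℝ × ℝ → ENNReal := fun p q =>
    ENNReal.ofReal ((v p - v q) ^ 2 / dd p q ^ 3) with hF1
  set F2 : ℝ × ℝ → ℝ × ℝ → ENNReal := fun p q =>
    ENNReal.ofReal (v p ^ 2) * ENNReal.ofReal ((c p.2 - c q.2) ^ 2 * (dd p q ^ 3)⁻¹) with hF2
  have mF1 : Measurable (Function.uncurry F1) := by
    simp only [hF1]; unfold Function.uncurry; fun_prop
  have mF2 : Measurable (Function.uncurry F2) := by
    simp only [hF2]; unfold Function.uncurry; fun_prop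
  have pw : ∀ p q, ENNReal.ofReal ((QQ c m n f p - QQ c m n f q) ^ 2 / dd p q ^ 3) ≤
      ENNReal.ofReal (2 * B ^ 2) * F1 p q + 2 * F2 p q := by
    intro p q
    have hd := d0 p q
    simp only [hF1, hF2]
    rw [show (2 : ENNReal) = ENNReal.ofReal 2 by simp, ← ENNReal.ofReal_mul (by positivity), ← ENNReal.ofReal_mul (by positivity),
      ← ENNReal.ofReal_mul (by positivity), ← ENNReal.ofReal_add (by positivity) (by positivity)]
    apply ENNReal.ofReal_le_ofReal
    have e : (QQ c m n f p - QQ c m n f q) ^ 2 ≤ 2 * B ^ 2 * (v p - v q) ^ 2 + 2 * (v p ^ 2 * (c p.2 - c q.2) ^ 2) := by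
      unfold QQ
      rw [← hv]
      have e1 : c p.2 * v p - c q.2 * v q = c q.2 * (v p - v q) + v p * (c p.2 - c q.2) := by ring
      rw [e1]
      have e2 : (c q.2) ^ 2 ≤ B ^ 2 := by rw [← sq_abs]; have := bc.bd q.2; gcongr
      have e3 : (c q.2) ^ 2 * (v p - v q) ^ 2 ≤ B ^ 2 * (v p - v q) ^ 2 := by gcongr
      nlinarith [sq_nonneg (c q.2 * (v p - v q) - v p * (c p.2 - c q.2))]
    calc _ ≤ (2 * B ^ 2 * (v p - v q) ^ 2 + 2 * (v p ^ 2 * (c p.2 - c q.2) ^ 2)) / dd p q ^ 3 := by gcongr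
      _ = _ := by ring
  have inner : ∀ p : ℝ × ℝ, ∫⁻ q : ℝ × ℝ, ENNReal.ofReal ((c p.2 - c q.2) ^ 2 * (dd p q ^ 3)⁻¹) ≤
      ENNReal.ofReal π * ∫⁻ y', ENNReal.ofReal ((c p.2 - c y') ^ 2 * ((p.2 - y') ^ 2)⁻¹) := by
    intro p
    have mm : Measurable fun q : ℝ × ℝ => ENNReal.ofReal ((c p.2 - c q.2) ^ 2 * (dd p q ^ 3)⁻¹) := by
      have : Measurable fun q => dd p q := by unfold dd; fun_prop
      fun_prop
    rw [Measure.volume_eq_prod, lintegral_prod_symm _ mm.aemeasurable, ← lintegral_const_mul' _ _ ENNReal.ofReal_ne_top]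
    refine lintegral_mono fun y' => ?_
    simp only [ENNReal.ofReal_mul (sq_nonneg (c p.2 - c y'))]
    rw [lintegral_const_mul' _ _ ENNReal.ofReal_ne_top]
    rcases eq_or_ne p.2 y' with e | e
    · rw [e]; simp
    · refine (mul_le_mul_right (slice_dd p.1 (sub_ne_zero.2 e)) _).trans (le_of_eq ?_)
      rw [ENNReal.ofReal_mul pi_pos.le]
      ring
  have S2 : ∫⁻ p, ∫⁻ q, F2 p q ≤ ENNReal.ofReal (π * C2 * C3 * ∫ x, f x ^ 2) := by
    set J : ℝ → ENNReal := fun y => ∫⁻ y', ENNReal.ofReal ((c y - c y') ^ 2 * ((y - y') ^ 2)⁻¹) with hJ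
    have mJ : Measurable J := by
      have mm : Measurable (Function.uncurry fun y y' : ℝ => ENNReal.ofReal ((c y - c y') ^ 2 * ((y - y') ^ 2)⁻¹)) := by
        unfold Function.uncurry; fun_prop
      exact mm.lintegral_prod_right'
    calc _ ≤ ∫⁻ p : ℝ × ℝ, ENNReal.ofReal (v p ^ 2) * (ENNReal.ofReal π * J p.2) := by
          refine lintegral_mono fun p => ?_
          simp only [hF2]
          rw [lintegral_const_mul' _ _ ENNReal.ofReal_ne_top]
          exact mul_le_mul_right (inner p) _
      _ = ∫⁻ y, ∫⁻ x, ENNReal.ofReal (v (x, y) ^ 2) * (ENNReal.ofReal π * J y) := by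
          rw [Measure.volume_eq_prod, lintegral_prod_symm _ (by fun_prop)]
      _ ≤ ∫⁻ y, ENNReal.ofReal (C2 * ∫ x, f x ^ 2) * (ENNReal.ofReal π * J y) := by
          refine lintegral_mono fun y => ?_
          have : Measurable fun x => ENNReal.ofReal (v (x, y) ^ 2) := by fun_prop
          simp only
          rw [lintegral_mul_const _ this]
          exact mul_le_mul_left (H2 f hf hf2 y) _
      _ = ENNReal.ofReal (C2 * ∫ x, f x ^ 2) * (ENNReal.ofReal π * ∫⁻ y, J y) := by
          rw [lintegral_const_mul' _ _ ENNReal.ofReal_ne_top, lintegral_const_mul' _ _ ENNReal.ofReal_ne_top]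
      _ ≤ ENNReal.ofReal (C2 * ∫ x, f x ^ 2) * (ENNReal.ofReal π * ENNReal.ofReal C3) := by
          gcongr
      _ = _ := by
          rw [← ENNReal.ofReal_mul pi_pos.le, ← ENNReal.ofReal_mul (by positivity)]
          congr 1; ring
  calc GG (QQ c m n f) ≤ ∫⁻ p, ∫⁻ q, (ENNReal.ofReal (2 * B ^ 2) * F1 p q + 2 * F2 p q) :=
        lintegral_mono fun p => lintegral_mono fun q => pw p q
    _ = ENNReal.ofReal (2 * B ^ 2) * GG v + 2 * ∫⁻ p, ∫⁻ q, F2 p q := by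
        have : ∀ p, ∫⁻ q, (ENNReal.ofReal (2 * B ^ 2) * F1 p q + 2 * F2 p q) =
            ENNReal.ofReal (2 * B ^ 2) * (∫⁻ q, F1 p q) + 2 * ∫⁻ q, F2 p q := by
          intro p
          have m1 : Measurable (F1 p) := mF1.comp (measurable_const.prodMk measurable_id)
          rw [lintegral_add_left (m1.const_mul _), lintegral_const_mul' _ _ ENNReal.ofReal_ne_top,
            lintegral_const_mul' _ _ (by simp)]
        simp only [this]
        have m1 : Measurable fun p => ∫⁻ q, F1 p q := mF1.lintegral_prod_right'
        rw [lintegral_add_left (m1.const_mul _), lintegral_const_mul' _ _ ENNReal.ofReal_ne_top,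
            lintegral_const_mul' _ _ (by simp)]
        rfl
    _ ≤ ENNReal.ofReal (2 * B ^ 2) * ENNReal.ofReal (C1 * ∫ x, f x ^ 2) +
        ENNReal.ofReal 2 * ENNReal.ofReal (π * C2 * C3 * ∫ x, f x ^ 2) := by
        rw [show (2 : ENNReal) = ENNReal.ofReal 2 by simp]
        exact add_le_add (mul_le_mul_right (H1 f hf hf2) _) (mul_le_mul_right S2 _)
    _ = _ := by
        have := pi_pos
        rw [← ENNReal.ofReal_mul (by positivity), ← ENNReal.ofReal_mul (by positivity), ← ENNReal.ofReal_add (by positivity) (by positivity)]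
        congr 1; ring

structure T2 (η : ℝ × ℝ → ℝ) : Prop where
  smooth : ContDiff ℝ (⊤ : ℕ∞) η
  cs : HasCompactSupport η

/-- continuous compactly supported -/
structure CC (η : ℝ × ℝ → ℝ) : Prop where
  cont : Continuous η
  cs : HasCompactSupport η

def pd (η : ℝ × ℝ → ℝ) (d p : ℝ × ℝ) : ℝ := fderiv ℝ η p d

lemma T2.cc {η : ℝ × ℝ → ℝ} (h : T2 η) : CC η := ⟨h.smooth.continuous, h.cs⟩
lemma T2.diff {η : ℝ × ℝ → ℝ} (h : T2 η) : Differentiable ℝ η := h.smooth.differentiable (by simp)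
lemma T2.pd {η : ℝ × ℝ → ℝ} (h : T2 η) (d : ℝ × ℝ) : CC (pd η d) :=
  ⟨(h.smooth.continuous_fderiv (by simp)).clm_apply continuous_const, h.cs.fderiv_apply (𝕜 := ℝ) d⟩

lemma CC.bound {η : ℝ × ℝ → ℝ} (h : CC η) : ∃ B A, 0 ≤ B ∧ 1 ≤ A ∧ ∀ p, |η p| ≤ B * (Icc (-A) A).indicator (fun _ => (1:ℝ)) p.2 := by
  obtain ⟨B, hB⟩ := h.cs.exists_bound_of_continuous h.cont
  obtain ⟨A, hA⟩ := h.cs.isCompact.isBounded.subset_closedBall 0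
  have hB0 := (norm_nonneg _).trans (hB 0)
  refine ⟨B, max A 1, hB0, le_max_right _ _, fun p => ?_⟩
  by_cases hp : p.2 ∈ Icc (-(max A 1)) (max A 1)
  · rw [indicator_of_mem hp, mul_one]; exact hB p
  · have : η p = 0 := by
      by_contra hc
      have h1 := hA (subset_tsupport η hc)
      rw [mem_closedBall_zero_iff] at h1
      apply hp
      apply abs_le.1
      exact (norm_snd_le p).trans (h1.trans (le_max_left _ _))
    rw [this, indicator_of_notMem hp]; simp

def shL (s : ℝ) : ℝ × ℝ →L[ℝ] ℝ × ℝ :=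
  ((ContinuousLinearMap.fst ℝ ℝ ℝ) + s • (ContinuousLinearMap.snd ℝ ℝ ℝ)).prod (ContinuousLinearMap.snd ℝ ℝ ℝ)

lemma shL_apply (s : ℝ) (p : ℝ × ℝ) : shL s p = (p.1 + p.2 * s, p.2) := by
  simp [shL, mul_comm]

def shE (s : ℝ) : (ℝ × ℝ) ≃ₜ (ℝ × ℝ) where
  toFun := fun p => shL s p
  invFun := fun p => shL (-s) p
  left_inv := fun p => by simp [shL_apply]
  right_inv := fun p => by simp [shL_apply]
  continuous_toFun := (shL s).continuous
  continuous_invFun := (shL (-s)).continuous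

lemma shE_mp (s : ℝ) : MeasurePreserving (shE s).toMeasurableEquiv (volume : Measure (ℝ × ℝ)) volume := by
  have h1 : MeasurePreserving (fun p : ℝ × ℝ => (p.1, p.2 + p.1 * s)) (volume.prod volume) (volume.prod volume) := by
    refine MeasurePreserving.skew_product (g := fun (y x : ℝ) => x + y * s) (MeasurePreserving.id volume) (by fun_prop) ?_
    exact Filter.Eventually.of_forall fun y => (measurePreserving_add_right volume (y * s)).map_eq
  have h2 := (Measure.measurePreserving_swap (μ := (volume : Measure ℝ)) (ν := (volume : Measure ℝ)))
  have h3 := (h2.comp h1).comp h2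
  have e : (⇑(shE s).toMeasurableEquiv : ℝ × ℝ → ℝ × ℝ) = (Prod.swap ∘ (fun p : ℝ × ℝ => (p.1, p.2 + p.1 * s))) ∘ Prod.swap := by
    funext p
    show shL s p = _
    rw [shL_apply]; rfl
  rw [e]
  exact h3

lemma sh_integral (s : ℝ) (F : ℝ × ℝ → ℝ) : ∫ p, F p = ∫ p : ℝ × ℝ, F (p.1 + p.2 * s, p.2) := by
  rw [← (shE_mp s).integral_comp' F]
  refine integral_congr_ae (Filter.Eventually.of_forall fun p => ?_)
  show F (shL s p) = _
  rw [shL_apply]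

lemma T2.sh {η : ℝ × ℝ → ℝ} (h : T2 η) (s : ℝ) : T2 (fun p => η (p.1 + p.2 * s, p.2)) := by
  have e : (fun p : ℝ × ℝ => η (p.1 + p.2 * s, p.2)) = η ∘ (shL s) := by
    funext p; simp [shL_apply]
  rw [e]
  refine ⟨h.smooth.comp (shL s).contDiff, ?_⟩
  exact h.cs.comp_homeomorph (shE s)

lemma pd_sh {η : ℝ × ℝ → ℝ} (h : T2 η) (s : ℝ) (d p : ℝ × ℝ) :
    pd (fun p => η (p.1 + p.2 * s, p.2)) d p = pd η (d.1 + d.2 * s, d.2) (p.1 + p.2 * s, p.2) := by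
  have e : (fun p : ℝ × ℝ => η (p.1 + p.2 * s, p.2)) = η ∘ (shL s) := by
    funext p; simp [shL_apply]
  unfold pd
  rw [e, fderiv_comp _ (h.diff _) (shL s).differentiableAt, ContinuousLinearMap.fderiv]
  simp [shL_apply]

lemma pd_lin (η : ℝ × ℝ → ℝ) (a b : ℝ) (p : ℝ × ℝ) : pd η (a, b) p = a * pd η (1, 0) p + b * pd η (0, 1) p := by
  unfold pd
  have : ((a, b) : ℝ × ℝ) = a • ((1, 0) : ℝ × ℝ) + b • ((0, 1) : ℝ × ℝ) := by simp
  rw [this, map_add, map_smul, map_smul]; rfl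

/-- joint integrability -/
lemma INT {f m e : ℝ → ℝ} {η : ℝ × ℝ → ℝ} (hf : Measurable f) (hf2 : MemLp f 2 (volume : Measure ℝ))
    (hm : GK m) (hη : CC η) (he : Measurable e) (he1 : ∀ y, |e y| ≤ 1) :
    Integrable fun w : (ℝ × ℝ) × ℝ => e w.1.2 * f (w.1.1 - w.1.2 * w.2) * m w.2 * η w.1 := by
  obtain ⟨B, A, hB, hA, hb⟩ := hη.bound
  set g : ℝ → ℝ := (Icc (-A) A).indicator (fun _ => (1:ℝ)) with hg
  have mg : Measurable g := measurable_const.indicator measurableSet_Icc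
  have g0 : ∀ y, 0 ≤ g y := fun y => indicator_nonneg (fun _ _ => by norm_num) y
  have ig : Integrable g := by
    rw [hg, integrable_indicator_iff measurableSet_Icc]; simp
  have mm := hm.cont.measurable
  have mη := hη.cont.measurable
  have i1 : Integrable fun w : (ℝ × ℝ) × ℝ => |η w.1| * |m w.2| :=
    ((hη.cont.integrable_of_hasCompactSupport hη.cs).abs).mul_prod hm.int.abs
  have i2 : Integrable fun w : (ℝ × ℝ) × ℝ => (g w.1.2 * f (w.1.1 - w.1.2 * w.2) ^ 2) * (B * |m w.2|) := by
    have m0 : Measurable fun w : (ℝ × ℝ) × ℝ => (g w.1.2 * f (w.1.1 - w.1.2 * w.2) ^ 2) * (B * |m w.2|) := by fun_prop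
    have h0 : ∀ w : (ℝ × ℝ) × ℝ, 0 ≤ (g w.1.2 * f (w.1.1 - w.1.2 * w.2) ^ 2) * (B * |m w.2|) := fun w => by
      have := g0 w.1.2; positivity
    refine ⟨m0.aestronglyMeasurable, ?_⟩
    rw [hasFiniteIntegral_iff_ofReal (Filter.Eventually.of_forall h0), Measure.volume_eq_prod,
      lintegral_prod_symm _ m0.ennreal_ofReal.aemeasurable]
    have hs : ∀ s, ∫⁻ p : ℝ × ℝ, ENNReal.ofReal ((g p.2 * f (p.1 - p.2 * s) ^ 2) * (B * |m s|)) =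
        (∫⁻ y, ENNReal.ofReal (g y)) * (∫⁻ x, ENNReal.ofReal (f x ^ 2)) * ENNReal.ofReal (B * |m s|) := by
      intro s
      have m1 : Measurable fun p : ℝ × ℝ => ENNReal.ofReal ((g p.2 * f (p.1 - p.2 * s) ^ 2) * (B * |m s|)) := by fun_prop
      rw [Measure.volume_eq_prod, lintegral_prod_symm _ m1.aemeasurable]
      have : ∀ y, ∫⁻ x, ENNReal.ofReal ((g y * f (x - y * s) ^ 2) * (B * |m s|)) =
          ENNReal.ofReal (g y) * ((∫⁻ x, ENNReal.ofReal (f x ^ 2)) * ENNReal.ofReal (B * |m s|)) := by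
        intro y
        rw [← lintegral_sub_right_eq_self (fun x => ENNReal.ofReal (f x ^ 2)) (y * s),
          ← lintegral_mul_const' _ _ ENNReal.ofReal_ne_top, ← lintegral_const_mul' _ _ ENNReal.ofReal_ne_top]
        refine lintegral_congr fun x => ?_
        have := g0 y
        rw [ENNReal.ofReal_mul (by positivity), ENNReal.ofReal_mul this, mul_assoc]
      simp only [this]
      rw [lintegral_mul_const _ mg.ennreal_ofReal, mul_assoc]
    simp only [hs]
    have e1 := ofReal_integral_eq_lintegral_ofReal ig (Filter.Eventually.of_forall g0)
    have e2 := ofReal_integral_eq_lintegral_ofReal hf2.integrable_sq (Filter.Eventually.of_forall fun x => sq_nonneg _)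
    have e3 := ofReal_integral_eq_lintegral_ofReal (hm.int.abs.const_mul B) (Filter.Eventually.of_forall fun x => by simp only [Pi.zero_apply]; positivity)
    rw [← e1, ← e2, ← ENNReal.ofReal_mul (integral_nonneg g0), lintegral_const_mul' _ _ ENNReal.ofReal_ne_top, ← e3]
    exact ENNReal.mul_lt_top ENNReal.ofReal_lt_top ENNReal.ofReal_lt_top
  refine (i1.add i2).mono' (by fun_prop) (Filter.Eventually.of_forall fun w => ?_)
  simp only [Pi.add_apply]
  rw [Real.norm_eq_abs, abs_mul, abs_mul, abs_mul]
  have b1 := he1 w.1.2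
  have b2 := hb w.1
  set F := f (w.1.1 - w.1.2 * w.2)
  have b3 : |F| ≤ 1 + F ^ 2 := by rw [← sq_abs F]; nlinarith [sq_nonneg (|F| - 1), abs_nonneg F]
  calc |e w.1.2| * |F| * |m w.2| * |η w.1| ≤ 1 * (1 + F ^ 2) * |m w.2| * |η w.1| := by gcongr
    _ = |η w.1| * |m w.2| + F ^ 2 * |m w.2| * |η w.1| := by ring
    _ ≤ |η w.1| * |m w.2| + F ^ 2 * |m w.2| * (B * g w.1.2) := by gcongr
    _ = _ := by ring

lemma INT1 {f e : ℝ → ℝ} {η : ℝ × ℝ → ℝ} (hf : Measurable f) (hf2 : MemLp f 2 (volume : Measure ℝ))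
    (hη : CC η) (he : Measurable e) (he1 : ∀ y, |e y| ≤ 1) :
    Integrable fun p : ℝ × ℝ => e p.2 * f p.1 * η p := by
  obtain ⟨B, A, hB, hA, hb⟩ := hη.bound
  set g : ℝ → ℝ := (Icc (-A) A).indicator (fun _ => (1:ℝ)) with hg
  have ig : Integrable g := by
    rw [hg, integrable_indicator_iff measurableSet_Icc]; simp
  have mη := hη.cont.measurable
  have i1 : Integrable fun p : ℝ × ℝ => |η p| := (hη.cont.integrable_of_hasCompactSupport hη.cs).abs
  have i2 : Integrable fun p : ℝ × ℝ => f p.1 ^ 2 * (B * g p.2) := hf2.integrable_sq.mul_prod (ig.const_mul B)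
  refine (i1.add i2).mono' (by fun_prop) (Filter.Eventually.of_forall fun w => ?_)
  simp only [Pi.add_apply]
  rw [Real.norm_eq_abs, abs_mul, abs_mul]
  have b1 := he1 w.2
  have b2 := hb w
  set F := f w.1
  have b3 : |F| ≤ 1 + F ^ 2 := by rw [← sq_abs F]; nlinarith [sq_nonneg (|F| - 1), abs_nonneg F]
  calc |e w.2| * |F| * |η w| ≤ 1 * (1 + F ^ 2) * |η w| := by gcongr
    _ = |η w| + F ^ 2 * |η w| := by ring
    _ ≤ |η w| + F ^ 2 * (B * g w.2) := by gcongr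

/-- slices of test functions -/
lemma T2.sliceX {η : ℝ × ℝ → ℝ} (h : T2 η) (y : ℝ) : GK (fun t => η (t, y)) ∧
    ∀ t, deriv (fun t => η (t, y)) t = _root_.pd η (1, 0) (t, y) := by
  refine ⟨⟨h.smooth.comp (by fun_prop), ?_⟩, fun t => ?_⟩
  · have : Topology.IsClosedEmbedding (fun t : ℝ => (t, y)) := Function.LeftInverse.isClosedEmbedding (f := Prod.fst) (fun _ => rfl) continuous_fst (by fun_prop)
    exact h.cs.comp_isClosedEmbedding this
  · have h1 : HasDerivAt (fun t : ℝ => (t, y)) ((1, 0) : ℝ × ℝ) t := (hasDerivAt_id t).prodMk (hasDerivAt_const t y)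
    exact ((h.diff (t, y)).hasFDerivAt.comp_hasDerivAt t h1).deriv

lemma T2.sliceY {η : ℝ × ℝ → ℝ} (h : T2 η) (t : ℝ) : GK (fun y => η (t, y)) ∧
    ∀ y, deriv (fun y => η (t, y)) y = _root_.pd η (0, 1) (t, y) := by
  refine ⟨⟨h.smooth.comp (by fun_prop), ?_⟩, fun y => ?_⟩
  · have : Topology.IsClosedEmbedding (fun y : ℝ => (t, y)) := Function.LeftInverse.isClosedEmbedding (f := Prod.snd) (fun _ => rfl) continuous_snd (by fun_prop)
    exact h.cs.comp_isClosedEmbedding this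
  · have h1 : HasDerivAt (fun y : ℝ => (t, y)) ((0, 1) : ℝ × ℝ) y := (hasDerivAt_const y t).prodMk (hasDerivAt_id y)
    exact ((h.diff (t, y)).hasFDerivAt.comp_hasDerivAt y h1).deriv

def WD1 (f f₁ : ℝ → ℝ) : Prop := ∀ g, GK g → ∫ t, f t * deriv g t = - ∫ t, f₁ t * g t

/-- half-line cutoffs with their boundary sign -/
def HL (e : ℝ → ℝ) (σ : ℝ) : Prop := Measurable e ∧ (∀ y, |e y| ≤ 1) ∧
  ∀ g, GK g → ∫ y, e y * deriv g y = σ * g 0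

lemma HL_up : HL (fun y => if 0 ≤ y then 1 else 0) (-1) := by
  refine ⟨Measurable.ite measurableSet_Ici measurable_const measurable_const, fun y => ?_, fun g hg => ?_⟩
  · simp only; split_ifs <;> simp
  · have : ∫ y, (if 0 ≤ y then (1:ℝ) else 0) * deriv g y = ∫ y in Ici 0, deriv g y := by
      rw [← integral_indicator measurableSet_Ici]
      congr 1; funext y
      by_cases h : 0 ≤ y <;> simp [h, indicator]
    rw [this, integral_Ici_eq_integral_Ioi, hg.cs.integral_Ioi_deriv_eq (hg.smooth.of_le (by simp))]
    ring

lemma HL_dn : HL (fun y => if 0 ≤ y then 0 else 1) 1 := by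
  refine ⟨Measurable.ite measurableSet_Ici measurable_const measurable_const, fun y => ?_, fun g hg => ?_⟩
  · simp only; split_ifs <;> simp
  · have : ∫ y, (if 0 ≤ y then (0:ℝ) else 1) * deriv g y = ∫ y in Iio 0, deriv g y := by
      rw [← integral_indicator measurableSet_Iio]
      congr 1; funext y
      by_cases h : 0 ≤ y <;> simp [h, indicator]
    rw [this, ← integral_Iic_eq_integral_Iio, hg.cs.integral_Iic_deriv_eq (hg.smooth.of_le (by simp))]
    ring

lemma HBy {f e : ℝ → ℝ} {σ : ℝ} {ζ : ℝ × ℝ → ℝ} (hf : Measurable f) (hf2 : MemLp f 2 (volume : Measure ℝ))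
    (he : HL e σ) (h : T2 ζ) : ∫ p : ℝ × ℝ, e p.2 * f p.1 * pd ζ (0, 1) p = σ * ∫ t, f t * ζ (t, 0) := by
  rw [Measure.volume_eq_prod, integral_prod _ (INT1 hf hf2 (h.pd _) he.1 he.2.1), ← integral_const_mul]
  refine integral_congr_ae (Filter.Eventually.of_forall fun t => ?_)
  simp only
  have := he.2.2 _ (h.sliceY t).1
  simp only [(h.sliceY t).2] at this
  rw [show σ * (f t * ζ (t, 0)) = f t * (σ * ζ (t, 0)) by ring, ← this, ← integral_const_mul]
  congr 1; funext y; ring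

lemma HBx {f f₁ e : ℝ → ℝ} {ζ : ℝ × ℝ → ℝ} (hf : Measurable f) (hf2 : MemLp f 2 (volume : Measure ℝ))
    (hf₁ : Measurable f₁) (hf₁2 : MemLp f₁ 2 (volume : Measure ℝ)) (hw : WD1 f f₁)
    (he : Measurable e) (he1 : ∀ y, |e y| ≤ 1) (h : T2 ζ) :
    ∫ p : ℝ × ℝ, e p.2 * f p.1 * pd ζ (1, 0) p = - ∫ p : ℝ × ℝ, e p.2 * f₁ p.1 * ζ p := by
  rw [Measure.volume_eq_prod, integral_prod_symm _ (INT1 hf hf2 (h.pd _) he he1),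
    integral_prod_symm _ (INT1 hf₁ hf₁2 h.cc he he1), ← integral_neg]
  refine integral_congr_ae (Filter.Eventually.of_forall fun y => ?_)
  simp only
  have := hw _ (h.sliceX y).1
  simp only [(h.sliceX y).2] at this
  simp only [mul_assoc]
  rw [integral_const_mul, integral_const_mul, this, mul_neg]

lemma PSx {f f₁ e : ℝ → ℝ} {η : ℝ × ℝ → ℝ} (hf : Measurable f) (hf2 : MemLp f 2 (volume : Measure ℝ))
    (hf₁ : Measurable f₁) (hf₁2 : MemLp f₁ 2 (volume : Measure ℝ)) (hw : WD1 f f₁)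
    (he : Measurable e) (he1 : ∀ y, |e y| ≤ 1) (h : T2 η) (s : ℝ) :
    ∫ p : ℝ × ℝ, e p.2 * f (p.1 - p.2 * s) * pd η (1, 0) p = - ∫ p : ℝ × ℝ, e p.2 * f₁ (p.1 - p.2 * s) * η p := by
  rw [sh_integral s, sh_integral s (fun p : ℝ × ℝ => e p.2 * f₁ (p.1 - p.2 * s) * η p)]
  have := HBx hf hf2 hf₁ hf₁2 hw he he1 (h.sh s)
  simp only [pd_sh h] at this
  simpa using this

lemma PSy {f f₁ e : ℝ → ℝ} {η : ℝ × ℝ → ℝ} {σ : ℝ} (hf : Measurable f) (hf2 : MemLp f 2 (volume : Measure ℝ))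
    (hf₁ : Measurable f₁) (hf₁2 : MemLp f₁ 2 (volume : Measure ℝ)) (hw : WD1 f f₁)
    (he : HL e σ) (h : T2 η) (s : ℝ) :
    ∫ p : ℝ × ℝ, e p.2 * f (p.1 - p.2 * s) * pd η (0, 1) p =
      σ * (∫ t, f t * η (t, 0)) + s * ∫ p : ℝ × ℝ, e p.2 * f₁ (p.1 - p.2 * s) * η p := by
  rw [sh_integral s, sh_integral s (fun p : ℝ × ℝ => e p.2 * f₁ (p.1 - p.2 * s) * η p)]
  have h1 := HBx hf hf2 hf₁ hf₁2 hw he.1 he.2.1 (h.sh s)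
  have h2 := HBy hf hf2 he (h.sh s)
  have i1 := INT1 hf hf2 ((h.sh s).pd (1, 0)) he.1 he.2.1
  have i2 := INT1 hf hf2 ((h.sh s).pd (0, 1)) he.1 he.2.1
  have h3 : ∫ p : ℝ × ℝ, e p.2 * f p.1 * pd η (0, 1) (p.1 + p.2 * s, p.2) =
      (∫ p : ℝ × ℝ, e p.2 * f p.1 * pd (fun p => η (p.1 + p.2 * s, p.2)) (0, 1) p) -
      s * ∫ p : ℝ × ℝ, e p.2 * f p.1 * pd (fun p => η (p.1 + p.2 * s, p.2)) (1, 0) p := by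
    rw [← integral_const_mul, ← integral_sub i2 (i1.const_mul s)]
    congr 1; funext p
    rw [pd_sh h, pd_sh h]
    simp only [zero_add, one_mul, zero_mul, add_zero]
    rw [pd_lin η s 1]; ring
  simp only [add_sub_cancel_right]
  rw [h3, h1, h2]
  simp

def smul1 (m : ℝ → ℝ) (s : ℝ) : ℝ := s * m s

lemma GK.smul1 {m : ℝ → ℝ} (h : GK m) : GK (smul1 m) :=
  ⟨contDiff_id.mul h.smooth, h.cs.mul_left⟩

lemma FTT {f m e : ℝ → ℝ} {η : ℝ × ℝ → ℝ} (hf : Measurable f) (hf2 : MemLp f 2 (volume : Measure ℝ))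
    (hm : GK m) (hη : CC η) (he : Measurable e) (he1 : ∀ y, |e y| ≤ 1) :
    Integrable (fun p : ℝ × ℝ => e p.2 * TT m f p.1 p.2 * η p) ∧
    Integrable (fun s => m s * ∫ p : ℝ × ℝ, e p.2 * f (p.1 - p.2 * s) * η p) ∧
    ∫ p : ℝ × ℝ, e p.2 * TT m f p.1 p.2 * η p = ∫ s, m s * ∫ p : ℝ × ℝ, e p.2 * f (p.1 - p.2 * s) * η p := by
  have h := INT hf hf2 hm hη he he1
  have e1 : ∀ p : ℝ × ℝ, e p.2 * TT m f p.1 p.2 * η p = ∫ s, e p.2 * f (p.1 - p.2 * s) * m s * η p := by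
    intro p
    unfold TT
    rw [← integral_const_mul, ← integral_mul_const]
    congr 1; funext s; ring
  have e2 : ∀ s, m s * (∫ p : ℝ × ℝ, e p.2 * f (p.1 - p.2 * s) * η p) = ∫ p : ℝ × ℝ, e p.2 * f (p.1 - p.2 * s) * m s * η p := by
    intro s
    rw [← integral_const_mul]
    congr 1; funext s; ring
  simp only [e1, e2]
  exact ⟨h.integral_prod_left, h.integral_prod_right, integral_integral_swap h⟩

lemma VV_split {m n f : ℝ → ℝ} (p : ℝ × ℝ) : VV m n f p =
    (fun y : ℝ => if 0 ≤ y then (1:ℝ) else 0) p.2 * TT m f p.1 p.2 +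
    (fun y : ℝ => if 0 ≤ y then (0:ℝ) else 1) p.2 * TT n f p.1 p.2 := by
  unfold VV; split_ifs with h <;> simp [h]

lemma VV_int {f m n : ℝ → ℝ} {η : ℝ × ℝ → ℝ} (hf : Measurable f) (hf2 : MemLp f 2 (volume : Measure ℝ))
    (hm : GK m) (hn : GK n) (hη : CC η) : Integrable (fun p => VV m n f p * η p) := by
  simp only [VV_split, add_mul]
  exact (FTT hf hf2 hm hη HL_up.1 HL_up.2.1).1.add (FTT hf hf2 hn hη HL_dn.1 HL_dn.2.1).1

lemma VV_split_int {f m n : ℝ → ℝ} {η : ℝ × ℝ → ℝ} (hf : Measurable f) (hf2 : MemLp f 2 (volume : Measure ℝ))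
    (hm : GK m) (hn : GK n) (hη : CC η) : ∫ p, VV m n f p * η p =
    (∫ p : ℝ × ℝ, (fun y : ℝ => if 0 ≤ y then (1:ℝ) else 0) p.2 * TT m f p.1 p.2 * η p) +
    ∫ p : ℝ × ℝ, (fun y : ℝ => if 0 ≤ y then (0:ℝ) else 1) p.2 * TT n f p.1 p.2 * η p := by
  simp only [VV_split, add_mul]
  exact integral_add (FTT hf hf2 hm hη HL_up.1 HL_up.2.1).1 (FTT hf hf2 hn hη HL_dn.1 HL_dn.2.1).1

lemma HTx {f f₁ m e : ℝ → ℝ} {η : ℝ × ℝ → ℝ} (hf : Measurable f) (hf2 : MemLp f 2 (volume : Measure ℝ))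
    (hf₁ : Measurable f₁) (hf₁2 : MemLp f₁ 2 (volume : Measure ℝ)) (hw : WD1 f f₁)
    (hm : GK m) (he : Measurable e) (he1 : ∀ y, |e y| ≤ 1) (h : T2 η) :
    ∫ p : ℝ × ℝ, e p.2 * TT m f p.1 p.2 * pd η (1, 0) p = - ∫ p : ℝ × ℝ, e p.2 * TT m f₁ p.1 p.2 * η p := by
  rw [(FTT hf hf2 hm (h.pd _) he he1).2.2, (FTT hf₁ hf₁2 hm h.cc he he1).2.2, ← integral_neg]
  congr 1; funext s
  rw [PSx hf hf2 hf₁ hf₁2 hw he he1 h, mul_neg]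

lemma HTy {f f₁ m e : ℝ → ℝ} {η : ℝ × ℝ → ℝ} {σ : ℝ} (hf : Measurable f) (hf2 : MemLp f 2 (volume : Measure ℝ))
    (hf₁ : Measurable f₁) (hf₁2 : MemLp f₁ 2 (volume : Measure ℝ)) (hw : WD1 f f₁)
    (hm : GK m) (he : HL e σ) (h : T2 η) :
    ∫ p : ℝ × ℝ, e p.2 * TT m f p.1 p.2 * pd η (0, 1) p =
      σ * (∫ s, m s) * (∫ t, f t * η (t, 0)) + ∫ p : ℝ × ℝ, e p.2 * TT (smul1 m) f₁ p.1 p.2 * η p := by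
  have k := FTT hf₁ hf₁2 hm.smul1 h.cc he.1 he.2.1
  rw [(FTT hf hf2 hm (h.pd _) he.1 he.2.1).2.2, k.2.2]
  have : σ * (∫ s, m s) * (∫ t, f t * η (t, 0)) = ∫ s, m s * (σ * (∫ t, f t * η (t, 0))) := by
    rw [integral_mul_const]; ring
  rw [this, ← integral_add (hm.int.mul_const _) k.2.1]
  congr 1; funext s
  rw [PSy hf hf2 hf₁ hf₁2 hw he h]
  unfold smul1; ring

lemma VVx {f f₁ m n : ℝ → ℝ} {η : ℝ × ℝ → ℝ} (hf : Measurable f) (hf2 : MemLp f 2 (volume : Measure ℝ))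
    (hf₁ : Measurable f₁) (hf₁2 : MemLp f₁ 2 (volume : Measure ℝ)) (hw : WD1 f f₁)
    (hm : GK m) (hn : GK n) (h : T2 η) :
    ∫ p, VV m n f p * pd η (1, 0) p = - ∫ p, VV m n f₁ p * η p := by
  rw [VV_split_int hf hf2 hm hn (h.pd _), VV_split_int hf₁ hf₁2 hm hn h.cc,
    HTx hf hf2 hf₁ hf₁2 hw hm HL_up.1 HL_up.2.1 h, HTx hf hf2 hf₁ hf₁2 hw hn HL_dn.1 HL_dn.2.1 h]
  ring

lemma VVy {f f₁ m n : ℝ → ℝ} {η : ℝ × ℝ → ℝ} (hf : Measurable f) (hf2 : MemLp f 2 (volume : Measure ℝ))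
    (hf₁ : Measurable f₁) (hf₁2 : MemLp f₁ 2 (volume : Measure ℝ)) (hw : WD1 f f₁)
    (hm : GK m) (hn : GK n) (hmn : ∫ s, m s = ∫ s, n s) (h : T2 η) :
    ∫ p, VV m n f p * pd η (0, 1) p = ∫ p, VV (smul1 m) (smul1 n) f₁ p * η p := by
  rw [VV_split_int hf hf2 hm hn (h.pd _), VV_split_int hf₁ hf₁2 hm.smul1 hn.smul1 h.cc,
    HTy hf hf2 hf₁ hf₁2 hw hm HL_up h, HTy hf hf2 hf₁ hf₁2 hw hn HL_dn h, hmn]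
  ring

/-- weak derivative in the plane -/
def WD2 (d : ℝ × ℝ) (u v : ℝ × ℝ → ℝ) : Prop :=
  ∀ η, T2 η → Integrable (fun p => u p * pd η d p) ∧ Integrable (fun p => v p * η p) ∧
    ∫ p, u p * pd η d p = - ∫ p, v p * η p

lemma mulc {c : ℝ → ℝ} {η : ℝ × ℝ → ℝ} (hc : ContDiff ℝ (⊤ : ℕ∞) c) (h : T2 η) : T2 (fun p => c p.2 * η p) ∧
    (∀ p, pd (fun p => c p.2 * η p) (1, 0) p = c p.2 * pd η (1, 0) p) ∧
    (∀ p, pd (fun p => c p.2 * η p) (0, 1) p = c p.2 * pd η (0, 1) p + deriv c p.2 * η p) := by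
  have hd : ∀ p : ℝ × ℝ, HasFDerivAt (fun p => c p.2 * η p)
      (c p.2 • fderiv ℝ η p + η p • (deriv c p.2 • (ContinuousLinearMap.snd ℝ ℝ ℝ))) p := by
    intro p
    have h1 : HasFDerivAt (fun p : ℝ × ℝ => c p.2) (deriv c p.2 • (ContinuousLinearMap.snd ℝ ℝ ℝ)) p :=
      ((hc.differentiable (by simp)) p.2).hasDerivAt.comp_hasFDerivAt p hasFDerivAt_snd
    exact h1.mul (h.diff p).hasFDerivAt
  refine ⟨⟨(hc.comp contDiff_snd).mul h.smooth, h.cs.mul_left⟩, fun p => ?_, fun p => ?_⟩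
  · unfold pd; rw [(hd p).fderiv]; simp
  · unfold pd; rw [(hd p).fderiv]; simp; ring

lemma QQx {f f₁ c m n : ℝ → ℝ} (hf : Measurable f) (hf2 : MemLp f 2 (volume : Measure ℝ))
    (hf₁ : Measurable f₁) (hf₁2 : MemLp f₁ 2 (volume : Measure ℝ)) (hw : WD1 f f₁)
    (hc : GK c) (hm : GK m) (hn : GK n) : WD2 (1, 0) (QQ c m n f) (QQ c m n f₁) := by
  intro η h
  obtain ⟨k1, k2, k3⟩ := mulc hc.smooth h
  have e1 : (fun p => QQ c m n f p * pd η (1, 0) p) = fun p => VV m n f p * pd (fun p => c p.2 * η p) (1, 0) p := by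
    funext p; rw [k2]; unfold QQ; ring
  have e2 : (fun p => QQ c m n f₁ p * η p) = fun p => VV m n f₁ p * (c p.2 * η p) := by
    funext p; unfold QQ; ring
  rw [e1, e2]
  exact ⟨VV_int hf hf2 hm hn (k1.pd _), VV_int hf₁ hf₁2 hm hn k1.cc, VVx hf hf2 hf₁ hf₁2 hw hm hn k1⟩

lemma GK.deriv {m : ℝ → ℝ} (h : GK m) : GK (deriv m) :=
  ⟨(contDiff_infty_iff_deriv.1 h.smooth).2, h.cs.deriv⟩

lemma QQy {f f₁ c m n : ℝ → ℝ} (hf : Measurable f) (hf2 : MemLp f 2 (volume : Measure ℝ))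
    (hf₁ : Measurable f₁) (hf₁2 : MemLp f₁ 2 (volume : Measure ℝ)) (hw : WD1 f f₁)
    (hc : GK c) (hm : GK m) (hn : GK n) (hmn : ∫ s, m s = ∫ s, n s) :
    WD2 (0, 1) (QQ c m n f) (fun p => QQ (deriv c) m n f p - QQ c (smul1 m) (smul1 n) f₁ p) := by
  intro η h
  obtain ⟨k1, k2, k3⟩ := mulc hc.smooth h
  obtain ⟨j1, j2, j3⟩ := mulc hc.deriv.smooth h
  have e1 : (fun p => QQ c m n f p * pd η (0, 1) p) = fun p => VV m n f p * pd (fun p => c p.2 * η p) (0, 1) p -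
      VV m n f p * (deriv c p.2 * η p) := by
    funext p; rw [k3]; unfold QQ; ring
  have e2 : (fun p => (QQ (deriv c) m n f p - QQ c (smul1 m) (smul1 n) f₁ p) * η p) = fun p => VV m n f p * (deriv c p.2 * η p) -
      VV (smul1 m) (smul1 n) f₁ p * (c p.2 * η p) := by
    funext p; unfold QQ; ring
  rw [e1, e2]
  have i1 := VV_int hf hf2 hm hn (k1.pd (0, 1))
  have i2 := VV_int hf hf2 hm hn j1.cc
  have i3 := VV_int hf₁ hf₁2 hm.smul1 hn.smul1 k1.cc
  refine ⟨i1.sub i2, i2.sub i3, ?_⟩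
  rw [integral_sub i1 i2, integral_sub i2 i3, VVy hf hf2 hf₁ hf₁2 hw hm hn hmn k1]
  ring

lemma GK.int_deriv {j : ℝ → ℝ} (hj : GK j) : ∫ s, _root_.deriv j s = 0 := by
  have h1 := hj.cs.integral_Iic_deriv_eq (hj.smooth.of_le (by simp)) 0
  have h2 := hj.cs.integral_Ioi_deriv_eq (hj.smooth.of_le (by simp)) 0
  have := intervalIntegral.integral_Iic_add_Ioi (b := (0:ℝ)) (μ := volume) hj.deriv.int.integrableOn hj.deriv.int.integrableOn
  rw [h1, h2] at this
  linarith

lemma TTW {f f₁ j : ℝ → ℝ} (hw : WD1 f f₁) (hj : GK j) (x y : ℝ) :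
    TT (deriv j) f x y = y * TT j f₁ x y := by
  unfold TT
  by_cases hy : y = 0
  · subst hy
    simp only [zero_mul, sub_zero]
    rw [integral_const_mul, hj.int_deriv, mul_zero]
  have key : ∀ G : ℝ → ℝ, ∫ s, G (x - y * s) = |y|⁻¹ * ∫ t, G t := by
    intro G
    have h1 := Measure.integral_comp_mul_left (fun s => G (x - s)) y
    rw [h1, integral_sub_left_eq_self G volume x, abs_inv, smul_eq_mul]
  have hθ : GK (fun t => j ((x - t) / y)) := by
    refine ⟨hj.smooth.comp (by fun_prop), ?_⟩
    have := hj.cs.comp_homeomorph ((Homeomorph.subLeft x).trans (Homeomorph.mulRight₀ y⁻¹ (inv_ne_zero hy)))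
    exact this
  have hd : ∀ t, deriv (fun t => j ((x - t) / y)) t = - y⁻¹ * deriv j ((x - t) / y) := by
    intro t
    have h1 : HasDerivAt (fun t => (x - t) / y) (-1 / y) t := ((hasDerivAt_id t).const_sub x).div_const y
    have h2 := ((hj.smooth.differentiable (by simp)) ((x - t) / y)).hasDerivAt.comp t h1
    rw [show (fun t => j ((x - t) / y)) = j ∘ (fun t => (x - t) / y) from rfl, h2.deriv]
    field_simp
  have h1 := hw _ hθ
  simp only [hd] at h1
  have e1 := key (fun t => f t * deriv j ((x - t) / y))
  have e2 := key (fun t => f₁ t * j ((x - t) / y))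
  have e3 : ∀ s, (x - (x - y * s)) / y = s := fun s => by field_simp; ring
  simp only [e3] at e1 e2
  rw [e1, e2]
  have e4 : ∫ t, f t * (-y⁻¹ * deriv j ((x - t) / y)) = -y⁻¹ * ∫ t, f t * deriv j ((x - t) / y) := by
    rw [← integral_const_mul]; congr 1; funext t; ring
  rw [e4] at h1
  have : ∫ t, f t * deriv j ((x - t) / y) = y * ∫ t, f₁ t * j ((x - t) / y) := by
    have h2 : y * (-y⁻¹ * ∫ t, f t * deriv j ((x - t) / y)) = y * - ∫ t, f₁ t * j ((x - t) / y) := by rw [h1]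
    rw [← mul_assoc, mul_neg, mul_inv_cancel₀ hy] at h2
    linarith
  rw [this]; ring

lemma L2loc {f : ℝ → ℝ} (hf2 : MemLp f 2 (volume : Measure ℝ)) : LocallyIntegrable f volume :=
  hf2.locallyIntegrable (by norm_num)

lemma GK.supp {g : ℝ → ℝ} (hg : GK g) : ∃ A, 0 < A ∧ (∀ x, x ∉ Ioc (-A) A → g x = 0) ∧ g A = 0 ∧ g (-A) = 0 := by
  obtain ⟨A, hA⟩ := hg.cs.isCompact.isBounded.subset_closedBall 0
  have hz : ∀ x, A < |x| → g x = 0 := by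
    intro x hx
    by_contra hc
    have := hA (subset_tsupport g hc)
    rw [mem_closedBall_zero_iff, Real.norm_eq_abs] at this
    linarith
  have hp : 0 < |A| + 1 := by positivity
  refine ⟨|A| + 1, hp, fun x hx => hz x ?_, hz _ ?_, hz _ ?_⟩
  · by_contra hc
    push Not at hc
    have := abs_le.1 hc
    exact hx ⟨by linarith [le_abs_self A], by linarith [le_abs_self A]⟩
  · rw [abs_of_pos hp]; linarith [le_abs_self A]
  · rw [abs_neg, abs_of_pos hp]; linarith [le_abs_self A]

lemma LI {f : ℝ → ℝ} (hf : LocallyIntegrable f volume) (a b : ℝ) : IntervalIntegrable f volume a b :=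
  intervalIntegrable_iff.mpr <|
      (hf.integrableOn_isCompact isCompact_uIcc).mono_set uIoc_subset_uIcc

lemma prim_WD1 {f₁ : ℝ → ℝ} (h1 : LocallyIntegrable f₁ volume) : WD1 (fun x => ∫ t in (0:ℝ)..x, f₁ t) f₁ := by
  intro g hg
  obtain ⟨A, hA, h0, hA1, hA2⟩ := hg.supp
  obtain ⟨A', hA', h0', _, _⟩ := hg.deriv.supp
  have ii : ∀ a b, IntervalIntegrable f₁ volume a b := fun a b => LI h1 a b
  have ac : AbsolutelyContinuousOnInterval (fun x => ∫ t in (0:ℝ)..x, f₁ t) (-A) A :=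
    (ii (-A) A).absolutelyContinuousOnInterval_intervalIntegral (by rw [uIcc_of_le (by linarith)]; constructor <;> linarith)
  have acg : AbsolutelyContinuousOnInterval g (-A) A :=
    ((hg.smooth.of_le (by simp)).contDiffOn).absolutelyContinuousOnInterval
  have k := ac.integral_mul_deriv_eq_deriv_mul acg
  rw [hA1, hA2, mul_zero, mul_zero, sub_zero, zero_sub] at k
  have d0 : ∀ x, x ∉ Icc (-A) A → deriv g x = 0 := by
    intro x hx
    have : g =ᶠ[nhds x] fun _ => 0 := by
      filter_upwards [isClosed_Icc.isOpen_compl.mem_nhds hx] with z hz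
      exact h0 z fun h => hz (Ioc_subset_Icc_self h)
    rw [this.deriv_eq]; simp
  have e1 : ∫ t, (∫ t in (0:ℝ)..t, f₁ t) * deriv g t = ∫ t in (-A)..A, (∫ t in (0:ℝ)..t, f₁ t) * deriv g t := by
    rw [intervalIntegral.integral_of_le (by linarith), ← integral_Icc_eq_integral_Ioc, setIntegral_eq_integral_of_forall_compl_eq_zero]
    intro x hx; rw [d0 x hx, mul_zero]
  have e2 : ∫ t, f₁ t * g t = ∫ t in (-A)..A, deriv (fun x => ∫ t in (0:ℝ)..x, f₁ t) t * g t := by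
    rw [← setIntegral_eq_integral_of_forall_compl_eq_zero (s := Ioc (-A) A) (fun x hx => by rw [h0 x hx, mul_zero]),
      intervalIntegral.integral_of_le (by linarith)]
    refine integral_congr_ae (ae_restrict_of_ae ?_)
    filter_upwards [LocallyIntegrable.ae_hasDerivAt_integral h1] with x hx
    rw [(hx 0).deriv]
  rw [e1, k, e2]

lemma bump_ex : ∃ b : ℝ → ℝ, GK b ∧ ∫ s, b s = 1 ∧ ∀ s, s ≤ 0 → b s = 0 := by
  let B : ContDiffBump (1:ℝ) := ⟨1/4, 1/2, by norm_num, by norm_num⟩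
  refine ⟨B.normed volume, ⟨B.contDiff_normed, B.hasCompactSupport_normed⟩, B.integral_normed, fun s hs => ?_⟩
  by_contra h
  have := B.support_normed_eq (μ := (volume : Measure ℝ))
  have h2 : s ∈ Function.support (B.normed (volume : Measure ℝ)) := h
  rw [this, Metric.mem_ball, Real.dist_eq] at h2
  have := abs_lt.1 h2
  have h3 : B.rOut = 1/2 := rfl
  rw [h3] at this
  linarith [this.1]

lemma prim_GK {g : ℝ → ℝ} (hg : GK g) (h0 : ∫ s, g s = 0) : ∃ G, GK G ∧ deriv G = g := by
  obtain ⟨A, hA, hz, _, _⟩ := hg.supp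
  have hd : ∀ x, HasDerivAt (fun x => ∫ t in (-A)..x, g t) (g x) x := fun x =>
    intervalIntegral.integral_hasDerivAt_right (hg.cont.intervalIntegrable _ _) (hg.cont.stronglyMeasurableAtFilter _ _) hg.cont.continuousAt
  have e : deriv (fun x => ∫ t in (-A)..x, g t) = g := funext fun x => (hd x).deriv
  refine ⟨_, ⟨?_, ?_⟩, e⟩
  · rw [contDiff_infty_iff_deriv]
    exact ⟨fun x => (hd x).differentiableAt, by rw [e]; exact hg.smooth⟩
  · refine HasCompactSupport.intro (K := Icc (-A) A) isCompact_Icc fun x hx => ?_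
    by_cases h : x < -A
    · rw [intervalIntegral.integral_of_ge h.le, neg_eq_zero]
      refine setIntegral_eq_zero_of_forall_eq_zero fun t ht => hz t fun h' => ?_
      linarith [ht.2, h'.1]
    · have hxA : A < x := by
        by_contra h'
        exact hx ⟨by linarith, by linarith⟩
      rw [intervalIntegral.integral_of_le (by linarith), setIntegral_eq_integral_of_forall_compl_eq_zero, h0]
      intro t ht
      refine hz t fun h' => ht ⟨h'.1, by linarith [h'.2]⟩

lemma dBR0 {f : ℝ → ℝ} (hf : LocallyIntegrable f volume) (h : ∀ g, GK g → ∫ t, f t * deriv g t = 0) :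
    ∃ c, ∀ᵐ t, f t = c := by
  obtain ⟨b, hb, hb1, _⟩ := bump_ex
  have ib : ∀ g, GK g → Integrable fun t => f t * g t := fun g hg => by
    have := hf.integrable_smul_left_of_hasCompactSupport hg.cont hg.cs
    simpa [mul_comm] using this
  refine ⟨∫ t, f t * b t, ?_⟩
  have : ∀ᵐ t, f t - ∫ t, f t * b t = 0 := by
    refine ae_eq_zero_of_integral_contDiff_smul_eq_zero (hf.sub (locallyIntegrable_const _)) fun g hg hgc => ?_
    have gg : GK g := ⟨hg, hgc⟩
    have g2 : GK (fun t => g t - (∫ s, g s) * b t) :=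
      ⟨hg.sub (contDiff_const.mul hb.smooth), hgc.sub hb.cs.mul_left⟩
    obtain ⟨G, hG, hG2⟩ := prim_GK g2 (by rw [integral_sub gg.int (hb.int.const_mul _), integral_const_mul, hb1]; ring)
    have h1 := h G hG
    rw [hG2] at h1
    have h2 : ∫ t, f t * (g t - (∫ s, g s) * b t) = (∫ t, f t * g t) - (∫ s, g s) * ∫ t, f t * b t := by
      rw [← integral_const_mul, ← integral_sub (ib g gg) ((ib b hb).const_mul _)]
      congr 1; funext t; ring
    rw [h2] at h1
    simp only [smul_eq_mul, mul_sub]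
    rw [integral_sub (by simpa [mul_comm] using ib g gg) (gg.int.mul_const _), integral_mul_const]
    simp only [mul_comm (g _)]
    exact h1
  filter_upwards [this] with t ht
  linarith

lemma dBR {f f₁ : ℝ → ℝ} (hf : LocallyIntegrable f volume) (hf₁ : LocallyIntegrable f₁ volume) (hw : WD1 f f₁) :
    ∃ c, ∀ᵐ t, f t = c + ∫ s in (0:ℝ)..t, f₁ s := by
  have hp := prim_WD1 hf₁
  have hc : Continuous fun x => ∫ t in (0:ℝ)..x, f₁ t := intervalIntegral.continuous_primitive (fun a b => LI hf₁ a b) 0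
  have ib : ∀ (f : ℝ → ℝ), LocallyIntegrable f volume → ∀ g, GK g → Integrable fun t => f t * g t := fun f hf g hg => by
    have := hf.integrable_smul_left_of_hasCompactSupport hg.cont hg.cs
    simpa [mul_comm] using this
  obtain ⟨c, h⟩ := dBR0 (hf.sub hc.locallyIntegrable) fun g hg => by
    have h1 := hw g hg
    have h2 := hp g hg
    simp only [Pi.sub_apply, sub_mul]
    rw [integral_sub (ib _ hf _ hg.deriv) (ib _ hc.locallyIntegrable _ hg.deriv), h1, h2, sub_self]
  refine ⟨c, ?_⟩
  filter_upwards [h] with t ht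
  simp only [Pi.sub_apply] at ht
  linarith

def rep (f : ℝ → ℝ) : ℝ → ℝ := by
  classical
  exact if h : ∃ g, Continuous g ∧ f =ᵐ[volume] g then h.choose else f

lemma rep_spec {f : ℝ → ℝ} (h : ∃ g, Continuous g ∧ f =ᵐ[volume] g) : Continuous (rep f) ∧ f =ᵐ[volume] rep f := by
  unfold rep; rw [dif_pos h]; exact h.choose_spec

lemma cont_unique {f g : ℝ → ℝ} (hf : Continuous f) (hg : Continuous g) (h : f =ᵐ[volume] g) : f = g :=
  MeasureTheory.Measure.eq_of_ae_eq h hf hg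

lemma rep_eq {f g : ℝ → ℝ} (hg : Continuous g) (h : f =ᵐ[volume] g) : rep f = g := by
  have := rep_spec ⟨g, hg, h⟩
  exact cont_unique this.1 hg (this.2.symm.trans h)

lemma ex_cont {f f₁ : ℝ → ℝ} (hf : LocallyIntegrable f volume) (hf₁ : LocallyIntegrable f₁ volume) (hw : WD1 f f₁) :
    ∃ g, Continuous g ∧ f =ᵐ[volume] g := by
  obtain ⟨c, h⟩ := dBR hf hf₁ hw
  exact ⟨_, continuous_const.add (intervalIntegral.continuous_primitive (fun a b => LI hf₁ a b) 0), h⟩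

lemma rep_lin {f g : ℝ → ℝ} (a : ℝ) (hf : ∃ g, Continuous g ∧ f =ᵐ[volume] g) (hg : ∃ f, Continuous f ∧ g =ᵐ[volume] f) :
    rep (fun t => a * f t + g t) = fun t => a * rep f t + rep g t := by
  have h1 := rep_spec hf
  have h2 := rep_spec hg
  refine rep_eq ((continuous_const.mul h1.1).add h2.1) ?_
  filter_upwards [h1.2, h2.2] with t ha hb
  rw [ha, hb]

lemma WD1.congr {f f₁ g g₁ : ℝ → ℝ} (hw : WD1 f f₁) (h : f =ᵐ[volume] g) (h1 : f₁ =ᵐ[volume] g₁) : WD1 g g₁ := by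
  intro η hη
  have e1 : ∫ t, g t * deriv η t = ∫ t, f t * deriv η t := integral_congr_ae (by filter_upwards [h] with t ht; rw [ht])
  have e2 : ∫ t, g₁ t * η t = ∫ t, f₁ t * η t := integral_congr_ae (by filter_upwards [h1] with t ht; rw [ht])
  rw [e1, e2]; exact hw η hη

/-- continuous functions with continuous weak derivative are C1 -/
lemma WD1.hasDeriv {f f₁ : ℝ → ℝ} (hw : WD1 f f₁) (h : Continuous f) (h1 : Continuous f₁) (x : ℝ) : HasDerivAt f (f₁ x) x := by
  obtain ⟨c, hc⟩ := dBR h.locallyIntegrable h1.locallyIntegrable hw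
  have : f = fun t => c + ∫ s in (0:ℝ)..t, f₁ s :=
    cont_unique h (continuous_const.add (intervalIntegral.continuous_primitive (fun a b => h1.intervalIntegrable _ _) 0)) hc
  rw [this]
  exact (intervalIntegral.integral_hasDerivAt_right (h1.intervalIntegrable _ _) (h1.stronglyMeasurableAtFilter _ _) h1.continuousAt).const_add c

lemma IsWeakD1.wd {f f₁ : ℝ → ℝ} (h : IsWeakD1 univ f f₁) : WD1 f f₁ := by
  intro g hg
  have := h g hg.smooth hg.cs (subset_univ _)
  simpa using this

structure KK (k kn χ : ℝ → ℝ) : Prop where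
  gk : GK k
  gn : GK kn
  gc : GK χ
  ik : ∫ s, k s = 1
  ikn : ∫ s, kn s = 1
  jk : ∫ s, smul1 k s = 0
  jkn : ∫ s, smul1 kn s = 0
  l : ∫ s, smul1 (smul1 k) s = ∫ s, smul1 (smul1 kn) s
  kz : ∀ s, s < 0 → k s = 0
  knz : ∀ s, 0 < s → kn s = 0
  c0 : χ 0 = 1
  c1 : deriv χ 0 = 0

lemma GK.dsmul {j : ℝ → ℝ} (hj : GK j) (s : ℝ) : _root_.deriv (_root_.smul1 j) s = j s + _root_.smul1 (_root_.deriv j) s := by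
  have h := (hasDerivAt_id s).mul ((hj.smooth.differentiable (by simp)) s).hasDerivAt
  have : _root_.smul1 j = id * j := rfl
  rw [this, h.deriv]
  simp [_root_.smul1]

lemma GK.int_smul_deriv {j : ℝ → ℝ} (hj : GK j) : ∫ s, _root_.smul1 (_root_.deriv j) s = - ∫ s, j s := by
  have h := hj.smul1.int_deriv
  simp only [hj.dsmul] at h
  rw [integral_add hj.int hj.deriv.smul1.int] at h
  linarith

lemma GK.add {j k : ℝ → ℝ} (hj : GK j) (hk : GK k) : GK (fun s => j s + k s) :=
  ⟨hj.smooth.add hk.smooth, hj.cs.add hk.cs⟩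

lemma KK_ex : ∃ k kn χ, KK k kn χ := by
  obtain ⟨b, hb, b1, bz⟩ := bump_ex
  have gk := hb.add hb.smul1.deriv
  set k : ℝ → ℝ := fun s => b s + deriv (smul1 b) s with hk
  have gn : GK (fun s => k (-s)) := ⟨gk.smooth.comp contDiff_neg, gk.cs.comp_homeomorph (Homeomorph.neg ℝ)⟩
  let B : ContDiffBump (0:ℝ) := ⟨1, 2, by norm_num, by norm_num⟩
  have ik : ∫ s, k s = 1 := by
    rw [hk, integral_add hb.int hb.smul1.deriv.int, b1, hb.smul1.int_deriv, add_zero]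
  have jk : ∫ s, smul1 k s = 0 := by
    have : smul1 k = fun s => smul1 b s + smul1 (deriv (smul1 b)) s := by
      funext s; simp only [smul1, hk]; ring
    rw [this, integral_add hb.smul1.int hb.smul1.deriv.smul1.int, hb.smul1.int_smul_deriv]
    ring
  have kz : ∀ s, s < 0 → k s = 0 := by
    intro s hs
    have h1 : smul1 b =ᶠ[nhds s] fun _ => 0 := by
      filter_upwards [Iio_mem_nhds hs] with t ht
      simp [smul1, bz t (le_of_lt ht)]
    simp only [hk]
    rw [bz s hs.le, h1.deriv_eq]; simp
  refine ⟨k, fun s => k (-s), B, gk, gn, ⟨B.contDiff, B.hasCompactSupport⟩, ik, ?_, jk, ?_, ?_, kz, ?_, ?_, ?_⟩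
  · rw [integral_neg_eq_self k volume]; exact ik
  · have : smul1 (fun s => k (-s)) = fun s => - (smul1 k (-s)) := by funext s; simp [smul1]
    rw [this, integral_neg, integral_neg_eq_self (smul1 k) volume, jk, neg_zero]
  · have : smul1 (smul1 (fun s => k (-s))) = fun s => (smul1 (smul1 k) (-s)) := by funext s; simp [smul1]
    rw [this, integral_neg_eq_self (smul1 (smul1 k)) volume]
  · intro s hs; exact kz _ (by linarith)
  · exact B.one_of_mem_closedBall (by simp [B])
  · have : (B : ℝ → ℝ) =ᶠ[nhds 0] fun _ => 1 := B.eventuallyEq_one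
    rw [this.deriv_eq]; simp

lemma TT_cont {m F : ℝ → ℝ} (hm : GK m) (hF : Continuous F) : Continuous fun p : ℝ × ℝ => TT m F p.1 p.2 := by
  have mc := hm.cont
  have h := continuous_parametric_integral_of_continuous (μ := (volume : Measure ℝ)) (f := fun (p : ℝ × ℝ) (s : ℝ) => F (p.1 - p.2 * s) * m s)
    (by unfold Function.uncurry; fun_prop) hm.cs.isCompact
  refine h.congr fun p => ?_
  unfold TT
  refine setIntegral_eq_integral_of_forall_compl_eq_zero fun s hs => ?_
  rw [image_eq_zero_of_notMem_tsupport hs, mul_zero]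

lemma TT_fd {m F F₁ : ℝ → ℝ} (hm : GK m) (hF : ∀ x, HasDerivAt F (F₁ x) x) (hF₁ : Continuous F₁) (p : ℝ × ℝ) :
    HasFDerivAt (fun p : ℝ × ℝ => TT m F p.1 p.2)
      (TT m F₁ p.1 p.2 • ContinuousLinearMap.fst ℝ ℝ ℝ - TT (smul1 m) F₁ p.1 p.2 • ContinuousLinearMap.snd ℝ ℝ ℝ) p := by
  have mc := hm.cont
  have Fc : Continuous F := continuous_iff_continuousAt.2 fun x => (hF x).continuousAt
  let D : ℝ × ℝ → ℝ → (ℝ × ℝ →L[ℝ] ℝ) := fun p s => (F₁ (p.1 - p.2 * s) * m s) •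
    (ContinuousLinearMap.fst ℝ ℝ ℝ - s • ContinuousLinearMap.snd ℝ ℝ ℝ)
  have Dc : Continuous (fun w : (ℝ × ℝ) × ℝ => D w.1 w.2) := by
    simp only [D]; fun_prop
  have cI : ∀ (G : ℝ → ℝ), Continuous G → ∀ n, GK n → Integrable fun s => G (p.1 - p.2 * s) * n s := by
    intro G hG n hn
    have := hn.cont
    exact (show Continuous fun s => G (p.1 - p.2 * s) * n s by fun_prop).integrable_of_hasCompactSupport hn.cs.mul_left
  obtain ⟨M, hM⟩ := ((isCompact_closedBall p 1).prod hm.cs.isCompact).exists_bound_of_continuousOn Dc.continuousOn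
  have key := hasFDerivAt_integral_of_dominated_of_fderiv_le (𝕜 := ℝ) (μ := (volume : Measure ℝ)) (s := Metric.closedBall p 1) (x₀ := p)
    (F := fun (p : ℝ × ℝ) s => F (p.1 - p.2 * s) * m s) (F' := D)
    (bound := (tsupport m).indicator fun _ => M) (Metric.closedBall_mem_nhds p one_pos)
    (Filter.Eventually.of_forall fun q => (show Continuous fun s => F (q.1 - q.2 * s) * m s by fun_prop).aestronglyMeasurable)
    (cI F Fc m hm)
    (show Continuous (D p) from Dc.comp (by fun_prop : Continuous fun s => (p, s))).aestronglyMeasurable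
    (Filter.Eventually.of_forall fun s q hq => ?_) ?_ (Filter.Eventually.of_forall fun s q hq => ?_)
  · have e : ∀ s, D p s = (F₁ (p.1 - p.2 * s) * m s) • ContinuousLinearMap.fst ℝ ℝ ℝ - (F₁ (p.1 - p.2 * s) * smul1 m s) • ContinuousLinearMap.snd ℝ ℝ ℝ := by
      intro s
      simp only [D, smul_sub, smul_smul, smul1]
      congr 2; ring
    have E : ∫ s, D p s = TT m F₁ p.1 p.2 • ContinuousLinearMap.fst ℝ ℝ ℝ - TT (smul1 m) F₁ p.1 p.2 • ContinuousLinearMap.snd ℝ ℝ ℝ := by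
      rw [show (fun s => D p s) = _ from funext e, integral_sub ((cI F₁ hF₁ m hm).smul_const _) ((cI F₁ hF₁ _ hm.smul1).smul_const _), integral_smul_const, integral_smul_const]
      rfl
    rw [E] at key
    exact key
  · by_cases hs : s ∈ tsupport m
    · rw [indicator_of_mem hs]; exact hM (q, s) ⟨hq, hs⟩
    · rw [indicator_of_notMem hs]
      simp [D, image_eq_zero_of_notMem_tsupport hs]
  · rw [integrable_indicator_iff (isClosed_tsupport m).measurableSet]
    exact integrableOn_const hm.cs.isCompact.measure_lt_top.ne
  · have h1 : HasFDerivAt (fun q : ℝ × ℝ => q.1 - q.2 * s) (ContinuousLinearMap.fst ℝ ℝ ℝ - s • ContinuousLinearMap.snd ℝ ℝ ℝ) q :=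
      hasFDerivAt_fst.sub (hasFDerivAt_snd.mul_const s)
    have h2 := ((hF (q.1 - q.2 * s)).comp_hasFDerivAt q h1).mul_const (m s)
    have E : D q s = m s • F₁ (q.1 - q.2 * s) • (ContinuousLinearMap.fst ℝ ℝ ℝ - s • ContinuousLinearMap.snd ℝ ℝ ℝ) := by
      simp only [D, smul_smul]; congr 1; ring
    rw [E]; exact h2

lemma TT_zero {m F : ℝ → ℝ} (x : ℝ) : TT m F x 0 = F x * ∫ s, m s := by
  simp [TT, integral_const_mul]

lemma VV_cont {m n F : ℝ → ℝ} (hm : GK m) (hn : GK n) (h0 : ∫ s, m s = ∫ s, n s) (hF : Continuous F) : Continuous (VV m n F) := by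
  unfold VV
  refine Continuous.if_le (TT_cont hm hF) (TT_cont hn hF) continuous_const continuous_snd fun p hp => ?_
  rw [← hp, TT_zero, TT_zero, h0]

lemma VV_fd {m n F F₁ : ℝ → ℝ} (hm : GK m) (hn : GK n) (h0 : ∫ s, m s = ∫ s, n s) (h1 : ∫ s, smul1 m s = ∫ s, smul1 n s)
    (hF : ∀ x, HasDerivAt F (F₁ x) x) (hF₁ : Continuous F₁) (p : ℝ × ℝ) :
    HasFDerivAt (VV m n F)
      (VV m n F₁ p • ContinuousLinearMap.fst ℝ ℝ ℝ - VV (smul1 m) (smul1 n) F₁ p • ContinuousLinearMap.snd ℝ ℝ ℝ) p := by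
  have hP := TT_fd hm hF hF₁ p
  have hN := TT_fd hn hF hF₁ p
  rcases lt_trichotomy p.2 0 with hp | hp | hp
  · have e : VV m n F =ᶠ[nhds p] fun p => TT n F p.1 p.2 := by
      filter_upwards [(isOpen_Iio.preimage continuous_snd).mem_nhds (show p ∈ Prod.snd ⁻¹' Iio (0:ℝ) from hp)] with q hq
      exact if_neg (not_le.2 hq)
    refine HasFDerivAt.congr_of_eventuallyEq ?_ e
    unfold VV; rw [if_neg (not_le.2 hp), if_neg (not_le.2 hp)]; exact hN
  · have e1 : VV m n F₁ p = TT m F₁ p.1 p.2 := if_pos hp.ge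
    have e2 : VV (smul1 m) (smul1 n) F₁ p = TT (smul1 m) F₁ p.1 p.2 := if_pos hp.ge
    rw [e1, e2]
    have e3 : TT n F₁ p.1 p.2 = TT m F₁ p.1 p.2 := by rw [hp, TT_zero, TT_zero, h0]
    have e4 : TT (smul1 n) F₁ p.1 p.2 = TT (smul1 m) F₁ p.1 p.2 := by rw [hp, TT_zero, TT_zero, h1]
    rw [e3, e4] at hN
    have a := (hP.hasFDerivWithinAt (s := {q : ℝ × ℝ | 0 ≤ q.2})).congr (f₁ := VV m n F) (fun q hq => if_pos hq) (if_pos hp.ge)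
    have b := (hN.hasFDerivWithinAt (s := {q : ℝ × ℝ | q.2 ≤ 0})).congr (f₁ := VV m n F) (fun q hq => ?_) ?_
    · have := a.union b
      rw [← hasFDerivWithinAt_univ]
      refine this.mono fun q _ => ?_
      exact le_total (0:ℝ) q.2
    · rcases eq_or_lt_of_le (show q.2 ≤ 0 from hq) with h | h
      · simp only [VV]; rw [if_pos h.ge, h, TT_zero, TT_zero, h0]
      · exact if_neg (not_le.2 h)
    · simp only [VV]; rw [if_pos hp.ge, hp, TT_zero, TT_zero, h0]
  · have e : VV m n F =ᶠ[nhds p] fun p => TT m F p.1 p.2 := by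
      filter_upwards [(isOpen_Ioi.preimage continuous_snd).mem_nhds (show p ∈ Prod.snd ⁻¹' Ioi (0:ℝ) from hp)] with q hq
      exact if_pos (le_of_lt hq)
    refine HasFDerivAt.congr_of_eventuallyEq ?_ e
    unfold VV; rw [if_pos hp.le, if_pos hp.le]; exact hP

lemma VVW {f f₁ m n : ℝ → ℝ} (hw : WD1 f f₁) (hm : GK m) (hn : GK n) (p : ℝ × ℝ) :
    VV (deriv m) (deriv n) f p = p.2 * VV m n f₁ p := by
  unfold VV; split_ifs
  · exact TTW hw hm _ _
  · exact TTW hw hn _ _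

lemma QQW {f f₁ c m n : ℝ → ℝ} (hw : WD1 f f₁) (hm : GK m) (hn : GK n) :
    QQ (smul1 c) m n f₁ = QQ c (deriv m) (deriv n) f := by
  funext p
  unfold QQ; rw [VVW hw hm hn, smul1]; ring

def UU (k kn χ f g : ℝ → ℝ) (p : ℝ × ℝ) : ℝ := QQ χ k kn f p + QQ (smul1 χ) k kn g p

lemma UU_c1 {k kn χ f f₁ g : ℝ → ℝ} (h : KK k kn χ) (hf : ∀ x, HasDerivAt f (f₁ x) x) (hf₁ : Continuous f₁) (hg : Continuous g) :
    ContDiff ℝ 1 (UU k kn χ f g) ∧ (∀ t, UU k kn χ f g (t, 0) = f t) ∧ ∀ t, fderiv ℝ (UU k kn χ f g) (t, 0) (0, 1) = g t := by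
  set Φ : ℝ → ℝ := fun x => ∫ s in (0:ℝ)..x, g s with hΦ
  have hw : WD1 Φ g := prim_WD1 hg.locallyIntegrable
  have hd : ∀ x, HasDerivAt Φ (g x) x := fun x =>
    intervalIntegral.integral_hasDerivAt_right (hg.intervalIntegrable _ _) (hg.stronglyMeasurableAtFilter _ _) hg.continuousAt
  have e : UU k kn χ f g = fun p => χ p.2 * (VV k kn f p + VV (deriv k) (deriv kn) Φ p) := by
    funext p
    unfold UU
    rw [QQW hw h.gk h.gn]; unfold QQ; ring
  have m0 : ∫ s, k s = ∫ s, kn s := by rw [h.ik, h.ikn]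
  have m1 : ∫ s, smul1 k s = ∫ s, smul1 kn s := by rw [h.jk, h.jkn]
  have n0 : ∫ s, deriv k s = ∫ s, deriv kn s := by rw [h.gk.int_deriv, h.gn.int_deriv]
  have n1 : ∫ s, smul1 (deriv k) s = ∫ s, smul1 (deriv kn) s := by rw [h.gk.int_smul_deriv, h.gn.int_smul_deriv, m0]
  have a := VV_fd h.gk h.gn m0 m1 hf hf₁
  have b := VV_fd h.gk.deriv h.gn.deriv n0 n1 hd hg
  have cc : ∀ p : ℝ × ℝ, HasFDerivAt (fun p : ℝ × ℝ => χ p.2) (deriv χ p.2 • (ContinuousLinearMap.snd ℝ ℝ ℝ)) p := fun p =>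
    ((h.gc.smooth.differentiable (by simp)) p.2).hasDerivAt.comp_hasFDerivAt p hasFDerivAt_snd
  have F := fun p => (cc p).mul ((a p).add (b p))
  have c1 := VV_cont h.gk h.gn m0 hf₁
  have c2 := VV_cont h.gk.smul1 h.gn.smul1 m1 hf₁
  have c3 := VV_cont h.gk.deriv h.gn.deriv n0 hg
  have c4 := VV_cont h.gk.deriv.smul1 h.gn.deriv.smul1 n1 hg
  have c5 : Continuous (VV k kn f) := VV_cont h.gk h.gn m0 (continuous_iff_continuousAt.2 fun x => (hf x).continuousAt)
  have c6 : Continuous (VV (deriv k) (deriv kn) Φ) := VV_cont h.gk.deriv h.gn.deriv n0 (continuous_iff_continuousAt.2 fun x => (hd x).continuousAt)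
  have c7 := h.gc.cont
  have c8 := h.gc.deriv.cont
  rw [e]
  refine ⟨?_, fun t => ?_, fun t => ?_⟩
  · rw [contDiff_one_iff_fderiv]
    refine ⟨fun p => (F p).differentiableAt, ?_⟩
    rw [show fderiv ℝ (fun p => χ p.2 * (VV k kn f p + VV (deriv k) (deriv kn) Φ p)) = _ from funext fun p => (F p).fderiv]
    fun_prop
  · simp only [VV, le_refl, if_true]
    rw [TT_zero, TT_zero, h.ik, h.gk.int_deriv, h.c0]; ring
  · have := (F (t, 0)).fderiv
    rw [show fderiv ℝ (fun p => χ p.2 * (VV k kn f p + VV (deriv k) (deriv kn) Φ p)) (t, 0) = _ from this]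
    simp only [VV, le_refl, if_true]
    rw [TT_zero, TT_zero, TT_zero, TT_zero]
    simp [h.ik, h.gk.int_deriv, h.c0, h.c1, h.jk, h.gk.int_smul_deriv]

lemma UU_supp {k kn χ f g : ℝ → ℝ} (h : KK k kn χ) (hf : ∀ t, t < 0 → f t = 0) (hg : ∀ t, t < 0 → g t = 0) (p : ℝ × ℝ) (hp : p.1 < 0) :
    UU k kn χ f g p = 0 := by
  have key : ∀ f : ℝ → ℝ, (∀ t, t < 0 → f t = 0) → VV k kn f p = 0 := by
    intro f hf
    unfold VV TT
    split_ifs with hy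
    · refine integral_eq_zero_of_ae (Filter.Eventually.of_forall fun s => ?_)
      simp only [Pi.zero_apply]
      rcases lt_or_ge s 0 with hs | hs
      · rw [h.kz s hs, mul_zero]
      · rw [hf _ (by nlinarith [mul_nonneg hy hs]), zero_mul]
    · push Not at hy
      refine integral_eq_zero_of_ae (Filter.Eventually.of_forall fun s => ?_)
      simp only [Pi.zero_apply]
      rcases lt_or_ge 0 s with hs | hs
      · rw [h.knz s hs, mul_zero]
      · rw [hf _ (by nlinarith [mul_nonneg_of_nonpos_of_nonpos hy.le hs]), zero_mul]
  unfold UU QQ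
  rw [key f hf, key g hg]; ring

lemma UU_lin {k kn χ f g f' g' : ℝ → ℝ} (h : KK k kn χ) (a : ℝ) (hf : Continuous f) (hg : Continuous g) (hf' : Continuous f') (hg' : Continuous g') (p : ℝ × ℝ) :
    UU k kn χ (fun t => a * f t + f' t) (fun t => a * g t + g' t) p = a * UU k kn χ f g p + UU k kn χ f' g' p := by
  have cI : ∀ (G : ℝ → ℝ), Continuous G → ∀ n, GK n → Integrable fun s => G (p.1 - p.2 * s) * n s := by
    intro G hG n hn
    have := hn.cont
    exact (show Continuous fun s => G (p.1 - p.2 * s) * n s by fun_prop).integrable_of_hasCompactSupport hn.cs.mul_left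
  have key : ∀ f f' : ℝ → ℝ, Continuous f → Continuous f' → VV k kn (fun t => a * f t + f' t) p = a * VV k kn f p + VV k kn f' p := by
    intro f f' hf hf'
    have t : ∀ n, GK n → TT n (fun t => a * f t + f' t) p.1 p.2 = a * TT n f p.1 p.2 + TT n f' p.1 p.2 := by
      intro n hn
      unfold TT
      rw [← integral_const_mul, ← integral_add ((cI f hf n hn).const_mul a) (cI f' hf' n hn)]
      congr 1; funext s; ring
    unfold VV; split_ifs
    · exact t k h.gk
    · exact t kn h.gn
  unfold UU QQ
  rw [key f f' hf hf', key g g' hg hg']; ring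

structure DD where
  f : ℝ → ℝ
  f₁ : ℝ → ℝ
  f₂ : ℝ → ℝ
  g : ℝ → ℝ
  g₁ : ℝ → ℝ

structure ML (f : ℝ → ℝ) : Prop where
  m : Measurable f
  l : MemLp f 2 (volume : Measure ℝ)

structure DD.OK (d : DD) : Prop where
  f : ML d.f
  f₁ : ML d.f₁
  f₂ : ML d.f₂
  g : ML d.g
  g₁ : ML d.g₁
  wf : WD1 d.f d.f₁
  wf₁ : WD1 d.f₁ d.f₂
  wg : WD1 d.g d.g₁

def nn (f : ℝ → ℝ) : ℝ := ∫ x, f x ^ 2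
lemma nn_nonneg (f : ℝ → ℝ) : 0 ≤ nn f := integral_nonneg fun x => sq_nonneg _

def DD.N (d : DD) : ℝ := nn d.f + nn d.f₁ + nn d.f₂ + nn d.g + nn d.g₁

lemma DD.N_nonneg (d : DD) : 0 ≤ d.N := by
  have := nn_nonneg d.f
  have := nn_nonneg d.f₁
  have := nn_nonneg d.f₂
  have := nn_nonneg d.g
  have := nn_nonneg d.g₁
  unfold DD.N; linarith

def Good (O : DD → ℝ × ℝ → ℝ) : Prop := ∃ C, 0 ≤ C ∧ ∀ d, DD.OK d → Measurable (O d) ∧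
  ∫⁻ p, ENNReal.ofReal (O d p ^ 2) ≤ ENNReal.ofReal (C * d.N) ∧ GG (O d) ≤ ENNReal.ofReal (C * d.N)

lemma GG_prod {v : ℝ × ℝ → ℝ} (hv : Measurable v) : GG v =
    ∫⁻ w : (ℝ × ℝ) × (ℝ × ℝ), ENNReal.ofReal ((v w.1 - v w.2) ^ 2 / dd w.1 w.2 ^ 3) := by
  have := dd_meas
  unfold GG
  rw [Measure.volume_eq_prod (ℝ × ℝ) (ℝ × ℝ), lintegral_prod _ (by fun_prop)]

lemma lint_two {α : Type*} [MeasurableSpace α] {μ : Measure α} {h a b : α → ℝ} (ha : Measurable a) (hb : Measurable b)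
    (a0 : ∀ x, 0 ≤ a x) (b0 : ∀ x, 0 ≤ b x) (hh : ∀ x, h x ≤ 2 * a x + 2 * b x) {A B : ℝ} (hA : 0 ≤ A) (hB : 0 ≤ B)
    (h1 : ∫⁻ x, ENNReal.ofReal (a x) ∂μ ≤ ENNReal.ofReal A) (h2 : ∫⁻ x, ENNReal.ofReal (b x) ∂μ ≤ ENNReal.ofReal B) :
    ∫⁻ x, ENNReal.ofReal (h x) ∂μ ≤ ENNReal.ofReal (2 * A + 2 * B) := by
  calc ∫⁻ x, ENNReal.ofReal (h x) ∂μ ≤ ∫⁻ x, (2 * ENNReal.ofReal (a x) + 2 * ENNReal.ofReal (b x)) ∂μ := by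
        refine lintegral_mono fun x => ?_
        refine (ENNReal.ofReal_le_ofReal (hh x)).trans (le_of_eq ?_)
        have := a0 x; have := b0 x
        rw [ENNReal.ofReal_add (by positivity) (by positivity), ENNReal.ofReal_mul (by norm_num), ENNReal.ofReal_mul (by norm_num)]
        simp
    _ = 2 * (∫⁻ x, ENNReal.ofReal (a x) ∂μ) + 2 * ∫⁻ x, ENNReal.ofReal (b x) ∂μ := by
        rw [lintegral_add_left (by fun_prop), lintegral_const_mul _ (by fun_prop), lintegral_const_mul _ (by fun_prop)]
    _ ≤ 2 * ENNReal.ofReal A + 2 * ENNReal.ofReal B := by gcongr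
    _ = _ := by
        rw [ENNReal.ofReal_add (by positivity) (by positivity), ENNReal.ofReal_mul (by norm_num), ENNReal.ofReal_mul (by norm_num)]
        simp

lemma dd_nonneg (p q : ℝ × ℝ) : 0 ≤ dd p q := Real.sqrt_nonneg _

lemma Good.lin {O P : DD → ℝ × ℝ → ℝ} (hO : Good O) (hP : Good P) {a : ℝ} (ha : a ^ 2 = 1) : Good (fun d p => O d p + a * P d p) := by
  obtain ⟨C, hC, h⟩ := hO
  obtain ⟨D, hD, k⟩ := hP
  have ddm := dd_meas
  refine ⟨2 * C + 2 * D, by positivity, fun d hd => ?_⟩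
  obtain ⟨h1, h2, h3⟩ := h d hd
  obtain ⟨k1, k2, k3⟩ := k d hd
  have m : Measurable (fun p => O d p + a * P d p) := by fun_prop
  have N := d.N_nonneg
  have E : (2 * C + 2 * D) * d.N = 2 * (C * d.N) + 2 * (D * d.N) := by ring
  refine ⟨m, ?_, ?_⟩
  · rw [E]
    refine lint_two (a := fun p => O d p ^ 2) (b := fun p => P d p ^ 2) (by fun_prop) (by fun_prop) (fun x => sq_nonneg _) (fun x => sq_nonneg _)
      (fun x => ?_) (by positivity) (by positivity) h2 k2
    nlinarith [sq_nonneg (O d x - a * P d x)]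
  · rw [E]
    rw [GG_prod m]
    rw [GG_prod h1] at h3
    rw [GG_prod k1] at k3
    refine lint_two (by fun_prop) (by fun_prop) (fun w => ?_) (fun w => ?_)
      (fun w => ?_) (by positivity) (by positivity) h3 k3
    · have := dd_nonneg w.1 w.2; positivity
    · have := dd_nonneg w.1 w.2; positivity
    · have := dd_nonneg w.1 w.2
      rw [← mul_div_assoc, ← mul_div_assoc, ← add_div]
      gcongr
      nlinarith [sq_nonneg ((O d w.1 - O d w.2) - a * (P d w.1 - P d w.2))]

lemma Good.add {O P : DD → ℝ × ℝ → ℝ} (hO : Good O) (hP : Good P) : Good (fun d p => O d p + P d p) := by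
  have := hO.lin hP (a := 1) (by norm_num)
  simpa using this

lemma Good.sub {O P : DD → ℝ × ℝ → ℝ} (hO : Good O) (hP : Good P) : Good (fun d p => O d p - P d p) := by
  have := hO.lin hP (a := -1) (by norm_num)
  simpa [sub_eq_add_neg] using this

lemma good_QQ {sel : DD → ℝ → ℝ} (hs : ∀ d, DD.OK d → ML (sel d)) (hN : ∀ d, DD.OK d → nn (sel d) ≤ d.N) {c m n : ℝ → ℝ}
    (hc : GK c) (hm : GK m) (hn : GK n) (he : ∫ s, m s = ∫ s, n s) : Good (fun d => QQ c m n (sel d)) := by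
  obtain ⟨C, hC, h⟩ := L2_QQ hc hm hn
  obtain ⟨D, hD, k⟩ := GG_QQ hc hm hn he
  refine ⟨max C D, hC.trans (le_max_left _ _), fun d hd => ⟨?_, ?_, ?_⟩⟩
  · have := VV_meas (hs d hd).m hm.cont.measurable hn.cont.measurable
    have := hc.cont.measurable
    unfold QQ; fun_prop
  · refine (h _ (hs d hd).m (hs d hd).l).trans (ENNReal.ofReal_le_ofReal ?_)
    exact mul_le_mul (le_max_left _ _) (hN d hd) (nn_nonneg _) (hC.trans (le_max_left _ _))
  · refine (k _ (hs d hd).m (hs d hd).l).trans (ENNReal.ofReal_le_ofReal ?_)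
    exact mul_le_mul (le_max_right _ _) (hN d hd) (nn_nonneg _) (hC.trans (le_max_left _ _))

lemma DD.bounds (d : DD) : nn d.f ≤ d.N ∧ nn d.f₁ ≤ d.N ∧ nn d.f₂ ≤ d.N ∧ nn d.g ≤ d.N ∧ nn d.g₁ ≤ d.N := by
  have := nn_nonneg d.f
  have := nn_nonneg d.f₁
  have := nn_nonneg d.f₂
  have := nn_nonneg d.g
  have := nn_nonneg d.g₁
  unfold DD.N
  refine ⟨?_, ?_, ?_, ?_, ?_⟩ <;> linarith

lemma gQf {c m n : ℝ → ℝ} (hc : GK c) (hm : GK m) (hn : GK n) (he : ∫ s, m s = ∫ s, n s) : Good (fun d => QQ c m n d.f) :=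
  good_QQ (fun d h => h.f) (fun d _ => d.bounds.1) hc hm hn he
lemma gQf₁ {c m n : ℝ → ℝ} (hc : GK c) (hm : GK m) (hn : GK n) (he : ∫ s, m s = ∫ s, n s) : Good (fun d => QQ c m n d.f₁) :=
  good_QQ (fun d h => h.f₁) (fun d _ => d.bounds.2.1) hc hm hn he
lemma gQf₂ {c m n : ℝ → ℝ} (hc : GK c) (hm : GK m) (hn : GK n) (he : ∫ s, m s = ∫ s, n s) : Good (fun d => QQ c m n d.f₂) :=
  good_QQ (fun d h => h.f₂) (fun d _ => d.bounds.2.2.1) hc hm hn he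
lemma gQg {c m n : ℝ → ℝ} (hc : GK c) (hm : GK m) (hn : GK n) (he : ∫ s, m s = ∫ s, n s) : Good (fun d => QQ c m n d.g) :=
  good_QQ (fun d h => h.g) (fun d _ => d.bounds.2.2.2.1) hc hm hn he
lemma gQg₁ {c m n : ℝ → ℝ} (hc : GK c) (hm : GK m) (hn : GK n) (he : ∫ s, m s = ∫ s, n s) : Good (fun d => QQ c m n d.g₁) :=
  good_QQ (fun d h => h.g₁) (fun d _ => d.bounds.2.2.2.2) hc hm hn he

lemma WD2.add {e : ℝ × ℝ} {u v u' v' : ℝ × ℝ → ℝ} (h : WD2 e u v) (h' : WD2 e u' v') :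
    WD2 e (fun p => u p + u' p) (fun p => v p + v' p) := by
  intro η hη
  obtain ⟨a, b, c⟩ := h η hη
  obtain ⟨a', b', c'⟩ := h' η hη
  simp only [add_mul]
  refine ⟨a.add a', b.add b', ?_⟩
  rw [integral_add a a', integral_add b b', c, c']; ring

lemma WD2.sub {e : ℝ × ℝ} {u v u' v' : ℝ × ℝ → ℝ} (h : WD2 e u v) (h' : WD2 e u' v') :
    WD2 e (fun p => u p - u' p) (fun p => v p - v' p) := by
  intro η hη
  obtain ⟨a, b, c⟩ := h η hη
  obtain ⟨a', b', c'⟩ := h' η hη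
  simp only [sub_mul]
  refine ⟨a.sub a', b.sub b', ?_⟩
  rw [integral_sub a a', integral_sub b b', c, c']; ring

lemma qx {f f₁ c m n : ℝ → ℝ} (hf : ML f) (hf₁ : ML f₁) (hw : WD1 f f₁)
    (hc : GK c) (hm : GK m) (hn : GK n) : WD2 (1, 0) (QQ c m n f) (QQ c m n f₁) :=
  QQx hf.m hf.l hf₁.m hf₁.l hw hc hm hn

lemma qy {f f₁ c m n : ℝ → ℝ} (hf : ML f) (hf₁ : ML f₁) (hw : WD1 f f₁)
    (hc : GK c) (hm : GK m) (hn : GK n) (hmn : ∫ s, m s = ∫ s, n s) :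
    WD2 (0, 1) (QQ c m n f) (fun p => QQ (deriv c) m n f p - QQ c (smul1 m) (smul1 n) f₁ p) :=
  QQy hf.m hf.l hf₁.m hf₁.l hw hc hm hn hmn

/-- everything needed in the plane -/
lemma plane {k kn χ : ℝ → ℝ} (h : KK k kn χ) : ∃ (G : Fin 2 → DD → ℝ × ℝ → ℝ) (H : Fin 2 → Fin 2 → DD → ℝ × ℝ → ℝ),
    Good (fun d => UU k kn χ d.f d.g) ∧ (∀ i, Good (G i)) ∧ (∀ i j, Good (H i j)) ∧
    ∀ d, DD.OK d → (WD2 (1, 0) (UU k kn χ d.f d.g) (G 0 d) ∧ WD2 (0, 1) (UU k kn χ d.f d.g) (G 1 d)) ∧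
      ∀ i, WD2 (1, 0) (G i d) (H i 0 d) ∧ WD2 (0, 1) (G i d) (H i 1 d) := by
  have gk := h.gk
  have gn := h.gn
  have gc := h.gc
  have m0 : ∫ s, k s = ∫ s, kn s := by rw [h.ik, h.ikn]
  have m1 : ∫ s, smul1 k s = ∫ s, smul1 kn s := by rw [h.jk, h.jkn]
  have m2 := h.l
  have n0 : ∫ s, deriv k s = ∫ s, deriv kn s := by rw [gk.int_deriv, gn.int_deriv]
  have n1 : ∫ s, smul1 (deriv k) s = ∫ s, smul1 (deriv kn) s := by rw [gk.int_smul_deriv, gn.int_smul_deriv, m0]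
  have l0 : ∫ s, deriv (smul1 k) s = ∫ s, deriv (smul1 kn) s := by rw [gk.smul1.int_deriv, gn.smul1.int_deriv]
  have l1 : ∫ s, smul1 (deriv (smul1 k)) s = ∫ s, smul1 (deriv (smul1 kn)) s := by
    rw [gk.smul1.int_smul_deriv, gn.smul1.int_smul_deriv, m1]
  let G0 : DD → ℝ × ℝ → ℝ := fun d p => QQ χ k kn d.f₁ p + QQ χ (deriv k) (deriv kn) d.g p
  let G1 : DD → ℝ × ℝ → ℝ := fun d p => (QQ (deriv χ) k kn d.f p - QQ χ (smul1 k) (smul1 kn) d.f₁ p) +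
    (QQ (deriv (smul1 χ)) k kn d.g p - QQ χ (deriv (smul1 k)) (deriv (smul1 kn)) d.g p)
  let H00 : DD → ℝ × ℝ → ℝ := fun d p => QQ χ k kn d.f₂ p + QQ χ (deriv k) (deriv kn) d.g₁ p
  let H01 : DD → ℝ × ℝ → ℝ := fun d p => (QQ (deriv χ) k kn d.f₁ p - QQ χ (smul1 k) (smul1 kn) d.f₂ p) +
    (QQ (deriv χ) (deriv k) (deriv kn) d.g p - QQ χ (smul1 (deriv k)) (smul1 (deriv kn)) d.g₁ p)
  let H10 : DD → ℝ × ℝ → ℝ := fun d p => (QQ (deriv χ) k kn d.f₁ p - QQ χ (smul1 k) (smul1 kn) d.f₂ p) +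
    (QQ (deriv (smul1 χ)) k kn d.g₁ p - QQ χ (deriv (smul1 k)) (deriv (smul1 kn)) d.g₁ p)
  let H11 : DD → ℝ × ℝ → ℝ := fun d p =>
    ((QQ (deriv (deriv χ)) k kn d.f p - QQ (deriv χ) (smul1 k) (smul1 kn) d.f₁ p) -
      (QQ (deriv χ) (smul1 k) (smul1 kn) d.f₁ p - QQ χ (smul1 (smul1 k)) (smul1 (smul1 kn)) d.f₂ p)) +
    ((QQ (deriv (deriv (smul1 χ))) k kn d.g p - QQ (deriv (smul1 χ)) (smul1 k) (smul1 kn) d.g₁ p) -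
      (QQ (deriv χ) (deriv (smul1 k)) (deriv (smul1 kn)) d.g p -
        QQ χ (smul1 (deriv (smul1 k))) (smul1 (deriv (smul1 kn))) d.g₁ p))
  refine ⟨![G0, G1], ![![H00, H01], ![H10, H11]], ?_, ?_, ?_, ?_⟩
  · exact (gQf gc gk gn m0).add (gQg gc.smul1 gk gn m0)
  · intro i
    fin_cases i
    · exact (gQf₁ gc gk gn m0).add (gQg gc gk.deriv gn.deriv n0)
    · exact ((gQf gc.deriv gk gn m0).sub (gQf₁ gc gk.smul1 gn.smul1 m1)).add
        ((gQg gc.smul1.deriv gk gn m0).sub (gQg gc gk.smul1.deriv gn.smul1.deriv l0))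
  · intro i j
    fin_cases i <;> fin_cases j
    · exact (gQf₂ gc gk gn m0).add (gQg₁ gc gk.deriv gn.deriv n0)
    · exact ((gQf₁ gc.deriv gk gn m0).sub (gQf₂ gc gk.smul1 gn.smul1 m1)).add
        ((gQg gc.deriv gk.deriv gn.deriv n0).sub (gQg₁ gc gk.deriv.smul1 gn.deriv.smul1 n1))
    · exact ((gQf₁ gc.deriv gk gn m0).sub (gQf₂ gc gk.smul1 gn.smul1 m1)).add
        ((gQg₁ gc.smul1.deriv gk gn m0).sub (gQg₁ gc gk.smul1.deriv gn.smul1.deriv l0))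
    · exact (((gQf gc.deriv.deriv gk gn m0).sub (gQf₁ gc.deriv gk.smul1 gn.smul1 m1)).sub
        ((gQf₁ gc.deriv gk.smul1 gn.smul1 m1).sub (gQf₂ gc gk.smul1.smul1 gn.smul1.smul1 m2))).add
        (((gQg gc.smul1.deriv.deriv gk gn m0).sub (gQg₁ gc.smul1.deriv gk.smul1 gn.smul1 m1)).sub
        ((gQg gc.deriv gk.smul1.deriv gn.smul1.deriv l0).sub (gQg₁ gc gk.smul1.deriv.smul1 gn.smul1.deriv.smul1 l1)))
  · intro d hd
    refine ⟨⟨?_, ?_⟩, fun i => ?_⟩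
    · have := (qx hd.f hd.f₁ hd.wf gc gk gn).add (qx hd.g hd.g₁ hd.wg gc.smul1 gk gn)
      rw [QQW hd.wg gk gn] at this
      exact this
    · have := (qy hd.f hd.f₁ hd.wf gc gk gn m0).add (qy hd.g hd.g₁ hd.wg gc.smul1 gk gn m0)
      rw [QQW hd.wg gk.smul1 gn.smul1] at this
      exact this
    · fin_cases i
      · refine ⟨?_, ?_⟩
        · exact (qx hd.f₁ hd.f₂ hd.wf₁ gc gk gn).add (qx hd.g hd.g₁ hd.wg gc gk.deriv gn.deriv)
        · exact (qy hd.f₁ hd.f₂ hd.wf₁ gc gk gn m0).add (qy hd.g hd.g₁ hd.wg gc gk.deriv gn.deriv n0)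
      · refine ⟨?_, ?_⟩
        · exact ((qx hd.f hd.f₁ hd.wf gc.deriv gk gn).sub (qx hd.f₁ hd.f₂ hd.wf₁ gc gk.smul1 gn.smul1)).add
            ((qx hd.g hd.g₁ hd.wg gc.smul1.deriv gk gn).sub (qx hd.g hd.g₁ hd.wg gc gk.smul1.deriv gn.smul1.deriv))
        · exact ((qy hd.f hd.f₁ hd.wf gc.deriv gk gn m0).sub (qy hd.f₁ hd.f₂ hd.wf₁ gc gk.smul1 gn.smul1 m1)).add
            ((qy hd.g hd.g₁ hd.wg gc.smul1.deriv gk gn m0).sub (qy hd.g hd.g₁ hd.wg gc gk.smul1.deriv gn.smul1.deriv l0))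

def eM : E2 ≃ᵐ ℝ × ℝ := (MeasurableEquiv.toLp 2 (Fin 2 → ℝ)).symm.trans MeasurableEquiv.finTwoArrow
def eL : E2 ≃L[ℝ] ℝ × ℝ := (EuclideanSpace.equiv (Fin 2) ℝ).trans (ContinuousLinearEquiv.finTwoArrow ℝ ℝ)

lemma eM_apply (x : E2) : eM x = (x 0, x 1) := rfl
lemma eL_apply (x : E2) : eL x = (x 0, x 1) := rfl
lemma eL_eM : (eL : E2 → ℝ × ℝ) = eM := rfl

lemma eM_mp : MeasurePreserving eM (volume : Measure E2) (volume : Measure (ℝ × ℝ)) :=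
  (volume_preserving_finTwoArrow ℝ).comp (EuclideanSpace.volume_preserving_symm_measurableEquiv_toLp (Fin 2))

lemma lint_real {α : Type*} [MeasurableSpace α] {μ : Measure α} {h : α → ℝ} (hm : Measurable h) (h0 : ∀ x, 0 ≤ h x) {K : ℝ} (hK : 0 ≤ K)
    (hl : ∫⁻ x, ENNReal.ofReal (h x) ∂μ ≤ ENNReal.ofReal K) : Integrable h μ ∧ ∫ x, h x ∂μ ≤ K := by
  refine ⟨⟨hm.aestronglyMeasurable, ?_⟩, ?_⟩
  · rw [hasFiniteIntegral_iff_ofReal (Filter.Eventually.of_forall h0)]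
    exact hl.trans_lt ENNReal.ofReal_lt_top
  · rw [integral_eq_lintegral_of_nonneg_ae (Filter.Eventually.of_forall h0) hm.aestronglyMeasurable]
    exact ENNReal.toReal_le_of_le_ofReal hK hl

lemma tr_L2 {v : ℝ × ℝ → ℝ} (hv : Measurable v) {K : ℝ} (hK : 0 ≤ K) (h : ∫⁻ p, ENNReal.ofReal (v p ^ 2) ≤ ENNReal.ofReal K) :
    L2on (univ : Set E2) (fun x => v (eM x)) ∧ Integrable (fun x : E2 => v (eM x) ^ 2) ∧ ∫ x : E2, v (eM x) ^ 2 ≤ K := by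
  have m : Measurable fun x : E2 => v (eM x) := hv.comp eM.measurable
  have h' : ∫⁻ x : E2, ENNReal.ofReal (v (eM x) ^ 2) ≤ ENNReal.ofReal K := by
    rw [eM_mp.lintegral_comp (f := fun p => ENNReal.ofReal (v p ^ 2)) (by fun_prop)]; exact h
  have k := lint_real (m.pow_const 2) (fun x => sq_nonneg _) hK h'
  refine ⟨?_, k⟩
  unfold L2on
  rw [Measure.restrict_univ]
  exact (memLp_two_iff_integrable_sq m.aestronglyMeasurable).2 k.1

lemma norm_dd (x y : E2) : ‖x - y‖ = dd (eM x) (eM y) := by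
  rw [EuclideanSpace.norm_eq, Fin.sum_univ_two]
  simp [dd, eM_apply]

lemma tr_GG {v : ℝ × ℝ → ℝ} (hv : Measurable v) {K : ℝ} (hK : 0 ≤ K) (h : GG v ≤ ENNReal.ofReal K) :
    GagH12 (univ : Set E2) (fun x => v (eM x)) ∧ GagSqVal (univ : Set E2) (fun x => v (eM x)) ≤ K := by
  have ddm := dd_meas
  rw [GG_prod hv] at h
  have m1 : Measurable fun w : (ℝ × ℝ) × (ℝ × ℝ) => (v w.1 - v w.2) ^ 2 / dd w.1 w.2 ^ 3 := by fun_prop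
  have mp : MeasurePreserving (Prod.map eM eM) ((volume : Measure E2).prod (volume : Measure E2)) (volume : Measure ((ℝ × ℝ) × (ℝ × ℝ))) :=
    eM_mp.prod eM_mp
  have e : (fun q : E2 × E2 => (v (eM q.1) - v (eM q.2)) ^ 2 / ‖q.1 - q.2‖ ^ (2 + 1)) =
      fun q : E2 × E2 => (fun w : (ℝ × ℝ) × (ℝ × ℝ) => (v w.1 - v w.2) ^ 2 / dd w.1 w.2 ^ 3) (Prod.map eM eM q) := by
    funext q; rw [norm_dd]; rfl
  have m2 : Measurable (fun q : E2 × E2 => (v (eM q.1) - v (eM q.2)) ^ 2 / ‖q.1 - q.2‖ ^ (2 + 1)) := by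
    rw [e]; exact m1.comp mp.measurable
  have h' : ∫⁻ q, ENNReal.ofReal ((fun q : E2 × E2 => (v (eM q.1) - v (eM q.2)) ^ 2 / ‖q.1 - q.2‖ ^ (2 + 1)) q) ∂((volume : Measure E2).prod (volume : Measure E2)) ≤ ENNReal.ofReal K := by
    rw [e]
    rw [← mp.lintegral_comp (m1.ennreal_ofReal)] at h
    exact h
  have k := lint_real m2 (fun q => by positivity) hK h'
  unfold GagH12 GagSqVal
  rw [Measure.restrict_univ]
  exact k

lemma tr_WD {e : ℝ × ℝ} {u v : ℝ × ℝ → ℝ} (h : WD2 e u v) (w : E2) (hw : eL w = e) :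
    IsWeakD (univ : Set E2) (fun x => u (eM x)) (fun x => v (eM x)) w := by
  intro φ hφ hc _
  have t : T2 (φ ∘ eL.symm) := ⟨hφ.comp eL.symm.contDiff, hc.comp_homeomorph eL.symm.toHomeomorph⟩
  obtain ⟨_, _, k⟩ := h _ t
  rw [Measure.restrict_univ]
  rw [← eM_mp.integral_comp eM.measurableEmbedding, ← eM_mp.integral_comp eM.measurableEmbedding] at k
  have e1 : ∀ x : E2, pd (φ ∘ eL.symm) e (eM x) = fderiv ℝ φ x w := by
    intro x
    unfold pd
    rw [← eL_eM, fderiv_comp _ (by simpa using (hφ.differentiable (by simp)) _) eL.symm.differentiableAt]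
    rw [ContinuousLinearEquiv.fderiv]
    simp [← hw]
  have e2 : ∀ x : E2, (φ ∘ eL.symm) (eM x) = φ x := by
    intro x; rw [← eL_eM]; simp
  simp only [e1, e2] at k
  exact k

lemma mk_data {φ φ₁ φ₂ ψ ψ₁ : ℝ → ℝ} (h : MemH2line φ φ₁ φ₂) (h' : MemH1line ψ ψ₁) :
    ∃ d : DD, d.OK ∧ d.f = rep φ ∧ d.g = rep ψ ∧ φ =ᵐ[volume] rep φ ∧ ψ =ᵐ[volume] rep ψ ∧
    Continuous (rep φ) ∧ Continuous (rep ψ) ∧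
    (∀ x, HasDerivAt d.f (d.f₁ x) x) ∧ Continuous d.f₁ ∧ Continuous d.g ∧
    d.N = (∫ t : ℝ, ((φ t) ^ 2 + (φ₁ t) ^ 2 + (φ₂ t) ^ 2)) + (∫ t : ℝ, ((ψ t) ^ 2 + (ψ₁ t) ^ 2)) := by
  obtain ⟨a0, a1, a2, w0, w1⟩ := h
  obtain ⟨b0, b1, v0⟩ := h'
  have r0 := rep_spec (ex_cont (L2loc a0) (L2loc a1) w0.wd)
  have r1 := rep_spec (ex_cont (L2loc a1) (L2loc a2) w1.wd)
  have s0 := rep_spec (ex_cont (L2loc b0) (L2loc b1) v0.wd)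
  have r2 := a2.1.aemeasurable.ae_eq_mk
  have s1 := b1.1.aemeasurable.ae_eq_mk
  have W := w0.wd.congr r0.2 r1.2
  refine ⟨⟨rep φ, rep φ₁, a2.1.aemeasurable.mk φ₂, rep ψ, b1.1.aemeasurable.mk ψ₁⟩, ⟨?_, ?_, ?_, ?_, ?_, W, w1.wd.congr r1.2 r2, v0.wd.congr s0.2 s1⟩,
    rfl, rfl, r0.2, s0.2, r0.1, s0.1, W.hasDeriv r0.1 r1.1, r1.1, s0.1, ?_⟩
  · exact ⟨r0.1.measurable, a0.ae_eq r0.2⟩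
  · exact ⟨r1.1.measurable, a1.ae_eq r1.2⟩
  · exact ⟨a2.1.aemeasurable.measurable_mk, a2.ae_eq r2⟩
  · exact ⟨s0.1.measurable, b0.ae_eq s0.2⟩
  · exact ⟨b1.1.aemeasurable.measurable_mk, b1.ae_eq s1⟩
  · have key : ∀ f g : ℝ → ℝ, f =ᵐ[volume] g → nn g = ∫ t, f t ^ 2 := fun f g hfg =>
      integral_congr_ae (by filter_upwards [hfg] with t ht; rw [ht])
    unfold DD.N
    simp only
    have i12 : Integrable (fun t => φ t ^ 2 + φ₁ t ^ 2) := a0.integrable_sq.add a1.integrable_sq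
    rw [key _ _ r0.2, key _ _ r1.2, key _ _ r2, key _ _ s0.2, key _ _ s1,
      integral_add i12 a2.integrable_sq,
      integral_add a0.integrable_sq a1.integrable_sq, integral_add b0.integrable_sq b1.integrable_sq]
    ring

lemma neg_zero_of_ae {f g : ℝ → ℝ} (h : f =ᵐ[volume] g) (hg : Continuous g) (hz : ∀ᵐ t : ℝ, t < 0 → f t = 0) : ∀ t, t < 0 → g t = 0 := by
  have : EqOn g (fun _ => 0) (Iio 0) := by
    refine Measure.eqOn_open_of_ae_eq (μ := (volume : Measure ℝ)) ?_ isOpen_Iio hg.continuousOn continuousOn_const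
    rw [Filter.EventuallyEq, ae_restrict_iff' measurableSet_Iio]
    filter_upwards [h, hz] with t h1 h2 h3
    rw [← h1]; exact h2 h3
  exact fun t ht => this ht

theorem lifting_operator_L1 :
    ∃ (L : (ℝ → ℝ) → (ℝ → ℝ) → E2 → ℝ) (C : ℝ), 0 < C ∧
      -- linearity
      (∀ (a : ℝ) (φ ψ φ' ψ' : ℝ → ℝ)
        (φ₁ φ₂ ψ₁ φ₁' φ₂' ψ₁' : ℝ → ℝ),
        MemH2line φ φ₁ φ₂ → MemH1line ψ ψ₁ → MemH2line φ' φ₁' φ₂' → MemH1line ψ' ψ₁' →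
        ∀ x, L (fun t => a * φ t + φ' t) (fun t => a * ψ t + ψ' t) x
          = a * L φ ψ x + L φ' ψ' x) ∧
      ∀ φ ψ φ₁ φ₂ ψ₁ : ℝ → ℝ, MemH2line φ φ₁ φ₂ → MemH1line ψ ψ₁ →
        -- L(φ,ψ) ∈ H^{5/2}(ℝ²), boundedly
        ContDiff ℝ 1 (L φ ψ) ∧
        (∃ G Hs, MemH2W (univ : Set E2) (L φ ψ) G Hs ∧
          (∀ d d', GagH12 (univ : Set E2) (Hs d d')) ∧
          (∫ x : E2, ((L φ ψ x) ^ 2 + ∑ d : Fin 2, (G d x) ^ 2 +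
              ∑ d : Fin 2, ∑ d' : Fin 2, (Hs d d' x) ^ 2)) +
            (∑ d : Fin 2, ∑ d' : Fin 2, GagSqVal (univ : Set E2) (Hs d d'))
            ≤ C * ((∫ t : ℝ, ((φ t) ^ 2 + (φ₁ t) ^ 2 + (φ₂ t) ^ 2)) +
                (∫ t : ℝ, ((ψ t) ^ 2 + (ψ₁ t) ^ 2)))) ∧
        -- (i) trace of L(φ,ψ) on the line x₂ = 0 is φ
        (∀ᵐ t : ℝ, L φ ψ (EuclideanSpace.single 0 t) = φ t) ∧
        -- (ii) trace of ∂L(φ,ψ)/∂x₂ on the line x₂ = 0 is ψ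
        (∀ᵐ t : ℝ, fderiv ℝ (L φ ψ) (EuclideanSpace.single 0 t) (stdb2 1) = ψ t) ∧
        -- (iii) support property
        ((∀ᵐ t : ℝ, t < 0 → φ t = 0) → (∀ᵐ t : ℝ, t < 0 → ψ t = 0) →
          ∀ x : E2, x 0 < 0 → L φ ψ x = 0) := by

  obtain ⟨k, kn, χ, hK⟩ := KK_ex
  obtain ⟨G, H, gU, gG, gH, hW⟩ := plane hK
  obtain ⟨CU, cU0, cU⟩ := gU
  choose CG cG0 cG using gG
  choose CH cH0 cH using gH
  set C : ℝ := CU + CG 0 + CG 1 + 2 * (CH 0 0 + CH 0 1 + CH 1 0 + CH 1 1) + 1 with hC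
  have cpos : 0 < C := by
    have := cG0 0; have := cG0 1; have := cH0 0 0; have := cH0 0 1; have := cH0 1 0; have := cH0 1 1
    positivity
  refine ⟨fun φ ψ x => UU k kn χ (rep φ) (rep ψ) (eM x), C, cpos, ?_, ?_⟩
  · intro a φ ψ φ' ψ' φ₁ φ₂ ψ₁ φ₁' φ₂' ψ₁' h h' g g' x
    have p1 := ex_cont (L2loc h.1) (L2loc h.2.1) h.2.2.2.1.wd
    have p2 := ex_cont (L2loc g.1) (L2loc g.2.1) g.2.2.2.1.wd
    have q1 := ex_cont (L2loc h'.1) (L2loc h'.2.1) h'.2.2.wd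
    have q2 := ex_cont (L2loc g'.1) (L2loc g'.2.1) g'.2.2.wd
    simp only
    rw [rep_lin a p1 p2, rep_lin a q1 q2]
    exact UU_lin hK a (rep_spec p1).1 (rep_spec q1).1 (rep_spec p2).1 (rep_spec q2).1 _
  · intro φ ψ φ₁ φ₂ ψ₁ h h'
    obtain ⟨d, ok, df, dg, rφ, rψ, cφ, cψ, hd, c1, c2, hN⟩ := mk_data h h'
    have N0 := d.N_nonneg
    beta_reduce
    rw [← df, ← dg]
    obtain ⟨u1, u2, u3⟩ := UU_c1 hK hd c1 c2
    set U := UU k kn χ d.f d.g with hU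
    refine ⟨u1.comp eL.contDiff, ?_, ?_, ?_, ?_⟩
    · obtain ⟨⟨wa, wb⟩, wc⟩ := hW d ok
      obtain ⟨mU, lU, _⟩ := cU d ok
      have tU := tr_L2 mU (mul_nonneg cU0 N0) lU
      have tG := fun i => tr_L2 (cG i d ok).1 (mul_nonneg (cG0 i) N0) (cG i d ok).2.1
      have tH := fun i j => tr_L2 (cH i j d ok).1 (mul_nonneg (cH0 i j) N0) (cH i j d ok).2.1
      have tHG := fun i j => tr_GG (cH i j d ok).1 (mul_nonneg (cH0 i j) N0) (cH i j d ok).2.2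
      have e0 : eL (EuclideanSpace.single 0 1) = (1, 0) := by simp [eL_apply]
      have e1 : eL (EuclideanSpace.single 1 1) = (0, 1) := by simp [eL_apply]
      refine ⟨fun i x => G i d (eM x), fun i j x => H i j d (eM x), ⟨tU.1, fun i => ⟨(tG i).1, ?_⟩, fun i j => ⟨(tH i j).1, ?_⟩⟩,
        fun i j => (tHG i j).1, ?_⟩
      · fin_cases i
        · exact tr_WD wa _ e0
        · exact tr_WD wb _ e1
      · fin_cases j
        · exact tr_WD (wc i).1 _ e0
        · exact tr_WD (wc i).2 _ e1
      · rw [← hN]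
        simp only [Fin.sum_univ_two]
        have iG : Integrable (fun x : E2 => G 0 d (eM x) ^ 2 + G 1 d (eM x) ^ 2) := (tG 0).2.1.add (tG 1).2.1
        have iUG : Integrable (fun x : E2 => U (eM x) ^ 2 + (G 0 d (eM x) ^ 2 + G 1 d (eM x) ^ 2)) := tU.2.1.add iG
        have iH0 : Integrable (fun x : E2 => H 0 0 d (eM x) ^ 2 + H 0 1 d (eM x) ^ 2) := (tH 0 0).2.1.add (tH 0 1).2.1
        have iH1 : Integrable (fun x : E2 => H 1 0 d (eM x) ^ 2 + H 1 1 d (eM x) ^ 2) := (tH 1 0).2.1.add (tH 1 1).2.1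
        have iH : Integrable (fun x : E2 => H 0 0 d (eM x) ^ 2 + H 0 1 d (eM x) ^ 2 + (H 1 0 d (eM x) ^ 2 + H 1 1 d (eM x) ^ 2)) := iH0.add iH1
        rw [integral_add iUG iH, integral_add tU.2.1 iG, integral_add (tG 0).2.1 (tG 1).2.1,
          integral_add iH0 iH1, integral_add (tH 0 0).2.1 (tH 0 1).2.1, integral_add (tH 1 0).2.1 (tH 1 1).2.1]
        have := tU.2.2; have := (tG 0).2.2; have := (tG 1).2.2
        have := (tH 0 0).2.2; have := (tH 0 1).2.2; have := (tH 1 0).2.2; have := (tH 1 1).2.2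
        have := (tHG 0 0).2; have := (tHG 0 1).2; have := (tHG 1 0).2; have := (tHG 1 1).2
        rw [hC]
        nlinarith
    · filter_upwards [rφ] with t ht
      rw [eM_apply]
      simp only [PiLp.single_apply]
      simp only [if_true, if_neg (show ¬ (1 : Fin 2) = 0 by decide)]
      rw [u2 t, df]; exact ht.symm
    · filter_upwards [rψ] with t ht
      have e0 : eL (EuclideanSpace.single 0 t) = (t, 0) := by simp [eL_apply]
      have e1 : eL (stdb2 1) = (0, 1) := by simp [eL_apply, stdb2]
      have : fderiv ℝ (U ∘ eL) (EuclideanSpace.single 0 t) (stdb2 1) = ψ t := by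
        rw [fderiv_comp _ ((u1.differentiable (by simp)) _) eL.differentiableAt, ContinuousLinearEquiv.fderiv]
        simp only [ContinuousLinearMap.comp_apply, ContinuousLinearEquiv.coe_coe]
        rw [e0, e1, u3, dg]; exact ht.symm
      exact this
    · intro z1 z2 x hx
      refine UU_supp hK ?_ ?_ _ hx
      · rw [df]; exact neg_zero_of_ae rφ cφ z1
      · rw [dg]; exact neg_zero_of_ae rψ cψ z2
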